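/- arXiv:2002.04713 — 2 statements merged into one kernel-verified Lean document; each statement's English description precedes it below -/
import Mathlib

section
/- Fix degrees d_1, …, d_s ≥ 2 with d := d_1 + ⋯ + d_s. Suppose that for every smooth complete intersection Y ⊂ ℙ^d of s hypersurfaces of degrees d_1, …, d_s, the Fano variety of lines F(Y) has dimension d − s − 2. Then for every n ≥ d and every smooth complete intersection X ⊂ ℙ^n of s hypersurfaces of degrees d_1, …, d_s, the Fano variety of lines F(X) has dimension 2n − d − s − 2. -/
/-! Formalization of: if for every smooth complete intersection Y ⊆ ℙ^d of s hypersurfaces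
of degrees d_1,…,d_s (d = Σ d_i) the Fano variety of lines F(Y) has dimension d − s − 2, then
for every n ≥ d and every smooth complete intersection X ⊆ ℙ^n of the same multidegree,
F(X) has dimension 2n − d − s − 2. -/

noncomputable section

/-- The Zariski topology on complex projective `n`-space `ℙ(ℂ^{n+1})`: it is generated by the
complements of the zero loci of homogeneous polynomials. -/
instance projZariski (n : ℕ) : TopologicalSpace (Projectivization ℂ (Fin (n + 1) → ℂ)) :=
  TopologicalSpace.generateFrom
    {U | ∃ (k : ℕ) (f : MvPolynomial (Fin (n + 1)) ℂ), f.IsHomogeneous k ∧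
      U = {x | MvPolynomial.eval x.rep f ≠ 0}}

/-- The Grassmannian `G(1,n)` of projective lines in `ℙ^n`, i.e. the set of 2-dimensional
linear subspaces of `ℂ^{n+1}`. -/
def ProjLine (n : ℕ) : Type :=
  {W : Submodule ℂ (Fin (n + 1) → ℂ) // Module.finrank ℂ W = 2}

/-- The Zariski topology on the Grassmannian of lines: it is generated by the complements of
the loci of lines `ℙ(W)` on which a fixed polynomial in two vector arguments vanishes
identically on `W × W` (e.g. polynomials in the Plücker coordinates). -/
instance grassZariski (n : ℕ) : TopologicalSpace (ProjLine n) :=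
  TopologicalSpace.generateFrom
    {U | ∃ F : MvPolynomial (Fin (n + 1) ⊕ Fin (n + 1)) ℂ,
      U = {W : ProjLine n | ¬ ∀ u ∈ W.1, ∀ v ∈ W.1, MvPolynomial.eval (Sum.elim u v) F = 0}}

/-- The projective line `ℙ(W) ⊆ ℙ^n` associated to a linear subspace `W ⊆ ℂ^{n+1}`,
as a set of points of `ℙ^n`. -/
def lineSet {n : ℕ} (W : Submodule ℂ (Fin (n + 1) → ℂ)) :
    Set (Projectivization ℂ (Fin (n + 1) → ℂ)) :=
  {x | x.rep ∈ W}

/-- The Fano variety of lines of `X ⊆ ℙ^n`: the subset of the Grassmannian of lines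
consisting of the lines contained in `X`. -/
def fanoLines {n : ℕ} (X : Set (Projectivization ℂ (Fin (n + 1) → ℂ))) : Set (ProjLine n) :=
  {W | lineSet W.1 ⊆ X}

/-- `X ⊆ ℙ^n` is a smooth complete intersection of the `s` hypersurfaces of degrees
`d 0, …, d (s-1)` cut out by the homogeneous polynomials `f 0, …, f (s-1)`:  each `f i` is
homogeneous of degree `d i ≥ 2`, `X` is the common zero locus of the `f i`, `X` has
codimension `s` (i.e. dimension `n - s`), and the Jacobian matrix `(∂f_i/∂x_j)` has rank `s`
at every point of (the affine cone over) `X`. -/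
structure IsSmoothCI (n s : ℕ) (d : Fin s → ℕ) (f : Fin s → MvPolynomial (Fin (n + 1)) ℂ)
    (X : Set (Projectivization ℂ (Fin (n + 1) → ℂ))) : Prop where
  two_le_deg : ∀ i, 2 ≤ d i
  homog : ∀ i, (f i).IsHomogeneous (d i)
  locus : X = {x | ∀ i, MvPolynomial.eval x.rep (f i) = 0}
  codim : topologicalKrullDim ↥X = ((n - s : ℕ) : WithBot ℕ∞)
  smooth : ∀ v : Fin (n + 1) → ℂ, v ≠ 0 → (∀ i, MvPolynomial.eval v (f i) = 0) →
    (Matrix.of fun i j => MvPolynomial.eval v (MvPolynomial.pderiv j (f i))).rank = s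




open scoped IntermediateField.algebraAdjoinAdjoin in
lemma fano_kaehler_indep (k : Subfield ℂ) {ι : Type} (v : ι → ℂ)
    (hv : IsTranscendenceBasis k v) :
    LinearIndependent ℂ (fun j => KaehlerDifferential.D k ℂ (v j)) := by
  classical
  let S := Algebra.adjoin k (Set.range v)
  let F := IntermediateField.adjoin k (Set.range v)
  have h1 : Algebra.FormallyEtale S F := .of_isLocalization (nonZeroDivisors _)
  have h0 : Algebra.IsAlgebraic S ℂ := hv.isAlgebraic
  have h2 : Algebra.IsAlgebraic F ℂ := Algebra.IsAlgebraic.extendScalars (R := S) (S := F)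
    (FaithfulSMul.algebraMap_injective S F)
  have h3 : Algebra.FormallyEtale F ℂ := Algebra.FormallyEtale.of_isSeparable _ _
  have h4 : Algebra.FormallyEtale S ℂ := .comp _ F _
  let e := hv.1.aevalEquiv
  let L (i : ι) : S →ₗ[k] ℂ := (Algebra.linearMap S ℂ).restrictScalars k ∘ₗ e.toLinearMap ∘ₗ
      (MvPolynomial.pderiv (R := k) i).toLinearMap ∘ₗ e.symm.toLinearMap
  let der (i : ι) : Derivation k S ℂ := Derivation.mk' (L i) (by
    intro a b
    simp [L, Algebra.smul_def])
  let φ (i : ι) : Ω[ℂ⁄k] →ₗ[ℂ] ℂ :=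
    (LinearMap.liftBaseChange ℂ (der i).liftKaehlerDifferential) ∘ₗ
      (KaehlerDifferential.tensorKaehlerEquivOfFormallyEtale k S ℂ).symm.toLinearMap
  have hφ : ∀ i j, φ i (KaehlerDifferential.D k ℂ (v j)) = if i = j then 1 else 0 := by
    intro i j
    have : v j = algebraMap S ℂ (e (MvPolynomial.X j)) := (hv.1.algebraMap_aevalEquiv (MvPolynomial.X j)).symm ▸ (MvPolynomial.aeval_X v j).symm
    rw [this]
    simp only [φ, LinearMap.comp_apply, LinearEquiv.coe_coe]
    rw [KaehlerDifferential.tensorKaehlerEquivOfFormallyEtale_symm_D_algebraMap]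
    rw [LinearMap.liftBaseChange_tmul, one_smul, Derivation.liftKaehlerDifferential_comp_D]
    have h5 : der i (e (MvPolynomial.X j)) =
      algebraMap S ℂ (e (MvPolynomial.pderiv (R := k) i (e.symm (e (MvPolynomial.X j))))) := rfl
    rw [h5, AlgEquiv.symm_apply_apply, MvPolynomial.pderiv_X, Pi.single_apply]
    split_ifs with h h' h'
    · rw [map_one, map_one]
    · exact absurd h.symm h'
    · exact absurd h'.symm h
    · rw [map_zero, map_zero]
  rw [linearIndependent_iff']
  intro s g hg i hi
  have := congrArg (φ i) hg
  simpa [hφ, hi] using this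

lemma fano_exists_indep (k : Subfield ℂ) (hk : Countable k) (m : ℕ) :
    ∃ t : Fin m → ℂ, LinearIndependent ℂ (fun j => KaehlerDifferential.D k ℂ (t j)) := by
  obtain ⟨s, hs⟩ := exists_isTranscendenceBasis k ℂ
  have hl := fano_kaehler_indep k _ hs
  have hinf : Infinite s := by
    by_contra hfin
    rw [not_infinite_iff_finite] at hfin
    have := IsAlgClosed.cardinal_le_max_transcendence_basis' _ hs
    have h2 : Cardinal.mk ℂ ≤ Cardinal.aleph0 := this.trans (by
      simp [Cardinal.mk_le_aleph0])
    rw [Cardinal.mk_complex] at h2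
    exact absurd h2 (not_le.mpr Cardinal.aleph0_lt_continuum)
  let f : Fin m ↪ s := (Fin.valEmbedding).trans (Infinite.natEmbedding s)
  exact ⟨fun j => (f j : ℂ), hl.comp f f.injective⟩


lemma fano_descend (k : Subfield ℂ) {σ : Type} (f : MvPolynomial σ ℂ)
    (hf : ∀ m, f.coeff m ∈ k) : ∃ f' : MvPolynomial σ k, MvPolynomial.map k.subtype f' = f := by
  have : f ∈ Set.range (MvPolynomial.map (σ := σ) k.subtype) := by
    rw [MvPolynomial.mem_range_map_iff_coeffs_subset]
    intro c hc
    obtain ⟨m, _, rfl⟩ := MvPolynomial.mem_coeffs_iff.mp hc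
    exact ⟨⟨_, hf m⟩, rfl⟩
  exact this

lemma fano_D_aeval (k : Subfield ℂ) {σ : Type} [Fintype σ] (x : σ → ℂ)
    (f : MvPolynomial σ ℂ) (hf : ∀ m, f.coeff m ∈ k) :
    KaehlerDifferential.D k ℂ (MvPolynomial.eval x f) =
      ∑ j, MvPolynomial.eval x (MvPolynomial.pderiv j f) • KaehlerDifferential.D k ℂ (x j) := by
  classical
  obtain ⟨f', rfl⟩ := fano_descend k f hf
  clear hf
  induction f' using MvPolynomial.induction_on with
  | C a =>
    have : (MvPolynomial.eval x) (MvPolynomial.map k.subtype (MvPolynomial.C a)) =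
      algebraMap k ℂ a := by simp; rfl
    rw [this, Derivation.map_algebraMap]
    simp
  | add p q hp hq =>
    simp only [map_add, hp, hq, add_smul, Finset.sum_add_distrib]
  | mul_X p i hp =>
    simp only [map_mul, MvPolynomial.map_X, MvPolynomial.eval_X, Derivation.leibniz, hp,
      map_add, MvPolynomial.pderiv_X, smul_eq_mul, add_smul, Finset.sum_add_distrib]
    congr 1
    · rw [Finset.sum_eq_single i]
      · simp
      · intro j _ hj
        simp [Pi.single_apply, hj.symm]
      · simp
    · rw [Finset.smul_sum]
      simp [mul_smul]

lemma fano_D_adjoin (k : Subfield ℂ) (A : Set ℂ) (z : ℂ) (hz : z ∈ Algebra.adjoin k A) :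
    KaehlerDifferential.D k ℂ z ∈ Submodule.span ℂ (KaehlerDifferential.D k ℂ '' A) := by
  induction hz using Algebra.adjoin_induction with
  | mem x hx => exact Submodule.subset_span ⟨x, hx, rfl⟩
  | algebraMap r => rw [Derivation.map_algebraMap]; exact zero_mem _
  | add x y _ _ hx hy => rw [map_add]; exact add_mem hx hy
  | mul x y _ _ hx hy =>
    rw [Derivation.leibniz]
    exact add_mem (Submodule.smul_mem _ _ hy) (Submodule.smul_mem _ _ hx)

lemma fano_eval_mem_adjoin (k : Subfield ℂ) {σ : Type} (A : Set ℂ) (x : σ → ℂ)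
    (hx : ∀ a, x a ∈ Algebra.adjoin k A)
    (f : MvPolynomial σ ℂ) (hf : ∀ m, f.coeff m ∈ k) :
    MvPolynomial.eval x f ∈ Algebra.adjoin k A := by
  rw [MvPolynomial.eval_eq]
  refine Subalgebra.sum_mem _ fun m _ => Subalgebra.mul_mem _ ?_ ?_
  · exact Subalgebra.algebraMap_mem _ (⟨_, hf m⟩ : k)
  · exact Subalgebra.prod_mem _ fun i _ => Subalgebra.pow_mem _ (hx i) _

lemma fano_pderiv_coeff_mem (k : Subfield ℂ) {σ : Type}
    (f : MvPolynomial σ ℂ) (hf : ∀ m, f.coeff m ∈ k) (j : σ) (m) :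
    (MvPolynomial.pderiv j f).coeff m ∈ k := by
  classical
  obtain ⟨f', rfl⟩ := fano_descend k f hf
  rw [MvPolynomial.pderiv_map, MvPolynomial.coeff_map]
  exact Subtype.property _

lemma fano_exists_subfield (S : Set ℂ) (hS : S.Countable) :
    ∃ k : Subfield ℂ, Countable k ∧ S ⊆ k := by
  refine ⟨Subfield.closure S, ?_, Subfield.subset_closure⟩
  have := Subfield.cardinalMk_closure_le_max S
  rw [← Cardinal.mk_le_aleph0_iff]
  refine this.trans ?_
  simp [hS.to_subtype]

lemma fano_euler {σ : Type} [Fintype σ] {f : MvPolynomial σ ℂ} {d : ℕ}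
    (hf : f.IsHomogeneous d) (x : σ → ℂ) :
    ∑ a, x a * MvPolynomial.eval x (MvPolynomial.pderiv a f) = d * MvPolynomial.eval x f := by
  have := congrArg (MvPolynomial.eval x) hf.sum_X_mul_pderiv
  simpa using this

lemma fano_eval_smul {σ : Type} {f : MvPolynomial σ ℂ} {d : ℕ}
    (hf : f.IsHomogeneous d) (c : ℂ) (x : σ → ℂ) :
    MvPolynomial.eval (c • x) f = c ^ d * MvPolynomial.eval x f := by
  rw [MvPolynomial.eval_eq, MvPolynomial.eval_eq, Finset.mul_sum]
  refine Finset.sum_congr rfl fun m hm => ?_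
  have h1 : m.degree = d := by
    rw [Finsupp.degree_eq_weight_one]
    exact hf (MvPolynomial.mem_support_iff.mp hm)
  have h2 : ∏ i ∈ m.support, (c • x) i ^ m i = c ^ d * ∏ i ∈ m.support, x i ^ m i := by
    simp only [Pi.smul_apply, smul_eq_mul, mul_pow, Finset.prod_mul_distrib]
    rw [Finset.prod_pow_eq_pow_sum, ← h1]
    rfl
  rw [h2]
  ring

lemma fano_bertini (n s : ℕ) (d : Fin s → ℕ) (f : Fin s → MvPolynomial (Fin (n + 1)) ℂ)
    (hf : ∀ i, (f i).IsHomogeneous (d i)) {w m : ℕ}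
    (b : Module.Basis (Fin w ⊕ Fin m) ℂ (Fin (n + 1) → ℂ)) (hwm : w + s ≤ m) :
    ∃ h : (Fin (n + 1) → ℂ) →ₗ[ℂ] ℂ, (∀ r, h (b (Sum.inl r)) = 0) ∧
      ∀ x : Fin (n + 1) → ℂ, x ≠ 0 → (∀ i, MvPolynomial.eval x (f i) = 0) → ∀ c : Fin s → ℂ,
        ¬ ∀ j, h (Pi.single j 1) =
          ∑ i, c i * MvPolynomial.eval x (MvPolynomial.pderiv j (f i)) := by
  classical
  -- the countable field of definition
  let S : Set ℂ := (⋃ i, Set.range fun m => (f i).coeff m) ∪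
    (Set.range fun p : (Fin w ⊕ Fin m) × Fin (n + 1) => b p.1 p.2) ∪
    (Set.range fun p : (Fin w ⊕ Fin m) × Fin (n + 1) => b.repr (Pi.single p.2 1) p.1)
  have hS : S.Countable := by
    refine Set.Countable.union (Set.Countable.union ?_ ?_) ?_
    · exact Set.countable_iUnion fun i => Set.countable_range _
    · exact Set.countable_range _
    · exact Set.countable_range _
  obtain ⟨k, hk, hSk⟩ := fano_exists_subfield S hS
  have hfk : ∀ i m, (f i).coeff m ∈ k := fun i m =>
    hSk (Or.inl (Or.inl (Set.mem_iUnion.mpr ⟨i, m, rfl⟩)))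
  have hbk : ∀ r a, b r a ∈ k := fun r a => hSk (Or.inl (Or.inr ⟨(r, a), rfl⟩))
  have hrk : ∀ r a, b.repr (Pi.single a 1) r ∈ k := fun r a => hSk (Or.inr ⟨(r, a), rfl⟩)
  obtain ⟨t, ht⟩ := fano_exists_indep k hk m
  let D := KaehlerDifferential.D k ℂ
  have hDk : ∀ z ∈ k, D z = 0 := fun z hz => D.map_algebraMap (⟨z, hz⟩ : k)
  let h : (Fin (n + 1) → ℂ) →ₗ[ℂ] ℂ := ∑ j, t j • b.coord (Sum.inr j)
  have hh : ∀ v, h v = ∑ j, t j * b.repr v (Sum.inr j) := fun v => by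
    simp [h, LinearMap.sum_apply]
  have hlin : ∀ v, h v = ∑ a, v a * h (Pi.single a 1) := fun v => by
    conv_lhs => rw [pi_eq_sum_univ' v, map_sum]
    simp only [map_smul, smul_eq_mul]
  refine ⟨h, fun r => by simp [hh, Finsupp.single_apply], ?_⟩
  intro x hx hfx c hc
  -- first step: x lies in the span of the first w basis vectors
  have step1 : ∀ j, b.repr x (Sum.inr j) = 0 := by
    have hx0 : ∑ j, t j * b.repr x (Sum.inr j) = 0 := by
      rw [← hh, hlin]
      simp only [hc, Finset.mul_sum]
      rw [Finset.sum_comm]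
      refine Finset.sum_eq_zero fun i _ => ?_
      have := fano_euler (hf i) x
      rw [hfx i, mul_zero] at this
      calc _ = c i * ∑ a, x a * MvPolynomial.eval x (MvPolynomial.pderiv a (f i)) := by
            rw [Finset.mul_sum]; exact Finset.sum_congr rfl fun a _ => by ring
        _ = 0 := by rw [this, mul_zero]
    have hDc : ∀ j, D (b.repr x (Sum.inr j)) =
        ∑ a, b.repr (Pi.single a 1) (Sum.inr j) • D (x a) := by
      intro j
      have : b.repr x (Sum.inr j) = ∑ a, x a * b.repr (Pi.single a 1) (Sum.inr j) := by
        conv_lhs => rw [pi_eq_sum_univ' x, map_sum]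
        simp only [map_smul, Finsupp.coe_finset_sum, Finset.sum_apply, Finsupp.coe_smul,
          Pi.smul_apply, smul_eq_mul]
      rw [this, map_sum]
      refine Finset.sum_congr rfl fun a _ => ?_
      rw [D.leibniz, hDk _ (hrk _ a), smul_zero, zero_add]
    have hD0 : ∑ j, t j • D (b.repr x (Sum.inr j)) = 0 := by
      have h1 : ∑ j, t j • D (b.repr x (Sum.inr j)) = ∑ a, h (Pi.single a 1) • D (x a) := by
        simp only [hDc, hh, Finset.smul_sum, Finset.sum_smul, smul_smul]
        rw [Finset.sum_comm]
      rw [h1]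
      simp only [hc, Finset.sum_smul]
      rw [Finset.sum_comm]
      refine Finset.sum_eq_zero fun i _ => ?_
      have h2 := fano_D_aeval k x (f i) (hfk i)
      rw [hfx i, map_zero] at h2
      calc _ = c i • ∑ a, MvPolynomial.eval x (MvPolynomial.pderiv a (f i)) • D (x a) := by
            rw [Finset.smul_sum]; exact Finset.sum_congr rfl fun a _ => by rw [smul_smul]
        _ = 0 := by rw [← h2, smul_zero]
    have h3 := congrArg D hx0
    rw [map_zero, map_sum] at h3
    simp only [D.leibniz, Finset.sum_add_distrib] at h3
    rw [hD0, zero_add] at h3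
    exact fun j => linearIndependent_iff'.mp ht Finset.univ _ h3 j (Finset.mem_univ j)
  -- second step: transcendence degree count
  obtain ⟨r0, hr0⟩ : ∃ r, b.repr x (Sum.inl r) ≠ 0 := by
    by_contra hcon
    push Not at hcon
    apply hx
    apply b.repr.injective
    ext (r | j)
    · simp [hcon r]
    · simp [step1 j]
  set α := b.repr x (Sum.inl r0) with hα
  let x' := α⁻¹ • x
  let a' : Fin w → ℂ := fun r => b.repr x' (Sum.inl r)
  let c' : Fin s → ℂ := fun i => c i * α ^ (d i - 1)
  have hx' : x' = ∑ r, a' r • b (Sum.inl r) := by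
    conv_lhs => rw [← b.sum_repr x']
    rw [Fintype.sum_sum_type]
    simp [a', x', step1]
  have ha0 : a' r0 = 1 := by simp [a', x', ← hα, hr0]
  have hc' : ∀ j, h (Pi.single j 1) =
      ∑ i, c' i * MvPolynomial.eval x' (MvPolynomial.pderiv j (f i)) := by
    intro j
    rw [hc j]
    refine Finset.sum_congr rfl fun i _ => ?_
    rw [fano_eval_smul (hf i).pderiv]
    simp only [c', inv_pow]
    field_simp
  let g : Fin w ⊕ Fin s → ℂ := Sum.elim a' c'
  have htj : ∀ j, t j ∈ Algebra.adjoin k (Set.range g) := by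
    intro j
    have h1 : t j = h (b (Sum.inr j)) := by simp [hh, Finsupp.single_apply]
    have hx'm : ∀ a, x' a ∈ Algebra.adjoin k (Set.range g) := by
      intro a
      rw [hx', Finset.sum_apply]
      refine Subalgebra.sum_mem _ fun r _ => ?_
      exact Subalgebra.mul_mem _ (Algebra.subset_adjoin ⟨Sum.inl r, rfl⟩)
        (Subalgebra.algebraMap_mem _ (⟨_, hbk (Sum.inl r) a⟩ : k))
    rw [h1, hlin]
    refine Subalgebra.sum_mem _ fun a _ => Subalgebra.mul_mem _
      (Subalgebra.algebraMap_mem _ (⟨_, hbk (Sum.inr j) a⟩ : k)) ?_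
    rw [hc']
    refine Subalgebra.sum_mem _ fun i _ => Subalgebra.mul_mem _
      (Algebra.subset_adjoin ⟨Sum.inr i, rfl⟩) ?_
    exact fano_eval_mem_adjoin k _ _ hx'm _ (fano_pderiv_coeff_mem k _ (hfk i) a)
  let T : Finset Ω[ℂ⁄k] := (Finset.univ.erase (Sum.inl r0)).image fun p => D (g p)
  have hspan : ∀ j, D (t j) ∈ Submodule.span ℂ (T : Set Ω[ℂ⁄k]) := by
    intro j
    refine Submodule.span_le.mpr ?_ (fano_D_adjoin k _ _ (htj j))
    rintro _ ⟨_, ⟨p, rfl⟩, rfl⟩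
    by_cases hp : p = Sum.inl r0
    · have h1 : g p = 1 := by rw [hp]; exact ha0
      change D (g p) ∈ _
      rw [h1, D.map_one_eq_zero]
      exact zero_mem _
    · exact Submodule.subset_span (Finset.mem_coe.mpr (Finset.mem_image.mpr
        ⟨p, Finset.mem_erase.mpr ⟨hp, Finset.mem_univ _⟩, rfl⟩))
  have hcard : m ≤ T.card := by
    let v : Fin m → Submodule.span ℂ (T : Set Ω[ℂ⁄k]) := fun j => ⟨D (t j), hspan j⟩
    have hv : LinearIndependent ℂ v :=
      LinearIndependent.of_comp (Submodule.subtype _) ht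
    have := hv.fintype_card_le_finrank
    rw [Fintype.card_fin] at this
    exact this.trans (finrank_span_finset_le_card T)
  have hT : T.card ≤ w + s - 1 := by
    refine Finset.card_image_le.trans ?_
    rw [Finset.card_erase_of_mem (Finset.mem_univ _)]
    simp
  have : 0 < w := r0.pos
  omega


/-- The Krull dimension of the poset of primes between `J` and `m`. -/
noncomputable def fanoHt {R : Type*} [CommRing R] (J m : Ideal R) : WithBot ℕ∞ :=
  Order.krullDim {P : PrimeSpectrum R // J ≤ P.asIdeal ∧ P.asIdeal ≤ m}

lemma fano_height {R : Type*} [CommRing R] (p : Ideal R) [hp : p.IsPrime] :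
    p.height = Order.height (⟨p, hp⟩ : PrimeSpectrum R) :=
  PrimeSpectrum.height_eq_orderHeight ⟨p, hp⟩

lemma fanoHt_le_height {R : Type*} [CommRing R] (J m : Ideal R) [hm : m.IsPrime] (hJ : J ≤ m) :
    fanoHt J m ≤ ((m.map (Ideal.Quotient.mk J)).height : WithBot ℕ∞) := by
  have hp : (m.map (Ideal.Quotient.mk J)).IsPrime := Ideal.isPrime_map_quotientMk_of_isPrime hJ
  rw [fano_height _, Order.height_eq_krullDim_Iic]
  have key : ∀ P : {P : PrimeSpectrum R // J ≤ P.asIdeal ∧ P.asIdeal ≤ m},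
      (P.1.asIdeal.map (Ideal.Quotient.mk J)).IsPrime := fun P =>
    haveI := P.1.isPrime
    Ideal.isPrime_map_quotientMk_of_isPrime P.2.1
  refine Order.krullDim_le_of_strictMono
    (fun P => ⟨⟨P.1.asIdeal.map (Ideal.Quotient.mk J), key P⟩, Ideal.map_mono P.2.2⟩) ?_
  have hc : ∀ P : {P : PrimeSpectrum R // J ≤ P.asIdeal ∧ P.asIdeal ≤ m},
      (P.1.asIdeal.map (Ideal.Quotient.mk J)).comap (Ideal.Quotient.mk J) = P.1.asIdeal := by
    intro P
    rw [Ideal.comap_map_of_surjective _ Ideal.Quotient.mk_surjective]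
    refine sup_eq_left.mpr (le_trans ?_ P.2.1)
    intro x hx
    exact Ideal.Quotient.eq_zero_iff_mem.mp (by simpa using hx)
  refine Monotone.strictMono_of_injective ?_ ?_
  · intro P Q hPQ
    exact Ideal.map_mono (show P.1.asIdeal ≤ Q.1.asIdeal from hPQ)
  · intro P Q hPQ
    have h1 : P.1.asIdeal.map (Ideal.Quotient.mk J) = Q.1.asIdeal.map (Ideal.Quotient.mk J) :=
      congrArg (fun Z => Z.1.asIdeal) hPQ
    apply Subtype.ext
    apply PrimeSpectrum.ext
    rw [← hc P, ← hc Q, h1]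

lemma height_le_fanoHt {R Q : Type*} [CommRing R] [CommRing Q] (φ : R →+* Q)
    (hφ : Function.Surjective φ) (J m : Ideal R) (hJ : J ≤ RingHom.ker φ)
    (p : Ideal Q) [hp : p.IsPrime] (hpm : p.comap φ ≤ m) :
    (p.height : WithBot ℕ∞) ≤ fanoHt J m := by
  rw [fano_height _, Order.height_eq_krullDim_Iic]
  refine Order.krullDim_le_of_strictMono
    (fun P => ⟨PrimeSpectrum.comap φ P.1, ?_, ?_⟩) ?_
  · refine hJ.trans ?_
    intro x hx
    change φ x ∈ P.1.asIdeal
    rw [RingHom.mem_ker.mp hx]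
    exact zero_mem _
  · exact (Ideal.comap_mono (show P.1.asIdeal ≤ p from P.2)).trans hpm
  refine Monotone.strictMono_of_injective ?_ ?_
  · intro P Q hPQ
    exact Ideal.comap_mono (show P.1.asIdeal ≤ Q.1.asIdeal from hPQ)
  · intro P Q hPQ
    apply Subtype.ext
    exact PrimeSpectrum.comap_injective_of_surjective φ hφ (congrArg Subtype.val hPQ)

lemma fanoHt_le_add {R : Type*} [CommRing R] [IsNoetherianRing R] (J m : Ideal R)
    [hm : m.IsPrime] (hJ : J ≤ m) {ι : Type*} [Fintype ι] (g : ι → R) (hg : ∀ i, g i ∈ m) :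
    fanoHt J m ≤ fanoHt (J ⊔ Ideal.span (Set.range g)) m + (Fintype.card ι : ℕ) := by
  have hp : (m.map (Ideal.Quotient.mk J)).IsPrime := Ideal.isPrime_map_quotientMk_of_isPrime hJ
  refine (fanoHt_le_height J m hJ).trans ?_
  let s : Set (R ⧸ J) := Set.range fun i => Ideal.Quotient.mk J (g i)
  have hs : s ⊆ (m.map (Ideal.Quotient.mk J) : Ideal (R ⧸ J)) := by
    rintro _ ⟨i, rfl⟩
    exact Ideal.mem_map_of_mem _ (hg i)
  have h1 := Ideal.height_le_height_add_encard_of_subset s hs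
  have hp2 : ((m.map (Ideal.Quotient.mk J)).map (Ideal.Quotient.mk (Ideal.span s))).IsPrime :=
    Ideal.isPrime_map_quotientMk_of_isPrime (Ideal.span_le.mpr hs)
  have h2 : s.encard ≤ (Fintype.card ι : ℕ) := by
    have : s = (fun i => Ideal.Quotient.mk J (g i)) '' Set.univ := by simp [s]
    rw [this]
    refine (Set.encard_image_le _ _).trans ?_
    simp [Set.encard_univ]
  have h3 : (((m.map (Ideal.Quotient.mk J)).map (Ideal.Quotient.mk (Ideal.span s))).height :
      WithBot ℕ∞) ≤ fanoHt (J ⊔ Ideal.span (Set.range g)) m := by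
    refine height_le_fanoHt ((Ideal.Quotient.mk (Ideal.span s)).comp (Ideal.Quotient.mk J))
      (Ideal.Quotient.mk_surjective.comp Ideal.Quotient.mk_surjective) _ _ ?_ _ ?_
    · refine sup_le ?_ (Ideal.span_le.mpr ?_)
      · intro x hx
        simp [RingHom.mem_ker, Ideal.Quotient.eq_zero_iff_mem.mpr hx]
      · rintro _ ⟨i, rfl⟩
        exact Ideal.Quotient.eq_zero_iff_mem.mpr (Ideal.subset_span ⟨i, rfl⟩)
    · rw [← Ideal.comap_comap, Ideal.comap_map_of_surjective _ Ideal.Quotient.mk_surjective]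
      have h4 : (⊥ : Ideal ((R ⧸ J) ⧸ Ideal.span s)).comap (Ideal.Quotient.mk (Ideal.span s)) ≤
          m.map (Ideal.Quotient.mk J) := by
        intro x hx
        exact Ideal.span_le.mpr hs (Ideal.Quotient.eq_zero_iff_mem.mp (by simpa using hx))
      rw [sup_eq_left.mpr h4, Ideal.comap_map_of_surjective _ Ideal.Quotient.mk_surjective]
      refine sup_le le_rfl ?_
      intro x hx
      exact hJ (Ideal.Quotient.eq_zero_iff_mem.mp (by simpa using hx))
  calc ((m.map (Ideal.Quotient.mk J)).height : WithBot ℕ∞)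
      ≤ ((((m.map (Ideal.Quotient.mk J)).map (Ideal.Quotient.mk (Ideal.span s))).height +
        (Fintype.card ι : ℕ) : ℕ∞) : WithBot ℕ∞) := by
        exact_mod_cast h1.trans (by gcongr)
    _ ≤ _ := by
        push_cast
        gcongr

lemma fanoHt_le_zero {R : Type*} [CommRing R] [IsNoetherianRing R] (J m : Ideal R)
    [hm : m.IsPrime] (h : m ≤ J ⊔ m * m) : fanoHt J m ≤ 0 := by
  have key : ∀ P : {P : PrimeSpectrum R // J ≤ P.asIdeal ∧ P.asIdeal ≤ m}, m ≤ P.1.asIdeal := by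
    intro P
    have h1 : m ≤ P.1.asIdeal ⊔ m • m := h.trans (sup_le_sup_right P.2.1 _)
    obtain ⟨r, hr, hrm⟩ := Submodule.exists_sub_one_mem_and_smul_le_of_fg_of_le_sup
      (IsNoetherian.noetherian m) le_rfl h1
    intro x hx
    have h2 : r * x ∈ P.1.asIdeal := hrm (Submodule.smul_mem_pointwise_smul x r m hx)
    refine (P.1.isPrime.mem_or_mem h2).resolve_left fun hrP => ?_
    apply hm.ne_top
    rw [Ideal.eq_top_iff_one]
    have := m.sub_mem (P.2.2 hrP) hr
    simpa using this
  have : Subsingleton {P : PrimeSpectrum R // J ≤ P.asIdeal ∧ P.asIdeal ≤ m} := by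
    constructor
    intro P Q
    apply Subtype.ext
    apply PrimeSpectrum.ext
    rw [le_antisymm P.2.2 (key P), le_antisymm Q.2.2 (key Q)]
  exact Order.krullDim_nonpos_of_subsingleton

/-- maximal ideal of a point -/
noncomputable def fanoMax {σ : Type} (x : σ → ℂ) : Ideal (MvPolynomial σ ℂ) :=
  RingHom.ker (MvPolynomial.eval x)

instance {σ : Type} (x : σ → ℂ) : (fanoMax x).IsPrime := RingHom.ker_isPrime _

lemma mem_fanoMax {σ : Type} (x : σ → ℂ) (g : MvPolynomial σ ℂ) :
    g ∈ fanoMax x ↔ MvPolynomial.eval x g = 0 := Iff.rfl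

lemma card_le_fanoHt_bot {σ : Type} [Fintype σ] (x : σ → ℂ) :
    ((Fintype.card σ : ℕ) : WithBot ℕ∞) ≤ fanoHt ⊥ (fanoMax x) := by
  let e := Fintype.equivFin σ
  let φ (i : ℕ) : MvPolynomial σ ℂ →ₐ[ℂ] MvPolynomial σ ℂ := MvPolynomial.aeval fun j =>
    if (e j : ℕ) < i then MvPolynomial.C (x j) else MvPolynomial.X j
  have hcomp : ∀ i j : ℕ, i ≤ j → ∀ g, φ j (φ i g) = φ j g := by
    intro i j hij g
    have : (φ j).comp (φ i) = φ j := by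
      ext a : 1
      simp only [φ, AlgHom.comp_apply, MvPolynomial.aeval_X]
      split_ifs with h1 h2 h2
      · exact (φ j).commutes (x a)
      · omega
      · simp [h2]
      · simp [h2]
    exact DFunLike.congr_fun this g
  have hev : ∀ i g, MvPolynomial.eval x (φ i g) = MvPolynomial.eval x g := by
    intro i g
    have : (MvPolynomial.aeval x).comp (φ i) = MvPolynomial.aeval (R := ℂ) x := by
      ext a
      simp only [φ, AlgHom.comp_apply, MvPolynomial.aeval_X]
      split_ifs <;> simp
    simpa [MvPolynomial.coe_aeval_eq_eval] using DFunLike.congr_fun this g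
  have hp : ∀ i, (RingHom.ker (φ i)).IsPrime := fun i => RingHom.ker_isPrime _
  refine Order.le_krullDim_iff.mpr ⟨⟨Fintype.card σ, fun i => ⟨⟨RingHom.ker (φ i), hp i⟩,
    bot_le, ?_⟩, ?_⟩, rfl⟩
  · intro g hg
    rw [mem_fanoMax, ← hev i, RingHom.mem_ker.mp hg, map_zero]
  · intro i
    change RingHom.ker (φ (i.castSucc : Fin _)) < RingHom.ker (φ (i.succ : Fin _))
    refine lt_of_le_of_ne ?_ ?_
    · intro g hg
      have h1 : φ (i : ℕ) g = 0 := by simpa using hg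
      change φ ((i.succ : Fin _) : ℕ) g = 0
      rw [← hcomp (i : ℕ) _ (by simp), h1, map_zero]
    · intro heq
      let a := e.symm i
      have h1 : (MvPolynomial.X a - MvPolynomial.C (x a)) ∈ RingHom.ker (φ ((i.succ : Fin _) : ℕ)) := by
        rw [RingHom.mem_ker, map_sub]
        have : φ ((i.succ : Fin _) : ℕ) (MvPolynomial.C (x a)) = MvPolynomial.C (x a) :=
          (φ _).commutes (x a)
        rw [this]
        simp [φ, a]
      have h2 : (MvPolynomial.X a - MvPolynomial.C (x a)) ∈ RingHom.ker (φ (i : ℕ)) := by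
        have h3 : RingHom.ker (φ (i : ℕ)) = RingHom.ker (φ ((i.succ : Fin _) : ℕ)) := by
          simpa using heq
        rw [h3]; exact h1
      rw [RingHom.mem_ker, map_sub] at h2
      have h4 : φ (i : ℕ) (MvPolynomial.C (x a)) = MvPolynomial.C (x a) := (φ _).commutes (x a)
      rw [h4] at h2
      have h5 : φ (i : ℕ) (MvPolynomial.X a) = MvPolynomial.X a := by simp [φ, a]
      rw [h5] at h2
      have h6 := congrArg (MvPolynomial.eval (fun _ => x a + 1)) h2
      simp at h6

open scoped Topology


/-- Krull dimension of a space at a point. -/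
noncomputable def fanoLocDim (T : Type*) [TopologicalSpace T] (p : T) : WithBot ℕ∞ :=
  Order.krullDim {Z : TopologicalSpace.IrreducibleCloseds T // p ∈ (Z : Set T)}

lemma fanoLocDim_le (T : Type*) [TopologicalSpace T] (p : T) :
    fanoLocDim T p ≤ topologicalKrullDim T :=
  Order.krullDim_le_of_strictMono (fun Z => Z.1) fun _ _ h => h

lemma fano_dim_le_of_locDim (T : Type*) [TopologicalSpace T] (N : WithBot ℕ∞)
    (h : ∀ p, fanoLocDim T p ≤ N) : topologicalKrullDim T ≤ N := by
  refine iSup_le fun l => ?_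
  obtain ⟨p, hp⟩ := (l 0).isIrreducible.nonempty
  refine le_trans ?_ (h p)
  refine Order.le_krullDim_iff.mpr ⟨⟨l.length, fun i => ⟨l i, ?_⟩, ?_⟩, rfl⟩
  · have h1 : l 0 ≤ l i := l.strictMono.monotone (Fin.zero_le i)
    exact h1 hp
  · intro i
    exact l.step i

/-- The Zariski topology on affine space. -/
@[reducible]
noncomputable def fanoZar (σ : Type) : TopologicalSpace (σ → ℂ) :=
  TopologicalSpace.induced (MvPolynomial.pointToPoint (k := ℂ) (K := ℂ)) inferInstance

lemma fanoZar_isClosed {σ : Type} (C : Set (σ → ℂ)) :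
    IsClosed[fanoZar σ] C ↔ ∃ I : Set (MvPolynomial σ ℂ),
      C = {x | ∀ g ∈ I, MvPolynomial.eval x g = 0} := by
  rw [isClosed_induced_iff]
  have key : ∀ I : Set (MvPolynomial σ ℂ),
      (MvPolynomial.pointToPoint (k := ℂ) (K := ℂ)) ⁻¹' (PrimeSpectrum.zeroLocus I) =
      {x | ∀ g ∈ I, MvPolynomial.eval x g = 0} := by
    intro I
    ext x
    simp only [Set.mem_preimage, PrimeSpectrum.mem_zeroLocus, Set.mem_setOf_eq]
    constructor
    · intro h g hg
      have := h hg
      simpa [MvPolynomial.pointToPoint] using this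
    · intro h g hg
      have := h g hg
      simpa [MvPolynomial.pointToPoint] using this
  constructor
  · rintro ⟨t, ht, rfl⟩
    obtain ⟨I, rfl⟩ := (PrimeSpectrum.isClosed_iff_zeroLocus t).mp ht
    exact ⟨I, key I⟩
  · rintro ⟨I, rfl⟩
    exact ⟨_, PrimeSpectrum.isClosed_zeroLocus I, key I⟩

lemma fano_eval_zero_of_prime {σ : Type} [Finite σ] (P : Ideal (MvPolynomial σ ℂ)) [P.IsPrime]
    (g : MvPolynomial σ ℂ)
    (h : ∀ x : σ → ℂ, (∀ q ∈ P, MvPolynomial.eval x q = 0) → MvPolynomial.eval x g = 0) :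
    g ∈ P := by
  rw [← MvPolynomial.IsPrime.vanishingIdeal_zeroLocus (K := ℂ) P]
  rw [MvPolynomial.mem_vanishingIdeal_iff]
  intro x hx
  have := h x (fun q hq => by simpa using (MvPolynomial.mem_zeroLocus_iff.mp hx) q hq)
  simpa using this

/-- affine charts -/
structure FanoChart {σ : Type} {T : Type*} [TopologicalSpace T] (φ : (σ → ℂ) → T) : Prop where
  isOpen : IsOpen (Set.range φ)
  cont : ∀ C : Set T, IsClosed C → ∃ I : Set (MvPolynomial σ ℂ),
      φ ⁻¹' C = {x | ∀ g ∈ I, MvPolynomial.eval x g = 0}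
  closed : ∀ g : MvPolynomial σ ℂ, ∃ C : Set T, IsClosed C ∧
      φ ⁻¹' C = {x | MvPolynomial.eval x g = 0}

lemma FanoChart.mk' {σ : Type} {T : Type*} (B : Set (Set T)) (φ : (σ → ℂ) → T)
    (h1 : IsOpen[TopologicalSpace.generateFrom B] (Set.range φ))
    (h2 : ∀ U ∈ B, ∃ I : Set (MvPolynomial σ ℂ),
      φ ⁻¹' U = {x | ¬ ∀ g ∈ I, MvPolynomial.eval x g = 0})
    (h3 : ∀ g : MvPolynomial σ ℂ, ∃ U : Set T, IsOpen[TopologicalSpace.generateFrom B] U ∧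
      φ ⁻¹' U = {x | MvPolynomial.eval x g ≠ 0}) :
    @FanoChart σ T (TopologicalSpace.generateFrom B) φ := by
  letI := TopologicalSpace.generateFrom B
  refine ⟨h1, ?_, ?_⟩
  · letI := fanoZar σ
    have hc : Continuous φ := by
      refine continuous_generateFrom_iff.mpr ?_
      intro U hU
      obtain ⟨I, hI⟩ := h2 U hU
      rw [hI, ← isClosed_compl_iff, fanoZar_isClosed]
      refine ⟨I, ?_⟩
      ext x
      simp
    intro C hC
    exact (fanoZar_isClosed _).mp (hC.preimage hc)
  · intro g
    obtain ⟨U, hU, hU'⟩ := h3 g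
    refine ⟨Uᶜ, hU.isClosed_compl, ?_⟩
    rw [Set.preimage_compl, hU']
    ext x
    simp

lemma FanoChart.closedIdeal {σ : Type} {T : Type*} [TopologicalSpace T] {φ : (σ → ℂ) → T}
    (hφ : FanoChart φ) (I : Ideal (MvPolynomial σ ℂ)) : ∃ C : Set T, IsClosed C ∧
      φ ⁻¹' C = {x | ∀ g ∈ I, MvPolynomial.eval x g = 0} := by
  choose C hC hC' using hφ.closed
  refine ⟨⋂ g ∈ I, C g, isClosed_biInter fun g _ => hC g, ?_⟩
  ext x
  simp only [Set.preimage_iInter, Set.mem_iInter, hC', Set.mem_setOf_eq]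


lemma FanoChart.locDim_ge {σ : Type} [Finite σ] {T : Type*} [TopologicalSpace T] {φ : (σ → ℂ) → T}
    (hφ : FanoChart φ) (S : Set T) (J : Ideal (MvPolynomial σ ℂ))
    (hJ : ∀ x, φ x ∈ S ↔ ∀ g ∈ J, MvPolynomial.eval x g = 0) (p : σ → ℂ) (hp : φ p ∈ S) :
    fanoHt J (fanoMax p) ≤ fanoLocDim S ⟨φ p, hp⟩ := by
  rw [fanoLocDim, ← Order.krullDim_orderDual]
  let V (P : Ideal (MvPolynomial σ ℂ)) : Set S :=
    {z | ∃ x, (∀ g ∈ P, MvPolynomial.eval x g = 0) ∧ φ x = z}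
  have hVmono : ∀ P Q, P ≤ Q → V Q ⊆ V P := fun P Q h z ⟨x, hx, hz⟩ =>
    ⟨x, fun g hg => hx g (h hg), hz⟩
  have hVp : ∀ P, P ≤ fanoMax p → ⟨φ p, hp⟩ ∈ V P := fun P hP => ⟨p, fun g hg => hP hg, rfl⟩
  have hVirr : ∀ P : Ideal (MvPolynomial σ ℂ), P.IsPrime → J ≤ P → P ≤ fanoMax p →
      IsIrreducible (V P) := by
    intro P hP hJP hPm
    refine ⟨⟨_, hVp P hPm⟩, ?_⟩
    rintro u v ⟨O1, hO1, rfl⟩ ⟨O2, hO2, rfl⟩ ⟨z1, ⟨x1, hx1, hz1⟩, hz1'⟩ ⟨z2, ⟨x2, hx2, hz2⟩, hz2'⟩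
    obtain ⟨I1, hI1⟩ := hφ.cont _ hO1.isClosed_compl
    obtain ⟨I2, hI2⟩ := hφ.cont _ hO2.isClosed_compl
    have hI1' : ∀ x, φ x ∈ O1 ↔ ∃ g ∈ I1, MvPolynomial.eval x g ≠ 0 := by
      intro x
      have := Set.ext_iff.mp hI1 x
      simp only [Set.mem_preimage, Set.mem_compl_iff, Set.mem_setOf_eq] at this
      rw [← not_iff_not, this]; push Not; rfl
    have hI2' : ∀ x, φ x ∈ O2 ↔ ∃ g ∈ I2, MvPolynomial.eval x g ≠ 0 := by
      intro x
      have := Set.ext_iff.mp hI2 x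
      simp only [Set.mem_preimage, Set.mem_compl_iff, Set.mem_setOf_eq] at this
      rw [← not_iff_not, this]; push Not; rfl
    obtain ⟨g1, hg1, hg1'⟩ := (hI1' x1).mp (by rw [hz1]; exact hz1')
    obtain ⟨g2, hg2, hg2'⟩ := (hI2' x2).mp (by rw [hz2]; exact hz2')
    have h1 : g1 ∉ P := fun h => hg1' (hx1 _ h)
    have h2 : g2 ∉ P := fun h => hg2' (hx2 _ h)
    have h12 : g1 * g2 ∉ P := fun h => (hP.mem_or_mem h).elim h1 h2
    have : ∃ x : σ → ℂ, (∀ q ∈ P, MvPolynomial.eval x q = 0) ∧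
        MvPolynomial.eval x (g1 * g2) ≠ 0 := by
      by_contra hcon
      push Not at hcon
      exact h12 (fano_eval_zero_of_prime P _ hcon)
    obtain ⟨x, hxP, hx⟩ := this
    rw [map_mul] at hx
    have hxS : φ x ∈ S := (hJ x).mpr fun g hg => hxP g (hJP hg)
    exact ⟨⟨φ x, hxS⟩, ⟨x, hxP, rfl⟩, (hI1' x).mpr ⟨g1, hg1, left_ne_zero_of_mul hx⟩,
      (hI2' x).mpr ⟨g2, hg2, right_ne_zero_of_mul hx⟩⟩
  have hVcl : ∀ P : Ideal (MvPolynomial σ ℂ), ∀ x, ∀ hx : φ x ∈ S, ⟨φ x, hx⟩ ∈ closure (V P) →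
      ∀ g ∈ P, MvPolynomial.eval x g = 0 := by
    intro P x hx hcl
    obtain ⟨C, hC, hC'⟩ := hφ.closedIdeal P
    have h1 : closure (V P) ⊆ Subtype.val ⁻¹' C := by
      refine closure_minimal ?_ (hC.preimage continuous_subtype_val)
      rintro z ⟨y, hy, hz⟩
      rw [Set.mem_preimage, ← hz]
      have : y ∈ φ ⁻¹' C := by rw [hC']; exact hy
      exact this
    have h2 : x ∈ φ ⁻¹' C := h1 hcl
    rw [hC'] at h2
    exact h2
  refine Order.krullDim_le_of_strictMono (fun P => OrderDual.toDual
    ⟨⟨closure (V P.1.asIdeal), (hVirr _ P.1.isPrime P.2.1 P.2.2).closure, isClosed_closure⟩,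
      subset_closure (hVp _ P.2.2)⟩) ?_
  refine Monotone.strictMono_of_injective ?_ ?_
  · intro P Q hPQ
    exact closure_mono (hVmono _ _ hPQ)
  · intro P Q hPQ
    have h1 : closure (V P.1.asIdeal) = closure (V Q.1.asIdeal) :=
      congrArg (fun Z => ((OrderDual.ofDual Z).1 : Set S)) hPQ
    have key : ∀ P Q : {P : PrimeSpectrum (MvPolynomial σ ℂ) //
        J ≤ P.asIdeal ∧ P.asIdeal ≤ fanoMax p},
        closure (V P.1.asIdeal) = closure (V Q.1.asIdeal) → P.1.asIdeal ≤ Q.1.asIdeal := by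
      intro P Q h g hg
      haveI := Q.1.isPrime
      refine fano_eval_zero_of_prime Q.1.asIdeal g fun x hx => ?_
      have hxS : φ x ∈ S := (hJ x).mpr fun g hg => hx g (Q.2.1 hg)
      refine hVcl P.1.asIdeal x hxS ?_ g hg
      rw [h]
      exact subset_closure ⟨x, hx, rfl⟩
    apply Subtype.ext
    apply PrimeSpectrum.ext
    exact le_antisymm (key P Q h1) (key Q P h1.symm)

lemma FanoChart.locDim_le {σ : Type} [Finite σ] {T : Type*} [TopologicalSpace T] {φ : (σ → ℂ) → T}
    (hφ : FanoChart φ) (S : Set T) (J : Ideal (MvPolynomial σ ℂ))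
    (hJ : ∀ x, φ x ∈ S ↔ ∀ g ∈ J, MvPolynomial.eval x g = 0) (p : σ → ℂ) (hp : φ p ∈ S) :
    fanoLocDim S ⟨φ p, hp⟩ ≤ fanoHt J (fanoMax p) := by
  rw [fanoLocDim, ← Order.krullDim_orderDual]
  let I (Z : Set S) : Ideal (MvPolynomial σ ℂ) :=
    { carrier := {g | ∀ x, ∀ hx : φ x ∈ S, (⟨φ x, hx⟩ : S) ∈ Z → MvPolynomial.eval x g = 0}
      add_mem' := fun {a b} ha hb x hx hz => by rw [map_add, ha x hx hz, hb x hx hz, add_zero]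
      zero_mem' := fun x hx hz => map_zero _
      smul_mem' := fun c a ha x hx hz => by rw [smul_eq_mul, map_mul, ha x hx hz, mul_zero] }
  have hIprime : ∀ Z : Set S, IsIrreducible Z → ⟨φ p, hp⟩ ∈ Z → (I Z).IsPrime := by
    intro Z hZ hpZ
    refine ⟨?_, ?_⟩
    · intro htop
      have h1 : (1 : MvPolynomial σ ℂ) ∈ I Z := by rw [htop]; trivial
      have := h1 p hp hpZ
      simp at this
    · intro g h hgh
      by_contra hcon
      push Not at hcon
      obtain ⟨hg, hh⟩ := hcon
      have hg' : ∃ x, ∃ hx : φ x ∈ S, (⟨φ x, hx⟩ : S) ∈ Z ∧ MvPolynomial.eval x g ≠ 0 := by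
        by_contra hc; push Not at hc; exact hg hc
      have hh' : ∃ x, ∃ hx : φ x ∈ S, (⟨φ x, hx⟩ : S) ∈ Z ∧ MvPolynomial.eval x h ≠ 0 := by
        by_contra hc; push Not at hc; exact hh hc
      obtain ⟨x1, hx1, hz1, hgx1⟩ := hg'
      obtain ⟨x2, hx2, hz2, hhx2⟩ := hh'
      obtain ⟨C1, hC1, hC1'⟩ := hφ.closed g
      obtain ⟨C2, hC2, hC2'⟩ := hφ.closed h
      have e1 : ∀ x, φ x ∈ C1 ↔ MvPolynomial.eval x g = 0 := fun x => Set.ext_iff.mp hC1' x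
      have e2 : ∀ x, φ x ∈ C2 ↔ MvPolynomial.eval x h = 0 := fun x => Set.ext_iff.mp hC2' x
      obtain ⟨z, hzZ, hz⟩ := hZ.2 (Subtype.val ⁻¹' (Set.range φ ∩ C1ᶜ))
        (Subtype.val ⁻¹' (Set.range φ ∩ C2ᶜ))
        ((hφ.isOpen.inter hC1.isOpen_compl).preimage continuous_subtype_val)
        ((hφ.isOpen.inter hC2.isOpen_compl).preimage continuous_subtype_val)
        ⟨⟨φ x1, hx1⟩, hz1, ⟨x1, rfl⟩, fun hc => hgx1 ((e1 x1).mp hc)⟩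
        ⟨⟨φ x2, hx2⟩, hz2, ⟨x2, rfl⟩, fun hc => hhx2 ((e2 x2).mp hc)⟩
      obtain ⟨⟨⟨y, hy⟩, hyC1⟩, ⟨-, hyC2⟩⟩ := hz
      obtain ⟨z, hzS⟩ := z
      simp only at hy hyC1 hyC2
      subst hy
      have h3 := hgh y hzS hzZ
      rw [map_mul] at h3
      rcases mul_eq_zero.mp h3 with h4 | h4
      · exact hyC1 ((e1 y).mpr h4)
      · exact hyC2 ((e2 y).mpr h4)
  have hIJ : ∀ Z : Set S, J ≤ I Z := fun Z g hg x hx _ => (hJ x).mp hx g hg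
  have hIp : ∀ Z : Set S, ⟨φ p, hp⟩ ∈ Z → I Z ≤ fanoMax p := fun Z hZ g hg => hg p hp hZ
  have hImono : ∀ Z Z' : Set S, Z ⊆ Z' → I Z' ≤ I Z := fun Z Z' h g hg x hx hz =>
    hg x hx (h hz)
  have hIback : ∀ Z : Set S, IsClosed Z → ∀ x, ∀ hx : φ x ∈ S,
      (∀ g ∈ I Z, MvPolynomial.eval x g = 0) → (⟨φ x, hx⟩ : S) ∈ Z := by
    intro Z hZ x hx h
    obtain ⟨C, hC, rfl⟩ := isClosed_induced_iff.mp hZ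
    obtain ⟨I', hI'⟩ := hφ.cont C hC
    have h1 : x ∈ φ ⁻¹' C := by
      rw [hI']
      intro g hg
      refine h g ?_
      intro y hy hyC
      have : y ∈ φ ⁻¹' C := hyC
      rw [hI'] at this
      exact this g hg
    exact h1
  have key : ∀ Z Z' : Set S, IsIrreducible Z → IsClosed Z' → ⟨φ p, hp⟩ ∈ Z → I Z' ≤ I Z →
      Z ⊆ Z' := by
    intro Z Z' hZ hZ' hpZ hI
    by_contra hcon
    obtain ⟨z, hz, hzn⟩ := Set.not_subset.mp hcon
    obtain ⟨y, hyZ, hyU, hyn⟩ := hZ.2 (Subtype.val ⁻¹' (Set.range φ)) Z'ᶜ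
      (hφ.isOpen.preimage continuous_subtype_val) hZ'.isOpen_compl
      ⟨_, hpZ, ⟨p, rfl⟩⟩ ⟨z, hz, hzn⟩
    obtain ⟨x, hx⟩ := hyU
    obtain ⟨y, hyS⟩ := y
    simp only at hx
    subst hx
    exact hyn (hIback Z' hZ' x hyS fun g hg => hI hg x hyS hyZ)
  refine Order.krullDim_le_of_strictMono (fun Z => ⟨⟨I (OrderDual.ofDual Z).1,
    hIprime _ (OrderDual.ofDual Z).1.isIrreducible (OrderDual.ofDual Z).2⟩, hIJ _,
    hIp _ (OrderDual.ofDual Z).2⟩) ?_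
  refine Monotone.strictMono_of_injective ?_ ?_
  · intro Z Z' h
    exact hImono _ _ h
  · intro Z Z' h
    have h1 : I (OrderDual.ofDual Z).1 = I (OrderDual.ofDual Z').1 :=
      congrArg (fun P => P.1.asIdeal) h
    apply OrderDual.ofDual.injective
    apply Subtype.ext
    apply SetLike.coe_injective
    exact Set.Subset.antisymm
      (key _ _ (OrderDual.ofDual Z).1.isIrreducible (OrderDual.ofDual Z').1.isClosed
        (OrderDual.ofDual Z).2 h1.ge)
      (key _ _ (OrderDual.ofDual Z').1.isIrreducible (OrderDual.ofDual Z).1.isClosed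
        (OrderDual.ofDual Z').2 h1.le)

lemma FanoChart.locDim_eq {σ : Type} [Finite σ] {T : Type*} [TopologicalSpace T] {φ : (σ → ℂ) → T}
    (hφ : FanoChart φ) (S : Set T) (J : Ideal (MvPolynomial σ ℂ))
    (hJ : ∀ x, φ x ∈ S ↔ ∀ g ∈ J, MvPolynomial.eval x g = 0) (p : σ → ℂ) (hp : φ p ∈ S) :
    fanoLocDim S ⟨φ p, hp⟩ = fanoHt J (fanoMax p) :=
  le_antisymm (FanoChart.locDim_le hφ S J hJ p hp) (FanoChart.locDim_ge hφ S J hJ p hp)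


open MvPolynomial in
lemma fano_eval_aeval {σ τ : Type*} (M : τ → MvPolynomial σ ℂ) (f : MvPolynomial τ ℂ) (p : σ → ℂ) :
    eval p (aeval M f) = eval (fun t => eval p (M t)) f := by
  induction f using MvPolynomial.induction_on with
  | C a => simp
  | add p q hp hq => simp only [map_add, hp, hq]
  | mul_X p t hp => simp only [map_mul, hp, aeval_X, eval_X]

open MvPolynomial in
lemma fano_chain {σ τ : Type*} [Fintype τ] (M : τ → MvPolynomial σ ℂ) (f : MvPolynomial τ ℂ)
    (j : σ) : pderiv j (aeval M f) = ∑ t, aeval M (pderiv t f) * pderiv j (M t) := by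
  classical
  induction f using MvPolynomial.induction_on with
  | C a => simp
  | add p q hp hq => simp only [map_add, hp, hq, add_mul, Finset.sum_add_distrib]
  | mul_X p t hp =>
    simp only [map_mul, Derivation.leibniz, hp, aeval_X, map_add, smul_eq_mul, pderiv_X, add_mul,
      Finset.sum_add_distrib]
    congr 1
    · rw [Finset.sum_eq_single t]
      · simp
      · intro t' _ h; simp [Pi.single_apply, h.symm]
      · simp
    · rw [Finset.mul_sum]; exact Finset.sum_congr rfl fun _ _ => by ring

open MvPolynomial in
/-- The polynomial attached to a linear functional. -/
noncomputable def fanoLin {m : ℕ} (l : (Fin m → ℂ) →ₗ[ℂ] ℂ) : MvPolynomial (Fin m) ℂ :=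
  ∑ j, C (l (Pi.single j 1)) * X j

open MvPolynomial in
lemma fano_linear_apply {m : ℕ} {V : Type*} [AddCommGroup V] [Module ℂ V]
    (l : (Fin m → ℂ) →ₗ[ℂ] V) (x : Fin m → ℂ) :
    l x = ∑ j, x j • l (Pi.single j 1) := by
  conv_lhs => rw [pi_eq_sum_univ' x]
  rw [map_sum]
  refine Finset.sum_congr rfl fun j _ => ?_
  rw [map_smul]

open MvPolynomial in
lemma eval_fanoLin {m : ℕ} (l : (Fin m → ℂ) →ₗ[ℂ] ℂ) (x : Fin m → ℂ) :
    eval x (fanoLin l) = l x := by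
  rw [fano_linear_apply l x, fanoLin, map_sum]
  exact Finset.sum_congr rfl fun j _ => by simp [mul_comm]

open MvPolynomial in
lemma fanoLin_homog {m : ℕ} (l : (Fin m → ℂ) →ₗ[ℂ] ℂ) : (fanoLin l).IsHomogeneous 1 := by
  refine IsHomogeneous.sum _ _ _ fun j _ => ?_
  have := (isHomogeneous_C (Fin m) (l (Pi.single j 1))).mul (isHomogeneous_X ℂ j)
  rwa [zero_add] at this

open MvPolynomial in
/-- Homogenization / clearing denominators. -/
lemma fano_clear {σ τ : Type} (r : ℕ) (D : MvPolynomial τ ℂ) (N : σ → MvPolynomial τ ℂ)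
    (hD : D.IsHomogeneous r) (hN : ∀ j, (N j).IsHomogeneous r) (g : MvPolynomial σ ℂ) :
    ∃ (k : ℕ) (G : MvPolynomial τ ℂ), G.IsHomogeneous (r * k) ∧ ∀ x : τ → ℂ, eval x D ≠ 0 →
      eval x G = (eval x D) ^ k * eval (fun j => eval x (N j) / eval x D) g := by
  induction g using MvPolynomial.induction_on with
  | C a => exact ⟨0, C a, isHomogeneous_C _ _, fun x hx => by simp⟩
  | add p q hp hq =>
    obtain ⟨k1, G1, h1, e1⟩ := hp
    obtain ⟨k2, G2, h2, e2⟩ := hq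
    refine ⟨k1 + k2, D ^ k2 * G1 + D ^ k1 * G2, ?_, fun x hx => ?_⟩
    · refine IsHomogeneous.add ?_ ?_
      · convert (hD.pow k2).mul h1 using 1; ring
      · convert (hD.pow k1).mul h2 using 1; ring
    · simp only [map_add, map_mul, map_pow, e1 x hx, e2 x hx]; ring
  | mul_X p j hp =>
    obtain ⟨k, G, h, e⟩ := hp
    refine ⟨k + 1, G * N j, h.mul (hN j), fun x hx => ?_⟩
    simp only [map_mul, e x hx, eval_X]
    field_simp
    ring

open MvPolynomial in
lemma fano_eval_rep {N k : ℕ} {f : MvPolynomial (Fin (N+1)) ℂ} (hf : f.IsHomogeneous k)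
    (v : Fin (N+1) → ℂ) (hv : v ≠ 0) :
    eval (Projectivization.mk ℂ v hv).rep f = 0 ↔ eval v f = 0 := by
  obtain ⟨a, ha⟩ := Projectivization.exists_smul_eq_mk_rep ℂ v hv
  rw [← ha]
  have : eval (a • v) f = (a : ℂ) ^ k * eval v f := fano_eval_smul hf (a : ℂ) v
  rw [this]
  simp

/-- a point of the affine chart attached to a basis -/
noncomputable def fanoPt {N : ℕ} (b : Module.Basis (Fin (N+1)) ℂ (Fin (N+1) → ℂ)) (p : Fin N → ℂ) :
    Fin (N+1) → ℂ := b 0 + ∑ j, p j • b j.succ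

lemma fanoPt_coord_zero {N : ℕ} (b : Module.Basis (Fin (N+1)) ℂ (Fin (N+1) → ℂ)) (p : Fin N → ℂ) :
    b.coord 0 (fanoPt b p) = 1 := by
  simp [fanoPt, Finsupp.single_apply]

lemma fanoPt_coord_succ {N : ℕ} (b : Module.Basis (Fin (N+1)) ℂ (Fin (N+1) → ℂ)) (p : Fin N → ℂ)
    (j : Fin N) : b.coord j.succ (fanoPt b p) = p j := by
  simp [fanoPt, Finsupp.single_apply]

lemma fanoPt_ne {N : ℕ} (b : Module.Basis (Fin (N+1)) ℂ (Fin (N+1) → ℂ)) (p : Fin N → ℂ) :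
    fanoPt b p ≠ 0 := by
  intro h
  have := fanoPt_coord_zero b p
  rw [h, map_zero] at this
  exact zero_ne_one this

/-- The coordinates of the chart as polynomials. -/
noncomputable def fanoPtPoly {N : ℕ} (b : Module.Basis (Fin (N+1)) ℂ (Fin (N+1) → ℂ)) 
    (t : Fin (N+1)) : MvPolynomial (Fin N) ℂ :=
  MvPolynomial.C (b 0 t) + ∑ j, MvPolynomial.X j * MvPolynomial.C (b j.succ t)

lemma eval_fanoPtPoly {N : ℕ} (b : Module.Basis (Fin (N+1)) ℂ (Fin (N+1) → ℂ)) (p : Fin N → ℂ) :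
    (fun t => MvPolynomial.eval p (fanoPtPoly b t)) = fanoPt b p := by
  ext t
  simp [fanoPtPoly, fanoPt]

lemma pderiv_fanoPtPoly {N : ℕ} (b : Module.Basis (Fin (N+1)) ℂ (Fin (N+1) → ℂ))
    (t : Fin (N+1)) (j : Fin N) :
    MvPolynomial.pderiv j (fanoPtPoly b t) = MvPolynomial.C (b j.succ t) := by
  classical
  simp only [fanoPtPoly, map_add, map_sum, Derivation.leibniz, MvPolynomial.pderiv_C,
    MvPolynomial.pderiv_X, smul_zero, zero_add]
  rw [Finset.sum_eq_single j]
  · simp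
  · intro t' _ h; simp [Pi.single_apply, h]
  · simp

noncomputable def fanoProjChart {N : ℕ} (b : Module.Basis (Fin (N+1)) ℂ (Fin (N+1) → ℂ))
    (p : Fin N → ℂ) : Projectivization ℂ (Fin (N+1) → ℂ) :=
  Projectivization.mk ℂ (fanoPt b p) (fanoPt_ne b p)

open MvPolynomial in
lemma fanoProjChart_isChart {N : ℕ} (b : Module.Basis (Fin (N+1)) ℂ (Fin (N+1) → ℂ)) :
    FanoChart (fanoProjChart b) := by
  refine FanoChart.mk' _ _ ?_ ?_ ?_
  · have : Set.range (fanoProjChart b) = {x | eval x.rep (fanoLin (b.coord 0)) ≠ 0} := by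
      ext x
      constructor
      · rintro ⟨p, rfl⟩
        change ¬ _
        rw [fanoProjChart, fano_eval_rep (fanoLin_homog _), eval_fanoLin, fanoPt_coord_zero]
        exact one_ne_zero
      · intro hx
        change ¬ _ at hx
        rw [eval_fanoLin] at hx
        set u := x.rep with hu
        refine ⟨fun j => b.coord j.succ u / b.coord 0 u, ?_⟩
        conv_rhs => rw [← Projectivization.mk_rep x]
        rw [fanoProjChart, Projectivization.mk_eq_mk_iff']
        refine ⟨(b.coord 0 u)⁻¹, ?_⟩
        rw [← hu]
        apply b.ext_elem
        intro i
        change b.coord i _ = b.coord i _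
        rw [map_smul]
        refine Fin.cases ?_ (fun j => ?_) i
        · rw [fanoPt_coord_zero, smul_eq_mul, inv_mul_cancel₀ hx]
        · rw [fanoPt_coord_succ, smul_eq_mul, div_eq_mul_inv, mul_comm]
    rw [this]
    exact TopologicalSpace.isOpen_generateFrom_of_mem ⟨1, _, fanoLin_homog _, rfl⟩
  · rintro U ⟨k, f, hf, rfl⟩
    refine ⟨{aeval (fanoPtPoly b) f}, ?_⟩
    ext p
    simp only [Set.mem_preimage, Set.mem_setOf_eq, Set.mem_singleton_iff, forall_eq,
      fano_eval_aeval, eval_fanoPtPoly]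
    change (¬ _) ↔ _
    rw [fanoProjChart, fano_eval_rep hf]
  · intro g
    obtain ⟨k, G, hG, e⟩ := fano_clear 1 (fanoLin (b.coord 0))
      (fun j : Fin N => fanoLin (b.coord j.succ)) (fanoLin_homog _) (fun j => fanoLin_homog _) g
    refine ⟨_, TopologicalSpace.isOpen_generateFrom_of_mem ⟨_, G, hG, rfl⟩, ?_⟩
    ext p
    have h1 := e (fanoPt b p) (by rw [eval_fanoLin, fanoPt_coord_zero]; exact one_ne_zero)
    simp only [eval_fanoLin, fanoPt_coord_zero, fanoPt_coord_succ, one_pow, one_mul, div_one] at h1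
    rw [Set.mem_preimage]
    change (¬ _) ↔ (¬ _)
    rw [fanoProjChart, fano_eval_rep hG, h1]

open MvPolynomial in
lemma fano_taylor {N : ℕ} (g : MvPolynomial (Fin N) ℂ) :
    g - C (eval 0 g) - ∑ j, C (eval 0 (pderiv j g)) * X j ∈
      fanoMax (0 : Fin N → ℂ) * fanoMax (0 : Fin N → ℂ) := by
  classical
  induction g using MvPolynomial.induction_on with
  | C a => simp
  | add p q hp hq =>
    convert add_mem hp hq using 1
    simp only [map_add, add_mul, Finset.sum_add_distrib]
    ring
  | mul_X p k hp =>
    have h1 : (∑ j, C (eval 0 (pderiv j (p * X k))) * X j : MvPolynomial (Fin N) ℂ) =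
        C (eval 0 p) * X k := by
      rw [Finset.sum_eq_single k]
      · simp
      · intro t' _ h; simp [pderiv_X, Pi.single_apply, h.symm]
      · simp
    have : p * X k - C (eval 0 (p * X k)) - ∑ j, C (eval 0 (pderiv j (p * X k))) * X j =
        (p - C (eval 0 p)) * X k := by
      rw [h1]; simp; ring
    rw [this]
    refine Ideal.mul_mem_mul ?_ ?_
    · rw [mem_fanoMax]; simp
    · rw [mem_fanoMax]; simp

open MvPolynomial in
lemma fano_max_le {N : ℕ} (I : Ideal (MvPolynomial (Fin N) ℂ))
    (h : ∀ j, (X j : MvPolynomial (Fin N) ℂ) ∈ I ⊔ fanoMax (0 : Fin N → ℂ) * fanoMax 0) :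
    fanoMax (0 : Fin N → ℂ) ≤ I ⊔ fanoMax (0 : Fin N → ℂ) * fanoMax 0 := by
  intro g hg
  have h1 := fano_taylor g
  rw [(mem_fanoMax _ _).mp hg, map_zero, sub_zero] at h1
  have h2 : (∑ j, C (eval 0 (pderiv j g)) * X j : MvPolynomial (Fin N) ℂ) ∈
    I ⊔ fanoMax (0 : Fin N → ℂ) * fanoMax 0 := sum_mem fun j _ => Ideal.mul_mem_left _ _ (h j)
  have h3 := Ideal.mem_sup_right (S := I) h1
  simpa using add_mem h3 h2

lemma fano_extend_indep {N s : ℕ} (L : Fin s → (Fin N → ℂ)) (hL : LinearIndependent ℂ L) :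
    ∃ l : Fin (N - s) → (Fin N → ℂ), ∀ x : Fin N → ℂ, ∃ (a : Fin s → ℂ) (c : Fin (N - s) → ℂ),
      x = ∑ i, a i • L i + ∑ k, c k • l k := by
  obtain ⟨q, hq⟩ := Submodule.exists_isCompl (Submodule.span ℂ (Set.range L))
  have h1 := Submodule.finrank_add_eq_of_isCompl hq
  rw [finrank_span_eq_card hL] at h1
  simp at h1
  let B := Module.finBasisOfFinrankEq ℂ q (n := N - s) (by omega)
  refine ⟨fun k => (B k : Fin N → ℂ), fun x => ?_⟩
  obtain ⟨y, hy, z, hz, rfl⟩ := Submodule.mem_sup.mp (show x ∈ Submodule.span ℂ (Set.range L) ⊔ q by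
    rw [hq.sup_eq_top]; trivial)
  obtain ⟨a, rfl⟩ := (Submodule.mem_span_range_iff_exists_fun ℂ).mp hy
  refine ⟨a, fun k => B.repr ⟨z, hz⟩ k, ?_⟩
  congr 1
  have := congrArg Subtype.val (B.sum_repr ⟨z, hz⟩)
  rw [Submodule.coe_sum] at this
  exact this.symm

lemma fano_basis_sum {w m N : ℕ} (hw : w + m = N) (v : Fin w → Fin N → ℂ)
    (hv : LinearIndependent ℂ v) :
    ∃ b : Module.Basis (Fin w ⊕ Fin m) ℂ (Fin N → ℂ), ∀ r, b (Sum.inl r) = v r := by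
  obtain ⟨l, hl⟩ := fano_extend_indep v hv
  obtain rfl : m = N - w := by omega
  refine ⟨basisOfTopLeSpanOfCardEqFinrank (Sum.elim v l) ?_ (by simp; omega), fun r => ?_⟩
  swap
  · rw [coe_basisOfTopLeSpanOfCardEqFinrank, Sum.elim_inl]
  rintro x -
  obtain ⟨a, c, rfl⟩ := hl x
  exact add_mem (sum_mem fun i _ => Submodule.smul_mem _ _ (Submodule.subset_span ⟨Sum.inl i, rfl⟩))
    (sum_mem fun i _ => Submodule.smul_mem _ _ (Submodule.subset_span ⟨Sum.inr i, rfl⟩))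

lemma fano_exists_basis {N : ℕ} (v : Fin (N+1) → ℂ) (hv : v ≠ 0) :
    ∃ b : Module.Basis (Fin (N+1)) ℂ (Fin (N+1) → ℂ), b 0 = v := by
  obtain ⟨b, hb⟩ := fano_basis_sum (w := 1) (m := N) (add_comm _ _) (fun _ => v)
    (LinearIndependent.of_subsingleton 0 hv)
  refine ⟨b.reindex (finSumFinEquiv.trans (finCongr (add_comm 1 N))), ?_⟩
  rw [Module.Basis.reindex_apply, ← hb 0]
  congr 1

lemma fano_withBot_sub {N s : ℕ} {a : WithBot ℕ∞} (h : (N : WithBot ℕ∞) ≤ a + (s : ℕ)) :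
    ((N - s : ℕ) : WithBot ℕ∞) ≤ a := by
  induction a using WithBot.recBotCoe with
  | bot => simp at h
  | coe a =>
    induction a using ENat.recTopCoe with
    | top => exact le_top
    | coe a =>
      have : N ≤ a + s := by exact_mod_cast h
      have h2 : N - s ≤ a := by omega
      exact (Nat.cast_le (α := WithBot ℕ∞)).mpr h2

/-- local upper bound from the Jacobian criterion -/
lemma fano_jac_upper {N s : ℕ} (g : Fin s → MvPolynomial (Fin N) ℂ)
    (hg0 : ∀ i, MvPolynomial.eval 0 (g i) = 0)
    (hL : LinearIndependent ℂ (fun i j => MvPolynomial.eval 0 (MvPolynomial.pderiv j (g i)))) :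
    fanoHt (Ideal.span (Set.range g)) (fanoMax 0) ≤ ((N - s : ℕ) : WithBot ℕ∞) := by
  classical
  obtain ⟨l, hl⟩ := fano_extend_indep _ hL
  set J := Ideal.span (Set.range g)
  have hJ : J ≤ fanoMax 0 := by
    rw [Ideal.span_le]; rintro _ ⟨i, rfl⟩; exact hg0 i
  let q (k : Fin (N - s)) : MvPolynomial (Fin N) ℂ :=
    ∑ j, MvPolynomial.C (l k j) * MvPolynomial.X j
  have h1 := fanoHt_le_add J (fanoMax 0) hJ q (fun k => by rw [mem_fanoMax]; simp [q])
  rw [Fintype.card_fin] at h1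
  have h2 : fanoHt (J ⊔ Ideal.span (Set.range q)) (fanoMax 0) ≤ 0 := by
    refine fanoHt_le_zero _ _ ?_
    refine fano_max_le _ fun j => ?_
    obtain ⟨a, c, hac⟩ := hl (Pi.single j 1)
    set I := J ⊔ Ideal.span (Set.range q) ⊔ fanoMax 0 * fanoMax 0 with hI
    have hgI : ∀ i, (∑ t, MvPolynomial.C (MvPolynomial.eval 0 (MvPolynomial.pderiv t (g i))) *
        MvPolynomial.X t : MvPolynomial (Fin N) ℂ) ∈ I := by
      intro i
      have h3 := fano_taylor (g i)
      rw [hg0, map_zero, sub_zero] at h3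
      have h4 : g i ∈ I := Ideal.mem_sup_left (Ideal.mem_sup_left
        (Ideal.subset_span ⟨i, rfl⟩))
      have h5 := sub_mem h4 (Ideal.mem_sup_right (S := J ⊔ Ideal.span (Set.range q)) h3)
      simpa using h5
    have hqI : ∀ k, q k ∈ I := fun k => Ideal.mem_sup_left (Ideal.mem_sup_right
        (Ideal.subset_span ⟨k, rfl⟩))
    have hX : (MvPolynomial.X j : MvPolynomial (Fin N) ℂ) =
        ∑ i, MvPolynomial.C (a i) * (∑ t, MvPolynomial.C (MvPolynomial.eval 0
          (MvPolynomial.pderiv t (g i))) * MvPolynomial.X t) +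
        ∑ k, MvPolynomial.C (c k) * q k := by
      have h6 : (MvPolynomial.X j : MvPolynomial (Fin N) ℂ) =
        ∑ t, MvPolynomial.C ((Pi.single j 1 : Fin N → ℂ) t) * MvPolynomial.X t := by
        rw [Finset.sum_eq_single j]
        · simp
        · intro t' _ h; simp [Pi.single_apply, h]
        · simp
      rw [h6, hac]
      simp only [q, Finset.mul_sum]
      rw [Finset.sum_comm, Finset.sum_comm (s := (Finset.univ : Finset (Fin (N - s)))),
        ← Finset.sum_add_distrib]
      refine Finset.sum_congr rfl fun t _ => ?_
      simp only [Pi.add_apply, Finset.sum_apply, Pi.smul_apply, smul_eq_mul, map_add, map_sum,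
        map_mul, add_mul, Finset.sum_mul, mul_assoc]
    rw [hX]
    exact add_mem (sum_mem fun i _ => Ideal.mul_mem_left _ _ (hgI i))
      (sum_mem fun k _ => Ideal.mul_mem_left _ _ (hqI k))
  refine h1.trans ?_
  calc _ ≤ (0 : WithBot ℕ∞) + ((N - s : ℕ) : WithBot ℕ∞) := by gcongr
    _ = _ := zero_add _


lemma fano_rank_indep {s m : ℕ} (A : Fin s → Fin m → ℂ) :
    (Matrix.of A).rank = s ↔ LinearIndependent ℂ A := by
  rw [Matrix.rank_eq_finrank_span_row, linearIndependent_iff_card_eq_finrank_span,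
    Fintype.card_fin]
  exact eq_comm

lemma fano_nonempty {n s : ℕ} (f : Fin s → MvPolynomial (Fin n) ℂ)
    (h0 : ∀ i, MvPolynomial.eval 0 (f i) = 0) (hs : s < n) :
    ∃ x : Fin n → ℂ, x ≠ 0 ∧ ∀ i, MvPolynomial.eval x (f i) = 0 := by
  by_contra hcon
  have hx0 : ∀ x : Fin n → ℂ, (∀ i, MvPolynomial.eval x (f i) = 0) → x = 0 := by
    intro x hx
    by_contra h
    exact hcon ⟨x, h, hx⟩
  have h1 := fanoHt_le_add ⊥ (fanoMax (0 : Fin n → ℂ)) bot_le f h0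
  have h2 := (card_le_fanoHt_bot (0 : Fin n → ℂ)).trans h1
  have h3 : fanoHt (⊥ ⊔ Ideal.span (Set.range f)) (fanoMax (0 : Fin n → ℂ)) ≤ 0 := by
    rw [bot_sup_eq]
    have key : ∀ P : {P : PrimeSpectrum (MvPolynomial (Fin n) ℂ) //
        Ideal.span (Set.range f) ≤ P.asIdeal ∧ P.asIdeal ≤ fanoMax 0},
        P.1.asIdeal = fanoMax 0 := by
      intro P
      refine le_antisymm P.2.2 fun g hg => ?_
      have := P.1.isPrime
      refine fano_eval_zero_of_prime P.1.asIdeal g fun x hx => ?_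
      rw [hx0 x fun i => hx _ (P.2.1 (Ideal.subset_span ⟨i, rfl⟩))]
      exact hg
    have : Subsingleton {P : PrimeSpectrum (MvPolynomial (Fin n) ℂ) //
      Ideal.span (Set.range f) ≤ P.asIdeal ∧ P.asIdeal ≤ fanoMax 0} := ⟨fun P Q =>
        Subtype.ext (PrimeSpectrum.ext ((key P).trans (key Q).symm))⟩
    exact Order.krullDim_nonpos_of_subsingleton
  rw [Fintype.card_fin, Fintype.card_fin] at h2
  have h4 : ((n : ℕ) : WithBot ℕ∞) ≤ 0 + (s : ℕ) := h2.trans (by gcongr)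
  rw [zero_add] at h4
  have : n ≤ s := by exact_mod_cast h4
  omega

/-- The projective zero locus. -/
def fanoLocus {N s : ℕ} (f : Fin s → MvPolynomial (Fin (N+1)) ℂ) :
    Set (Projectivization ℂ (Fin (N + 1) → ℂ)) := {x | ∀ i, MvPolynomial.eval x.rep (f i) = 0}

lemma fano_jac_dim {N s : ℕ} (d : Fin s → ℕ) (f : Fin s → MvPolynomial (Fin (N+1)) ℂ)
    (hd : ∀ i, d i ≠ 0) (hf : ∀ i, (f i).IsHomogeneous (d i))
    (hs : s ≤ N)
    (hsm : ∀ v, v ≠ 0 → (∀ i, MvPolynomial.eval v (f i) = 0) →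
      LinearIndependent ℂ (fun i j => MvPolynomial.eval v (MvPolynomial.pderiv j (f i)))) :
    topologicalKrullDim ↥(fanoLocus f) = ((N - s : ℕ) : WithBot ℕ∞) := by
  have key : ∀ x : fanoLocus f, fanoLocDim (fanoLocus f) x = ((N - s : ℕ) : WithBot ℕ∞) := by
    rintro ⟨x, hx⟩
    obtain ⟨b, hb⟩ := fano_exists_basis x.rep x.rep_nonzero
    have hpt : fanoPt b 0 = x.rep := by simp [fanoPt, hb]
    have hφ0 : fanoProjChart b 0 = x := by
      conv_rhs => rw [← Projectivization.mk_rep x]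
      simp only [fanoProjChart, hpt]
    subst hφ0
    set g : Fin s → MvPolynomial (Fin N) ℂ :=
      fun i => MvPolynomial.aeval (fanoPtPoly b) (f i) with hgdef
    have hge : ∀ i p, MvPolynomial.eval p (g i) = MvPolynomial.eval (fanoPt b p) (f i) := by
      intro i p
      rw [hgdef]; simp only
      rw [fano_eval_aeval, eval_fanoPtPoly]
    have hmem : ∀ p, fanoProjChart b p ∈ fanoLocus f ↔ ∀ i, MvPolynomial.eval p (g i) = 0 := by
      intro p
      refine forall_congr' fun i => ?_
      rw [hge, fanoProjChart, fano_eval_rep (hf i)]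
    have hfx : ∀ i, MvPolynomial.eval (fanoPt b 0) (f i) = 0 := fun i => by
      rw [← hge]; exact (hmem 0).mp hx i
    have hJ : ∀ p, fanoProjChart b p ∈ fanoLocus f ↔ ∀ q ∈ Ideal.span (Set.range g),
        MvPolynomial.eval p q = 0 := by
      intro p
      rw [hmem]
      constructor
      · intro h
        have : Ideal.span (Set.range g) ≤ fanoMax p := by
          rw [Ideal.span_le]; rintro _ ⟨i, rfl⟩; exact h i
        exact fun q hq => this hq
      · exact fun h i => h _ (Ideal.subset_span ⟨i, rfl⟩)
    rw [(fanoProjChart_isChart b).locDim_eq _ _ hJ 0 hx]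
    refine le_antisymm ?_ ?_
    · refine fano_jac_upper g ((hmem 0).mp hx) ?_
      have hind := hsm (fanoPt b 0) (fanoPt_ne b 0) hfx
      have hpd : ∀ i j, MvPolynomial.eval 0 (MvPolynomial.pderiv j (g i)) =
          ∑ t, b j.succ t * MvPolynomial.eval (fanoPt b 0) (MvPolynomial.pderiv t (f i)) := by
        intro i j
        rw [hgdef]; simp only
        rw [fano_chain, map_sum]
        refine Finset.sum_congr rfl fun t _ => ?_
        rw [map_mul, fano_eval_aeval, eval_fanoPtPoly, pderiv_fanoPtPoly, MvPolynomial.eval_C,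
          mul_comm]
      rw [Fintype.linearIndependent_iff] at hind ⊢
      intro c hc
      refine hind c ?_
      -- the functional vanishes on the basis
      let l : (Fin (N+1) → ℂ) →ₗ[ℂ] ℂ := ∑ t, (∑ i, c i * MvPolynomial.eval (fanoPt b 0)
          (MvPolynomial.pderiv t (f i))) • LinearMap.proj t
      have hlapp : ∀ y, l y = ∑ i, c i * ∑ t, y t * MvPolynomial.eval (fanoPt b 0)
          (MvPolynomial.pderiv t (f i)) := by
        intro y
        simp only [l, LinearMap.sum_apply, LinearMap.smul_apply, LinearMap.proj_apply,
          smul_eq_mul, Finset.sum_mul, Finset.mul_sum]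
        rw [Finset.sum_comm]
        exact Finset.sum_congr rfl fun i _ => Finset.sum_congr rfl fun t _ => by ring
      have hl0 : l = 0 := by
        refine b.ext fun k => ?_
        rw [hlapp, LinearMap.zero_apply]
        refine Fin.cases ?_ (fun j => ?_) k
        · have hb0 : b 0 = fanoPt b 0 := by rw [hpt, hb]
          rw [hb0]
          refine Finset.sum_eq_zero fun i _ => ?_
          rw [fano_euler (hf i), hfx i, mul_zero, mul_zero]
        · have := congrFun hc j
          simp only [Finset.sum_apply, Pi.smul_apply, hpd, smul_eq_mul, Pi.zero_apply] at this
          exact this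
      ext t
      have := congrArg (fun l => l (Pi.single t 1)) hl0
      simp only [hlapp, LinearMap.zero_apply] at this
      simpa [Pi.single_apply, Finset.sum_apply] using this
    · have h1 := fanoHt_le_add ⊥ (fanoMax (0 : Fin N → ℂ)) bot_le g ((hmem 0).mp hx)
      rw [bot_sup_eq, Fintype.card_fin] at h1
      have h2 := (card_le_fanoHt_bot (0 : Fin N → ℂ)).trans h1
      rw [Fintype.card_fin] at h2
      exact fano_withBot_sub h2
  refine le_antisymm (fano_dim_le_of_locDim _ _ fun p => (key p).le) ?_
  obtain ⟨x, hx, hfx⟩ := fano_nonempty f (fun i => by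
    have := fano_eval_smul (hf i) 0 0
    simpa [hd i] using this) (by omega)
  have hmem : Projectivization.mk ℂ x hx ∈ fanoLocus f := fun i => by
    rw [fano_eval_rep (hf i)]; exact hfx i
  rw [← key ⟨_, hmem⟩]
  exact fanoLocDim_le _ _

lemma fano_linear_indep_pair {n m : ℕ} (b : Module.Basis (Fin 2 ⊕ Fin m) ℂ (Fin (n+1) → ℂ))
    (U V : Fin (n+1) → ℂ) (h00 : b.coord (Sum.inl 0) U = 1) (h10 : b.coord (Sum.inl 1) U = 0)
    (h01 : b.coord (Sum.inl 0) V = 0) (h11 : b.coord (Sum.inl 1) V = 1) :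
    Module.finrank ℂ (Submodule.span ℂ {U, V}) = 2 := by
  have hli : LinearIndependent ℂ ![U, V] := by
    rw [LinearIndependent.pair_iff]
    intro x y hxy
    have h0 := congrArg (b.coord (Sum.inl 0)) hxy
    have h1 := congrArg (b.coord (Sum.inl 1)) hxy
    rw [map_add, map_smul, map_smul, h00, h01, map_zero] at h0
    rw [map_add, map_smul, map_smul, h10, h11, map_zero] at h1
    simp at h0 h1
    exact ⟨h0, h1⟩
  have := finrank_span_eq_card hli
  rw [Matrix.range_cons_cons_empty] at this
  simpa using this

/-- The two vectors spanning a line in the Grassmannian chart. -/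
noncomputable def fanoVec {n m : ℕ} (b : Module.Basis (Fin 2 ⊕ Fin m) ℂ (Fin (n+1) → ℂ))
    (p : Fin 2 × Fin m → ℂ) (r : Fin 2) : Fin (n+1) → ℂ :=
  b (Sum.inl r) + ∑ j, p (r, j) • b (Sum.inr j)

lemma fanoVec_coord_inl {n m : ℕ} (b : Module.Basis (Fin 2 ⊕ Fin m) ℂ (Fin (n+1) → ℂ))
    (p : Fin 2 × Fin m → ℂ) (r r' : Fin 2) :
    b.coord (Sum.inl r') (fanoVec b p r) = if r = r' then 1 else 0 := by
  simp [fanoVec, Finsupp.single_apply]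

lemma fanoVec_coord_inr {n m : ℕ} (b : Module.Basis (Fin 2 ⊕ Fin m) ℂ (Fin (n+1) → ℂ))
    (p : Fin 2 × Fin m → ℂ) (r : Fin 2) (j : Fin m) :
    b.coord (Sum.inr j) (fanoVec b p r) = p (r, j) := by
  simp [fanoVec, Finsupp.single_apply]

open MvPolynomial in
noncomputable def fanoVecPoly {n m : ℕ} (b : Module.Basis (Fin 2 ⊕ Fin m) ℂ (Fin (n+1) → ℂ))
    (r : Fin 2) (t : Fin (n+1)) : MvPolynomial (Fin 2 × Fin m) ℂ :=
  C (b (Sum.inl r) t) + ∑ j, X (r, j) * C (b (Sum.inr j) t)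

lemma eval_fanoVecPoly {n m : ℕ} (b : Module.Basis (Fin 2 ⊕ Fin m) ℂ (Fin (n+1) → ℂ))
    (p : Fin 2 × Fin m → ℂ) (r : Fin 2) (t : Fin (n+1)) :
    MvPolynomial.eval p (fanoVecPoly b r t) = fanoVec b p r t := by
  simp [fanoVecPoly, fanoVec]

noncomputable def fanoGrChart {n m : ℕ} (b : Module.Basis (Fin 2 ⊕ Fin m) ℂ (Fin (n+1) → ℂ))
    (p : Fin 2 × Fin m → ℂ) : ProjLine n :=
  ⟨Submodule.span ℂ {fanoVec b p 0, fanoVec b p 1}, fano_linear_indep_pair b _ _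
    (by simp [fanoVec_coord_inl, -Module.Basis.coord_apply]) (by simp [fanoVec_coord_inl, -Module.Basis.coord_apply])
    (by simp [fanoVec_coord_inl, -Module.Basis.coord_apply]) (by simp [fanoVec_coord_inl, -Module.Basis.coord_apply])⟩

open MvPolynomial in
/-- two by two minors -/
noncomputable def fanoDet {n : ℕ} (l l' : (Fin (n+1) → ℂ) →ₗ[ℂ] ℂ) :
    MvPolynomial (Fin (n+1) ⊕ Fin (n+1)) ℂ :=
  rename Sum.inl (fanoLin l) * rename Sum.inr (fanoLin l') -
    rename Sum.inl (fanoLin l') * rename Sum.inr (fanoLin l)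

open MvPolynomial in
lemma fanoDet_homog {n : ℕ} (l l' : (Fin (n+1) → ℂ) →ₗ[ℂ] ℂ) : (fanoDet l l').IsHomogeneous 2 := by
  have h := fun (l : (Fin (n+1) → ℂ) →ₗ[ℂ] ℂ) (g : Fin (n+1) → Fin (n+1) ⊕ Fin (n+1)) =>
    (fanoLin_homog l).rename_isHomogeneous (f := g)
  exact ((h l _).mul (h l' _)).sub ((h l' _).mul (h l _))

open MvPolynomial in
lemma eval_fanoDet {n : ℕ} (l l' : (Fin (n+1) → ℂ) →ₗ[ℂ] ℂ) (u v : Fin (n+1) → ℂ) :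
    eval (Sum.elim u v) (fanoDet l l') = l u * l' v - l' u * l v := by
  simp only [fanoDet, map_sub, map_mul, eval_rename, Sum.elim_comp_inl, Sum.elim_comp_inr,
    eval_fanoLin]

open MvPolynomial in
lemma fanoGrChart_isChart {n m : ℕ} (b : Module.Basis (Fin 2 ⊕ Fin m) ℂ (Fin (n+1) → ℂ)) :
    FanoChart (fanoGrChart b) := by
  set D := fanoDet (b.coord (Sum.inl 0)) (b.coord (Sum.inl 1)) with hD
  have hDp : ∀ p, eval (Sum.elim (fanoVec b p 0) (fanoVec b p 1)) D = 1 := by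
    intro p
    rw [hD, eval_fanoDet]
    simp [fanoVec_coord_inl, -Module.Basis.coord_apply]
  have hmem0 : ∀ p, fanoVec b p 0 ∈ (fanoGrChart b p).1 := fun p =>
    Submodule.subset_span (by simp)
  have hmem1 : ∀ p, fanoVec b p 1 ∈ (fanoGrChart b p).1 := fun p =>
    Submodule.subset_span (by simp)
  let Nm : Fin 2 × Fin m → MvPolynomial (Fin (n+1) ⊕ Fin (n+1)) ℂ := fun q =>
    if q.1 = 0 then fanoDet (b.coord (Sum.inr q.2)) (b.coord (Sum.inl 1))
    else fanoDet (b.coord (Sum.inl 0)) (b.coord (Sum.inr q.2))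
  have hNm : ∀ q, (Nm q).IsHomogeneous 2 := by
    intro q
    simp only [Nm]
    split_ifs
    · exact fanoDet_homog _ _
    · exact fanoDet_homog _ _
  refine FanoChart.mk' _ _ ?_ ?_ ?_
  · have : Set.range (fanoGrChart b) = {W : ProjLine n | ¬ ∀ u ∈ W.1, ∀ v ∈ W.1,
        eval (Sum.elim u v) D = 0} := by
      ext W
      constructor
      · rintro ⟨p, rfl⟩ h
        have := h _ (hmem0 p) _ (hmem1 p)
        rw [hDp] at this
        exact one_ne_zero this
      · intro hW
        change ¬ _ at hW
        push Not at hW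
        obtain ⟨u, hu, v, hv, huv⟩ := hW
        set p : Fin 2 × Fin m → ℂ := fun q => eval (Sum.elim u v) (Nm q) / eval (Sum.elim u v) D
          with hp
        refine ⟨p, ?_⟩
        have hDe : eval (Sum.elim u v) D = b.coord (Sum.inl 0) u * b.coord (Sum.inl 1) v -
          b.coord (Sum.inl 1) u * b.coord (Sum.inl 0) v := eval_fanoDet _ _ _ _
        have hU : fanoVec b p 0 = (eval (Sum.elim u v) D)⁻¹ • (b.coord (Sum.inl 1) v • u -
            b.coord (Sum.inl 1) u • v) := by
          apply b.ext_elem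
          intro i
          change b.coord i _ = b.coord i _
          rw [map_smul, map_sub, map_smul, map_smul]
          rcases i with r | j
          · rw [fanoVec_coord_inl]
            fin_cases r
            · simp only [smul_eq_mul, Fin.zero_eta, if_true]
              rw [eq_inv_mul_iff_mul_eq₀ huv, hDe]; ring
            · simp only [smul_eq_mul, Fin.mk_one]
              rw [if_neg (by decide)]; ring
          · rw [fanoVec_coord_inr, hp]
            simp only [Nm, if_true, eval_fanoDet, smul_eq_mul]
            ring
        have hV : fanoVec b p 1 = (eval (Sum.elim u v) D)⁻¹ • (b.coord (Sum.inl 0) u • v -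
            b.coord (Sum.inl 0) v • u) := by
          apply b.ext_elem
          intro i
          change b.coord i _ = b.coord i _
          rw [map_smul, map_sub, map_smul, map_smul]
          rcases i with r | j
          · rw [fanoVec_coord_inl]
            fin_cases r
            · simp only [smul_eq_mul, Fin.zero_eta]
              rw [if_neg (by decide)]; ring
            · simp only [smul_eq_mul, Fin.mk_one, if_true]
              rw [eq_inv_mul_iff_mul_eq₀ huv, hDe]; ring
          · rw [fanoVec_coord_inr, hp]
            simp only [Nm, one_ne_zero, if_false, eval_fanoDet, smul_eq_mul]
            ring
        apply Subtype.ext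
        have hfd : Module.finrank ℂ (fanoGrChart b p).1 = Module.finrank ℂ W.1 :=
          (fanoGrChart b p).2.trans W.2.symm
        refine Submodule.eq_of_le_of_finrank_eq ?_ hfd
        refine Submodule.span_le.mpr ?_
        rintro x (rfl | rfl)
        · rw [hU]
          exact W.1.smul_mem _ (sub_mem (W.1.smul_mem _ hu) (W.1.smul_mem _ hv))
        · rw [hV]
          exact W.1.smul_mem _ (sub_mem (W.1.smul_mem _ hv) (W.1.smul_mem _ hu))
    rw [this]
    exact TopologicalSpace.isOpen_generateFrom_of_mem ⟨D, rfl⟩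
  · rintro U ⟨F, rfl⟩
    let M (q : (ℂ × ℂ) × (ℂ × ℂ)) : Fin (n+1) ⊕ Fin (n+1) → MvPolynomial (Fin 2 × Fin m) ℂ :=
      Sum.elim (fun t => C q.1.1 * fanoVecPoly b 0 t + C q.1.2 * fanoVecPoly b 1 t)
        (fun t => C q.2.1 * fanoVecPoly b 0 t + C q.2.2 * fanoVecPoly b 1 t)
    have hM : ∀ q p, (fun t => eval p (M q t)) = Sum.elim
        (q.1.1 • fanoVec b p 0 + q.1.2 • fanoVec b p 1)
        (q.2.1 • fanoVec b p 0 + q.2.2 • fanoVec b p 1) := by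
      intro q p
      ext t
      rcases t with t | t <;> simp [M, eval_fanoVecPoly]
    refine ⟨Set.range fun q => aeval (M q) F, ?_⟩
    ext p
    simp only [Set.mem_preimage, Set.mem_setOf_eq, Set.mem_range, forall_exists_index,
      forall_apply_eq_imp_iff, fano_eval_aeval, hM]
    apply not_congr
    constructor
    · intro h q
      exact h _ (Submodule.mem_span_pair.mpr ⟨_, _, rfl⟩) _ (Submodule.mem_span_pair.mpr ⟨_, _, rfl⟩)
    · intro h u hu v hv
      obtain ⟨a, c, rfl⟩ := Submodule.mem_span_pair.mp hu
      obtain ⟨a', c', rfl⟩ := Submodule.mem_span_pair.mp hv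
      exact h ((a, c), (a', c'))
  · intro g
    obtain ⟨k, G, hG, e⟩ := fano_clear 2 D Nm (fanoDet_homog _ _) hNm g
    refine ⟨_, TopologicalSpace.isOpen_generateFrom_of_mem ⟨D * G, rfl⟩, ?_⟩
    have hfrac : ∀ p, ∀ u ∈ (fanoGrChart b p).1, ∀ v ∈ (fanoGrChart b p).1,
        eval (Sum.elim u v) D ≠ 0 →
        (fun j => eval (Sum.elim u v) (Nm j) / eval (Sum.elim u v) D) = p := by
      intro p u hu v hv hne
      obtain ⟨a, c, rfl⟩ := Submodule.mem_span_pair.mp hu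
      obtain ⟨a', c', rfl⟩ := Submodule.mem_span_pair.mp hv
      ext ⟨r, j⟩
      rw [div_eq_iff hne, hD]
      fin_cases r
      · simp [Nm, eval_fanoDet, fanoVec_coord_inl, fanoVec_coord_inr, -Module.Basis.coord_apply]
        ring
      · simp [Nm, eval_fanoDet, fanoVec_coord_inl, fanoVec_coord_inr, -Module.Basis.coord_apply]
        ring
    ext p
    simp only [Set.mem_preimage, Set.mem_setOf_eq, map_mul]
    constructor
    · intro h h0
      refine h fun u hu v hv => ?_
      by_cases hne : eval (Sum.elim u v) D = 0
      · rw [hne, zero_mul]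
      · rw [e _ hne, hfrac p u hu v hv hne, h0, mul_zero, mul_zero]
    · intro h h0
      have h1 := h0 _ (hmem0 p) _ (hmem1 p)
      have hne : eval (Sum.elim (fanoVec b p 0) (fanoVec b p 1)) D ≠ 0 := by
        rw [hDp]; exact one_ne_zero
      rw [e _ hne, hfrac p _ (hmem0 p) _ (hmem1 p) hne, hDp] at h1
      apply h
      simpa using h1


open MvPolynomial in
lemma fano_eval_zero {n k : ℕ} (hk : k ≠ 0) {f : MvPolynomial (Fin n) ℂ} (hf : f.IsHomogeneous k) :
    eval 0 f = 0 := by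
  have := fano_eval_smul hf 0 0
  simpa [hk] using this

open MvPolynomial in
lemma fano_mem_fanoLines {n s : ℕ} (d : Fin s → ℕ) (f : Fin s → MvPolynomial (Fin (n+1)) ℂ)
    (hd : ∀ i, d i ≠ 0) (hf : ∀ i, (f i).IsHomogeneous (d i)) (W : ProjLine n) :
    W ∈ fanoLines (fanoLocus f) ↔ ∀ u ∈ W.1, ∀ i, eval u (f i) = 0 := by
  constructor
  · intro h u hu i
    by_cases hu0 : u = 0
    · rw [hu0]; exact fano_eval_zero (hd i) (hf i)
    · have h1 : Projectivization.mk ℂ u hu0 ∈ lineSet W.1 := by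
        obtain ⟨a, ha⟩ := Projectivization.exists_smul_eq_mk_rep ℂ u hu0
        change (Projectivization.mk ℂ u hu0).rep ∈ W.1
        rw [← ha]
        exact W.1.smul_mem (a : ℂ) hu
      exact (fano_eval_rep (hf i) u hu0).mp (h h1 i)
  · intro h x hx i
    exact h _ hx i

open MvPolynomial in
lemma fano_poly_eval {σ : Type} (q : σ → Polynomial ℂ) (f : MvPolynomial σ ℂ) (t : ℂ) :
    (aeval q f).eval t = eval (fun j => (q j).eval t) f := by
  induction f using MvPolynomial.induction_on with
  | C a => simp
  | add p q hp hq => simp only [map_add, Polynomial.eval_add, hp, hq]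
  | mul_X p j hp => simp only [map_mul, Polynomial.eval_mul, hp, aeval_X, eval_X]

open MvPolynomial in
lemma fano_line_vanish {n k : ℕ} {f : MvPolynomial (Fin (n+1)) ℂ} (hf : f.IsHomogeneous k)
    (U V : Fin (n+1) → ℂ) (h : ∀ j : Fin (k+1), eval (U + ((j : ℕ) : ℂ) • V) f = 0) (a c : ℂ) :
    eval (a • U + c • V) f = 0 := by
  have hev : ∀ (U V : Fin (n+1) → ℂ) (t : ℂ), (aeval (fun j => Polynomial.C (U j) +
      Polynomial.C (V j) * Polynomial.X) f).eval t = eval (U + t • V) f := by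
    intro U V t
    rw [fano_poly_eval]
    have : (fun j => (Polynomial.C (U j) + Polynomial.C (V j) * Polynomial.X).eval t) =
        U + t • V := by
      funext j
      rw [Pi.add_apply, Pi.smul_apply, smul_eq_mul, Polynomial.eval_add, Polynomial.eval_mul,
        Polynomial.eval_C, Polynomial.eval_C, Polynomial.eval_X, mul_comm]
    rw [this]
  have hP : (aeval (fun j => Polynomial.C (U j) + Polynomial.C (V j) * Polynomial.X) f :
      Polynomial ℂ) = 0 := by
    refine Polynomial.eq_zero_of_natDegree_lt_card_of_eval_eq_zero _
      (f := fun j : Fin (k+1) => ((j : ℕ) : ℂ)) ?_ ?_ ?_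
    · intro i j hij
      exact Fin.ext (Nat.cast_injective hij)
    · intro j
      rw [hev]; exact h j
    · rw [Fintype.card_fin]
      have := MvPolynomial.aeval_natDegree_le f hf.totalDegree_le
        (fun j => Polynomial.C (U j) + Polynomial.C (V j) * Polynomial.X) (n := 1) (fun j => by
          compute_degree)
      omega
  have h1 : ∀ t, eval (U + t • V) f = 0 := fun t => by rw [← hev, hP, Polynomial.eval_zero]
  have h2 : ∀ a c : ℂ, a ≠ 0 → eval (a • U + c • V) f = 0 := by
    intro a c ha
    have : a • U + c • V = a • (U + (c / a) • V) := by
      rw [smul_add, smul_smul, mul_div_cancel₀ _ ha]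
    rw [this, fano_eval_smul hf, h1, mul_zero]
  by_cases ha : a = 0
  · subst ha
    have hQ : (aeval (fun j => Polynomial.C ((c • V) j) + Polynomial.C (U j) * Polynomial.X) f :
      Polynomial ℂ) = 0 := by
      refine Polynomial.eq_zero_of_infinite_isRoot _ ?_
      refine Set.Infinite.mono (s := {0}ᶜ) ?_ (Set.finite_singleton 0).infinite_compl
      intro t ht
      change Polynomial.eval _ _ = 0
      rw [hev, add_comm (c • V)]
      exact h2 t c ht
    have := hev (c • V) U 0
    rw [hQ, Polynomial.eval_zero] at this
    rw [add_comm (_ • U), ← this]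
  · exact h2 a c ha

open MvPolynomial in
/-- equations of the Fano scheme in a chart -/
noncomputable def fanoEq {n m s : ℕ} (d : Fin s → ℕ) (f : Fin s → MvPolynomial (Fin (n+1)) ℂ)
    (b : Module.Basis (Fin 2 ⊕ Fin m) ℂ (Fin (n+1) → ℂ)) (q : Σ i : Fin s, Fin (d i + 1)) :
    MvPolynomial (Fin 2 × Fin m) ℂ :=
  aeval (fun t => fanoVecPoly b 0 t + C ((q.2 : ℕ) : ℂ) * fanoVecPoly b 1 t) (f q.1)

open MvPolynomial in
lemma eval_fanoEq {n m s : ℕ} (d : Fin s → ℕ) (f : Fin s → MvPolynomial (Fin (n+1)) ℂ)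
    (b : Module.Basis (Fin 2 ⊕ Fin m) ℂ (Fin (n+1) → ℂ)) (q : Σ i : Fin s, Fin (d i + 1))
    (p : Fin 2 × Fin m → ℂ) :
    eval p (fanoEq d f b q) = eval (fanoVec b p 0 + ((q.2 : ℕ) : ℂ) • fanoVec b p 1) (f q.1) := by
  rw [fanoEq, fano_eval_aeval]
  congr 2
  ext t
  simp [eval_fanoVecPoly]

open MvPolynomial in
lemma fano_chart_mem {n m s : ℕ} (d : Fin s → ℕ) (f : Fin s → MvPolynomial (Fin (n+1)) ℂ)
    (hd : ∀ i, d i ≠ 0) (hf : ∀ i, (f i).IsHomogeneous (d i))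
    (b : Module.Basis (Fin 2 ⊕ Fin m) ℂ (Fin (n+1) → ℂ)) (p : Fin 2 × Fin m → ℂ) :
    fanoGrChart b p ∈ fanoLines (fanoLocus f) ↔ ∀ q, eval p (fanoEq d f b q) = 0 := by
  rw [fano_mem_fanoLines d f hd hf]
  constructor
  · intro h q
    rw [eval_fanoEq]
    exact h _ (Submodule.mem_span_pair.mpr ⟨1, _, by rw [one_smul]⟩) _
  · intro h u hu i
    obtain ⟨a, c, rfl⟩ := Submodule.mem_span_pair.mp hu
    refine fano_line_vanish (hf i) _ _ (fun j => ?_) a c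
    have := h ⟨i, j⟩
    rwa [eval_fanoEq] at this

lemma fano_span_vanish {σ ι : Type} (g : ι → MvPolynomial σ ℂ) (p : σ → ℂ) :
    (∀ q ∈ Ideal.span (Set.range g), MvPolynomial.eval p q = 0) ↔
      ∀ i, MvPolynomial.eval p (g i) = 0 := by
  constructor
  · exact fun h i => h _ (Ideal.subset_span ⟨i, rfl⟩)
  · intro h
    have : Ideal.span (Set.range g) ≤ fanoMax p := by
      rw [Ideal.span_le]; rintro _ ⟨i, rfl⟩; exact h i
    exact fun q hq => this hq

/-- adapted charts -/
lemma fano_adapted {n m : ℕ} (hm : 2 + m = n + 1) (W : ProjLine n) :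
    ∃ b : Module.Basis (Fin 2 ⊕ Fin m) ℂ (Fin (n+1) → ℂ), fanoGrChart b 0 = W := by
  let B := Module.finBasisOfFinrankEq ℂ W.1 W.2
  obtain ⟨b, hb⟩ := fano_basis_sum hm (fun r => (B r : Fin (n+1) → ℂ))
    (B.linearIndependent.map' W.1.subtype (Submodule.ker_subtype _))
  refine ⟨b, ?_⟩
  apply Subtype.ext
  have hfd : Module.finrank ℂ (fanoGrChart b 0).1 = Module.finrank ℂ W.1 :=
    (fanoGrChart b 0).2.trans W.2.symm
  refine Submodule.eq_of_le_of_finrank_eq ?_ hfd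
  refine Submodule.span_le.mpr ?_
  have : ∀ r, fanoVec b 0 r = B r := by
    intro r
    simp [fanoVec, hb]
  rintro x (rfl | rfl)
  · rw [this]; exact (B 0).2
  · rw [this]; exact (B 1).2

lemma fano_lower {n m s : ℕ} (hm : 2 + m = n + 1) (d : Fin s → ℕ)
    (f : Fin s → MvPolynomial (Fin (n+1)) ℂ)
    (hd : ∀ i, d i ≠ 0) (hf : ∀ i, (f i).IsHomogeneous (d i))
    (hne : (fanoLines (fanoLocus f)).Nonempty) :
    ((2 * m - (∑ i, d i + s) : ℕ) : WithBot ℕ∞) ≤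
      topologicalKrullDim ↥(fanoLines (fanoLocus f)) := by
  obtain ⟨W, hW⟩ := hne
  obtain ⟨b, rfl⟩ := fano_adapted hm W
  refine le_trans ?_ (fanoLocDim_le _ ⟨_, hW⟩)
  rw [(fanoGrChart_isChart b).locDim_eq _ (Ideal.span (Set.range (fanoEq d f b)))
    (fun x => by rw [fano_span_vanish, fano_chart_mem d f hd hf]) 0 hW]
  have h1 := fanoHt_le_add ⊥ (fanoMax (0 : Fin 2 × Fin m → ℂ)) bot_le (fanoEq d f b)
    ((fano_chart_mem d f hd hf b 0).mp hW)
  have h2 := (card_le_fanoHt_bot (0 : Fin 2 × Fin m → ℂ)).trans h1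
  rw [bot_sup_eq] at h2
  have h3 := fano_withBot_sub h2
  convert h3 using 3
  · simp
  · simp [Finset.sum_add_distrib]

/-- cutting with a hyperplane containing the line drops the local dimension by at most two -/
lemma fano_cut {n m s : ℕ} (d : Fin s → ℕ)
    (f : Fin s → MvPolynomial (Fin (n+1)) ℂ)
    (hd : ∀ i, d i ≠ 0) (hf : ∀ i, (f i).IsHomogeneous (d i))
    (b : Module.Basis (Fin 2 ⊕ Fin m) ℂ (Fin (n+1) → ℂ))
    (hW : fanoGrChart b 0 ∈ fanoLines (fanoLocus f))
    (h : (Fin (n+1) → ℂ) →ₗ[ℂ] ℂ) (hh : ∀ r, h (b (Sum.inl r)) = 0) :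
    fanoLocDim (fanoLines (fanoLocus f)) ⟨_, hW⟩ ≤
      topologicalKrullDim ↥{W : ProjLine n | W ∈ fanoLines (fanoLocus f) ∧
        W.1 ≤ LinearMap.ker h} + (2 : ℕ) := by
  rw [(fanoGrChart_isChart b).locDim_eq _ (Ideal.span (Set.range (fanoEq d f b)))
    (fun x => by rw [fano_span_vanish, fano_chart_mem d f hd hf]) 0 hW]
  set J := Ideal.span (Set.range (fanoEq d f b)) with hJ
  have hEq0 := (fano_chart_mem d f hd hf b 0).mp hW
  let q (r : Fin 2) : MvPolynomial (Fin 2 × Fin m) ℂ :=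
    MvPolynomial.aeval (fanoVecPoly b r) (fanoLin h)
  have hq : ∀ r p, MvPolynomial.eval p (q r) = h (fanoVec b p r) := by
    intro r p
    simp only [q]
    rw [fano_eval_aeval, eval_fanoLin]
    congr 1
    ext t
    rw [eval_fanoVecPoly]
  have hvec0 : ∀ r, fanoVec b 0 r = b (Sum.inl r) := by
    intro r
    simp [fanoVec]
  have hJm : J ≤ fanoMax 0 := by
    rw [hJ, Ideal.span_le]; rintro _ ⟨i, rfl⟩; exact hEq0 i
  have h1 := fanoHt_le_add J (fanoMax 0) hJm q (fun r => by
    rw [mem_fanoMax, hq, hvec0, hh])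
  rw [Fintype.card_fin] at h1
  refine h1.trans ?_
  have hmem : ∀ x, fanoGrChart b x ∈ {W : ProjLine n | W ∈ fanoLines (fanoLocus f) ∧
        W.1 ≤ LinearMap.ker h} ↔ ∀ g ∈ J ⊔ Ideal.span (Set.range q),
          MvPolynomial.eval x g = 0 := by
    intro x
    have e1 : (∀ g ∈ J ⊔ Ideal.span (Set.range q), MvPolynomial.eval x g = 0) ↔
        (J ≤ fanoMax x ∧ Ideal.span (Set.range q) ≤ fanoMax x) := by
      rw [← sup_le_iff]; rfl
    rw [e1]
    refine and_congr ?_ ?_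
    · rw [fano_chart_mem d f hd hf, ← fano_span_vanish]; rfl
    · have : Ideal.span (Set.range q) ≤ fanoMax x ↔
          (∀ g ∈ Ideal.span (Set.range q), MvPolynomial.eval x g = 0) := Iff.rfl
      rw [this, fano_span_vanish]
      simp only [hq]
      constructor
      · intro hle r
        refine hle (Submodule.subset_span ?_)
        fin_cases r <;> simp
      · intro h0
        refine Submodule.span_le.mpr ?_
        rintro y (rfl | rfl)
        · exact h0 0
        · exact h0 1
  have hp : fanoGrChart b 0 ∈ {W : ProjLine n | W ∈ fanoLines (fanoLocus f) ∧
        W.1 ≤ LinearMap.ker h} := by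
    refine ⟨hW, ?_⟩
    refine Submodule.span_le.mpr ?_
    rintro y (rfl | rfl)
    · rw [hvec0]; exact hh 0
    · rw [hvec0]; exact hh 1
  have h2 := (fanoGrChart_isChart b).locDim_eq _ _ hmem 0 hp
  rw [← h2]
  gcongr
  exact fanoLocDim_le _ _


lemma fano_nonempty_of_dim {T : Type*} [TopologicalSpace T] {S : Set T} {k : ℕ}
    (h : topologicalKrullDim ↥S = (k : WithBot ℕ∞)) : S.Nonempty := by
  by_contra hS
  rw [Set.not_nonempty_iff_eq_empty] at hS
  subst hS
  have : IsEmpty (TopologicalSpace.IrreducibleCloseds (∅ : Set T)) :=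
    ⟨fun Z => by obtain ⟨x, -⟩ := Z.isIrreducible.nonempty; exact x.2⟩
  rw [topologicalKrullDim, Order.krullDim_eq_bot] at h
  exact WithBot.bot_ne_coe h

open MvPolynomial in
/-- composition with a linear map -/
noncomputable def fanoComp {n n' : ℕ} (A : (Fin n' → ℂ) →ₗ[ℂ] (Fin n → ℂ))
    (f : MvPolynomial (Fin n) ℂ) : MvPolynomial (Fin n') ℂ :=
  aeval (fun t => fanoLin (LinearMap.proj t ∘ₗ A)) f

open MvPolynomial in
lemma eval_fanoComp {n n' : ℕ} (A : (Fin n' → ℂ) →ₗ[ℂ] (Fin n → ℂ))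
    (f : MvPolynomial (Fin n) ℂ) (y : Fin n' → ℂ) : eval y (fanoComp A f) = eval (A y) f := by
  rw [fanoComp, fano_eval_aeval]
  simp only [eval_fanoLin]
  rfl

open MvPolynomial in
lemma fanoComp_homog {n n' : ℕ} (A : (Fin n' → ℂ) →ₗ[ℂ] (Fin n → ℂ))
    {f : MvPolynomial (Fin n) ℂ} {k : ℕ} (hf : f.IsHomogeneous k) :
    (fanoComp A f).IsHomogeneous k := by
  have := hf.aeval (fun t => fanoLin (LinearMap.proj t ∘ₗ A)) (fun t => fanoLin_homog _)
  rwa [one_mul] at this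

open MvPolynomial in
lemma pderiv_fanoLin {m : ℕ} (l : (Fin m → ℂ) →ₗ[ℂ] ℂ) (j : Fin m) :
    pderiv j (fanoLin l) = C (l (Pi.single j 1)) := by
  classical
  rw [fanoLin, map_sum, Finset.sum_eq_single j]
  · simp
  · intro t _ h; simp [pderiv_X, Pi.single_apply, h]
  · simp

open MvPolynomial in
lemma eval_pderiv_fanoComp {n n' : ℕ} (A : (Fin n' → ℂ) →ₗ[ℂ] (Fin n → ℂ))
    (f : MvPolynomial (Fin n) ℂ) (y : Fin n' → ℂ) (j : Fin n') :
    eval y (pderiv j (fanoComp A f)) =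
      ∑ t, eval (A y) (pderiv t f) * A (Pi.single j 1) t := by
  rw [fanoComp, fano_chain, map_sum]
  refine Finset.sum_congr rfl fun t _ => ?_
  rw [map_mul, pderiv_fanoLin, eval_C]
  exact congrArg₂ _ (eval_fanoComp A _ y) rfl

open MvPolynomial in
/-- composition of a polynomial in two vectors with a linear map -/
noncomputable def fanoComp2 {n n' : ℕ} (A : (Fin n' → ℂ) →ₗ[ℂ] (Fin n → ℂ))
    (f : MvPolynomial (Fin n ⊕ Fin n) ℂ) : MvPolynomial (Fin n' ⊕ Fin n') ℂ :=
  aeval (Sum.elim (fun t => rename Sum.inl (fanoLin (LinearMap.proj t ∘ₗ A)))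
    (fun t => rename Sum.inr (fanoLin (LinearMap.proj t ∘ₗ A)))) f

open MvPolynomial in
lemma eval_fanoComp2 {n n' : ℕ} (A : (Fin n' → ℂ) →ₗ[ℂ] (Fin n → ℂ))
    (f : MvPolynomial (Fin n ⊕ Fin n) ℂ) (u v : Fin n' → ℂ) :
    eval (Sum.elim u v) (fanoComp2 A f) = eval (Sum.elim (A u) (A v)) f := by
  rw [fanoComp2, fano_eval_aeval]
  congr 2
  ext t
  rcases t with t | t
  · simp only [Sum.elim_inl, eval_rename, Sum.elim_comp_inl, eval_fanoLin]; rfl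
  · simp only [Sum.elim_inr, eval_rename, Sum.elim_comp_inr, eval_fanoLin]; rfl

/-- Data of the smooth hyperplane section -/
lemma fano_section {n s : ℕ} (d : Fin s → ℕ) (f : Fin s → MvPolynomial (Fin (n+1+1)) ℂ)
    (hd : ∀ i, d i ≠ 0) (hf : ∀ i, (f i).IsHomogeneous (d i)) (hs : s ≤ n)
    (hsm : ∀ v, v ≠ 0 → (∀ i, MvPolynomial.eval v (f i) = 0) →
      LinearIndependent ℂ (fun i j => MvPolynomial.eval v (MvPolynomial.pderiv j (f i))))
    (h : (Fin (n+1+1) → ℂ) →ₗ[ℂ] ℂ)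
    (hh : ∀ x ≠ 0, (∀ i, MvPolynomial.eval x (f i) = 0) → ∀ c : Fin s → ℂ,
      ¬ ∀ j, h (Pi.single j 1) = ∑ i, c i * MvPolynomial.eval x (MvPolynomial.pderiv j (f i))) :
    ∃ A : (Fin (n+1) → ℂ) →ₗ[ℂ] (Fin (n+1+1) → ℂ), Function.Injective A ∧
      LinearMap.range A = LinearMap.ker h ∧
      ∀ v, v ≠ 0 → (∀ i, MvPolynomial.eval v (fanoComp A (f i)) = 0) →
        LinearIndependent ℂ (fun i j => MvPolynomial.eval v
          (MvPolynomial.pderiv j (fanoComp A (f i)))) := by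
  have hne : h ≠ 0 := by
    rintro rfl
    obtain ⟨x, hx, hfx⟩ := fano_nonempty f (fun i => fano_eval_zero (hd i) (hf i)) (by omega)
    exact hh x hx hfx 0 (fun j => by simp)
  obtain ⟨z, hz⟩ : ∃ z, h z = 1 := LinearMap.surjective hne 1
  have hfr : Module.finrank ℂ (LinearMap.ker h) = n + 1 := by
    have h1 := LinearMap.finrank_range_add_finrank_ker h
    rw [LinearMap.range_eq_top.mpr (LinearMap.surjective hne)] at h1
    simp at h1
    omega
  let B := Module.finBasisOfFinrankEq ℂ (LinearMap.ker h) hfr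
  let A : (Fin (n+1) → ℂ) →ₗ[ℂ] (Fin (n+1+1) → ℂ) :=
    (LinearMap.ker h).subtype ∘ₗ B.equivFun.symm.toLinearMap
  have hAinj : Function.Injective A := by
    intro x y hxy
    exact B.equivFun.symm.injective (Subtype.ext hxy)
  have hAr : LinearMap.range A = LinearMap.ker h := by
    rw [LinearMap.range_comp, LinearEquiv.range, Submodule.map_top, Submodule.range_subtype]
  refine ⟨A, hAinj, hAr, fun v hv hgv => ?_⟩
  have hAv : A v ≠ 0 := fun h0 => hv (hAinj (h0.trans (map_zero A).symm))
  have hfv : ∀ i, MvPolynomial.eval (A v) (f i) = 0 := fun i => by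
    rw [← eval_fanoComp]; exact hgv i
  have hind := hsm (A v) hAv hfv
  rw [Fintype.linearIndependent_iff] at hind ⊢
  intro c hc
  let L : (Fin (n+1+1) → ℂ) →ₗ[ℂ] ℂ := ∑ t, (∑ i, c i * MvPolynomial.eval (A v)
      (MvPolynomial.pderiv t (f i))) • LinearMap.proj t
  have hLapp : ∀ y, L y = ∑ i, c i * ∑ t, MvPolynomial.eval (A v)
      (MvPolynomial.pderiv t (f i)) * y t := by
    intro y
    simp only [L, LinearMap.sum_apply, LinearMap.smul_apply, LinearMap.proj_apply,
      smul_eq_mul, Finset.sum_mul, Finset.mul_sum]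
    rw [Finset.sum_comm]
    exact Finset.sum_congr rfl fun i _ => Finset.sum_congr rfl fun t _ => by ring
  have hLs : ∀ j, L (Pi.single j 1) = ∑ i, c i * MvPolynomial.eval (A v)
      (MvPolynomial.pderiv j (f i)) := by
    intro j
    rw [hLapp]
    simp [Pi.single_apply]
  have hLA : L ∘ₗ A = 0 := by
    refine (Pi.basisFun ℂ (Fin (n+1))).ext fun j => ?_
    rw [Pi.basisFun_apply, LinearMap.comp_apply, hLapp, LinearMap.zero_apply]
    have := congrFun hc j
    simp only [Finset.sum_apply, Pi.smul_apply, eval_pderiv_fanoComp, smul_eq_mul,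
      Pi.zero_apply] at this
    exact this
  have hLh : ∀ y, L y = L z * h y := by
    intro y
    have h1 : y - h y • z ∈ LinearMap.range A := by
      rw [hAr, LinearMap.mem_ker, map_sub, map_smul, hz]; simp
    obtain ⟨w, hw⟩ := h1
    have h2 : L (y - h y • z) = 0 := by
      rw [← hw]; exact LinearMap.congr_fun hLA w
    rw [map_sub, map_smul, sub_eq_zero] at h2
    rw [h2, smul_eq_mul, mul_comm]
  refine hind c ?_
  by_cases hLz : L z = 0
  · ext t
    have := hLs t
    rw [hLh, hLz, zero_mul] at this
    simpa [Finset.sum_apply] using this.symm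
  · exfalso
    refine hh (A v) hAv hfv (fun i => (L z)⁻¹ * c i) fun j => ?_
    simp only [mul_assoc]
    rw [← Finset.mul_sum, ← hLs, hLh (Pi.single j 1), inv_mul_cancel_left₀ hLz]

/-- lines of the section are lines of the ambient variety in the hyperplane -/
lemma fano_inducing {n n' s : ℕ} (d : Fin s → ℕ) (f : Fin s → MvPolynomial (Fin (n+1)) ℂ)
    (hd : ∀ i, d i ≠ 0) (hf : ∀ i, (f i).IsHomogeneous (d i))
    (h : (Fin (n+1) → ℂ) →ₗ[ℂ] ℂ)
    (A : (Fin (n'+1) → ℂ) →ₗ[ℂ] (Fin (n+1) → ℂ)) (hA : Function.Injective A)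
    (hAr : LinearMap.range A = LinearMap.ker h) :
    topologicalKrullDim ↥{W : ProjLine n | W ∈ fanoLines (fanoLocus f) ∧
        W.1 ≤ LinearMap.ker h} ≤
      topologicalKrullDim ↥(fanoLines (fanoLocus fun i => fanoComp A (f i))) := by
  set S := {W : ProjLine n | W ∈ fanoLines (fanoLocus f) ∧ W.1 ≤ LinearMap.ker h} with hS
  obtain ⟨π, hπ⟩ := LinearMap.exists_leftInverse_of_injective A (LinearMap.ker_eq_bot.mpr hA)
  have hπ' : ∀ y, π (A y) = y := fun y => LinearMap.congr_fun hπ y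
  have hfr : ∀ W : S, Module.finrank ℂ (W.1.1.comap A) = 2 := by
    intro W
    have h1 : (W.1.1.comap A).map A = W.1.1 :=
      Submodule.map_comap_eq_self (by rw [hAr]; exact W.2.2)
    have h2 := LinearEquiv.finrank_eq (Submodule.equivMapOfInjective A hA (W.1.1.comap A))
    rw [h2, h1]
    exact W.1.2
  let e : S → fanoLines (fanoLocus fun i => fanoComp A (f i)) := fun W =>
    ⟨⟨W.1.1.comap A, hfr W⟩, by
      refine (fano_mem_fanoLines d _ hd (fun i => fanoComp_homog A (hf i)) _).mpr ?_
      intro u hu i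
      rw [eval_fanoComp]
      exact (fano_mem_fanoLines d f hd hf W.1).mp W.2.1 _ hu i⟩
  have hmem : ∀ W : S, ∀ u ∈ W.1.1, ∃ y ∈ W.1.1.comap A, A y = u := by
    intro W u hu
    have : u ∈ LinearMap.range A := by rw [hAr]; exact W.2.2 hu
    obtain ⟨y, rfl⟩ := this
    exact ⟨y, hu, rfl⟩
  have hind : Topology.IsInducing e := by
    refine ⟨?_⟩
    change TopologicalSpace.induced Subtype.val (grassZariski n) =
      TopologicalSpace.induced e (TopologicalSpace.induced Subtype.val (grassZariski n'))
    rw [induced_compose, grassZariski, grassZariski, induced_generateFrom_eq,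
      induced_generateFrom_eq]
    congr 1
    ext U
    constructor
    · rintro ⟨_, ⟨F, rfl⟩, rfl⟩
      refine ⟨_, ⟨fanoComp2 A F, rfl⟩, ?_⟩
      ext W
      simp only [Set.mem_preimage, Set.mem_setOf_eq, Function.comp_apply]
      apply not_congr
      constructor
      · intro hW u hu v hv
        obtain ⟨u, hu, rfl⟩ := hmem W u hu
        obtain ⟨v, hv, rfl⟩ := hmem W v hv
        rw [← eval_fanoComp2]
        exact hW u hu v hv
      · intro hW u hu v hv
        rw [eval_fanoComp2]
        exact hW _ hu _ hv
    · rintro ⟨_, ⟨F, rfl⟩, rfl⟩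
      refine ⟨_, ⟨fanoComp2 π F, rfl⟩, ?_⟩
      ext W
      simp only [Set.mem_preimage, Set.mem_setOf_eq, Function.comp_apply]
      apply not_congr
      constructor
      · intro hW u hu v hv
        have := hW _ hu _ hv
        rwa [eval_fanoComp2, hπ', hπ'] at this
      · intro hW u hu v hv
        obtain ⟨u, hu, rfl⟩ := hmem W u hu
        obtain ⟨v, hv, rfl⟩ := hmem W v hv
        rw [eval_fanoComp2, hπ', hπ']
        exact hW u hu v hv
  exact hind.topologicalKrullDim_le

lemma fano_smoothCI {n s : ℕ} (d : Fin s → ℕ) (f : Fin s → MvPolynomial (Fin (n+1)) ℂ)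
    (hd : ∀ i, 2 ≤ d i) (hf : ∀ i, (f i).IsHomogeneous (d i)) (hs : s ≤ n)
    (hsm : ∀ v, v ≠ 0 → (∀ i, MvPolynomial.eval v (f i) = 0) →
      LinearIndependent ℂ (fun i j => MvPolynomial.eval v (MvPolynomial.pderiv j (f i)))) :
    IsSmoothCI n s d f (fanoLocus f) :=
  ⟨hd, hf, rfl, fano_jac_dim d f (fun i => by have := hd i; omega) hf hs hsm,
    fun v hv h0 => (fano_rank_indep _).mpr (hsm v hv h0)⟩

lemma fano_step {n s : ℕ} (d : Fin s → ℕ) (hd2 : ∀ i, 2 ≤ d i) (hds : s + 2 ≤ ∑ i, d i)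
    (hn : ∑ i, d i ≤ n)
    (IH : ∀ (g : Fin s → MvPolynomial (Fin (n + 1)) ℂ)
        (Y : Set (Projectivization ℂ (Fin (n + 1) → ℂ))), IsSmoothCI n s d g Y →
        topologicalKrullDim ↥(fanoLines Y) = ((2 * n - ∑ i, d i - s - 2 : ℕ) : WithBot ℕ∞))
    (f : Fin s → MvPolynomial (Fin (n + 1 + 1)) ℂ)
    (X : Set (Projectivization ℂ (Fin (n + 1 + 1) → ℂ))) (hX : IsSmoothCI (n+1) s d f X) :
    topologicalKrullDim ↥(fanoLines X) =
      ((2 * (n+1) - ∑ i, d i - s - 2 : ℕ) : WithBot ℕ∞) := by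
  have hd : ∀ i, d i ≠ 0 := fun i => by have := hd2 i; omega
  have hf := hX.homog
  obtain rfl : X = fanoLocus f := hX.locus
  have hsm : ∀ v, v ≠ 0 → (∀ i, MvPolynomial.eval v (f i) = 0) →
      LinearIndependent ℂ (fun i j => MvPolynomial.eval v (MvPolynomial.pderiv j (f i))) :=
    fun v hv h0 => (fano_rank_indep _).mp (hX.smooth v hv h0)
  have hsec : ∀ h : (Fin (n+1+1) → ℂ) →ₗ[ℂ] ℂ,
      (∀ x ≠ 0, (∀ i, MvPolynomial.eval x (f i) = 0) → ∀ c : Fin s → ℂ,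
      ¬ ∀ j, h (Pi.single j 1) = ∑ i, c i * MvPolynomial.eval x (MvPolynomial.pderiv j (f i))) →
      ∃ A : (Fin (n+1) → ℂ) →ₗ[ℂ] (Fin (n+1+1) → ℂ), Function.Injective A ∧
      LinearMap.range A = LinearMap.ker h ∧
      topologicalKrullDim ↥(fanoLines (fanoLocus fun i => fanoComp A (f i))) =
        ((2 * n - ∑ i, d i - s - 2 : ℕ) : WithBot ℕ∞) := by
    intro h hh
    obtain ⟨A, hA, hAr, hsmA⟩ := fano_section d f hd hf (by omega) hsm h hh
    exact ⟨A, hA, hAr, IH _ _ (fano_smoothCI d _ hd2 (fun i => fanoComp_homog A (hf i))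
      (by omega) hsmA)⟩
  refine le_antisymm ?_ ?_
  · refine fano_dim_le_of_locDim _ _ ?_
    rintro ⟨W, hW⟩
    obtain ⟨b, rfl⟩ := fano_adapted (m := n) (by omega) W
    obtain ⟨h, hh0, hh⟩ := fano_bertini (n+1) s d f hf b (by omega)
    obtain ⟨A, hA, hAr, hdim⟩ := hsec h hh
    refine (fano_cut d f hd hf b hW h hh0).trans ?_
    have h1 := fano_inducing d f hd hf h A hA hAr
    rw [hdim] at h1
    refine (add_le_add_left h1 _).trans ?_
    rw [← Nat.cast_add]
    refine Nat.cast_le.mpr ?_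
    omega
  · obtain ⟨b, -⟩ := fano_basis_sum (w := 0) (m := n+1+1) (N := n+1+1) (by omega) (fun i => i.elim0)
      linearIndependent_empty_type
    obtain ⟨h, -, hh⟩ := fano_bertini (n+1) s d f hf b (by omega)
    obtain ⟨A, hA, hAr, hdim⟩ := hsec h hh
    obtain ⟨W, hW⟩ := fano_nonempty_of_dim hdim
    have hne : (fanoLines (fanoLocus f)).Nonempty := by
      refine ⟨⟨W.1.map A, ?_⟩, ?_⟩
      · rw [← LinearEquiv.finrank_eq (Submodule.equivMapOfInjective A hA W.1)]
        exact W.2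
      · refine (fano_mem_fanoLines d f hd hf _).mpr ?_
        rintro _ ⟨u, hu, rfl⟩ i
        rw [← eval_fanoComp]
        exact (fano_mem_fanoLines d _ hd (fun i => fanoComp_homog A (hf i)) W).mp hW u hu i
    have := fano_lower (m := n) (by omega) d f hd hf hne
    refine le_trans (Nat.cast_le.mpr ?_) this
    omega

lemma fano_quadric_smooth {N : ℕ} (v : Fin (N+1) → ℂ) (hv : v ≠ 0) :
    LinearIndependent ℂ (fun (_ : Fin 1) j => MvPolynomial.eval v (MvPolynomial.pderiv j
      (∑ t : Fin (N+1), MvPolynomial.X t ^ 2 : MvPolynomial (Fin (N+1)) ℂ))) := by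
  classical
  refine LinearIndependent.of_subsingleton 0 ?_
  intro h0
  apply hv
  ext j
  have := congrFun h0 j
  rw [map_sum, Finset.sum_eq_single j] at this
  · simpa using this
  · intro t _ h; simp [MvPolynomial.pderiv_X, Pi.single_apply, h]
  · simp

lemma fano_quadric_no_line {N : ℕ} (hN : N = 2) (W : Submodule ℂ (Fin (N+1) → ℂ))
    (hW : Module.finrank ℂ W = 2) (h : ∀ u ∈ W, ∑ t, u t ^ 2 = 0) : False := by
  let T : (Fin (N+1) → ℂ) →ₗ[ℂ] (Module.Dual ℂ W) :=
    W.dualRestrict ∘ₗ (dotProductEquiv ℂ (Fin (N+1))).toLinearMap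
  have hT : LinearMap.range T = ⊤ := by
    rw [LinearMap.range_comp, LinearEquiv.range, Submodule.map_top, LinearMap.range_eq_top]
    exact Subspace.dualRestrict_surjective
  have h1 := LinearMap.finrank_range_add_finrank_ker T
  rw [hT, finrank_top, Subspace.dual_finrank_eq, hW, Module.finrank_fin_fun] at h1
  have hle : W ≤ LinearMap.ker T := by
    intro w hw
    rw [LinearMap.mem_ker]
    ext ⟨u, hu⟩
    change w ⬝ᵥ u = 0
    have e1 := h _ (add_mem hw hu)
    have e2 := h _ hw
    have e3 := h _ hu
    have e4 : ∑ t, (w + u) t ^ 2 = ∑ t, w t ^ 2 + ∑ t, u t ^ 2 + 2 * (w ⬝ᵥ u) := by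
      rw [dotProduct, Finset.mul_sum, ← Finset.sum_add_distrib, ← Finset.sum_add_distrib]
      exact Finset.sum_congr rfl fun t _ => by rw [Pi.add_apply]; ring
    rw [e1, e2, e3] at e4
    simpa using e4.symm
  have h2 := Submodule.finrank_mono hle
  omega


/-- **Lemma (reduction to `n = d`).**  Fix degrees `d_1, …, d_s`.  If the Fano variety of
lines of every smooth complete intersection of type `(d_1, …, d_s)` in `ℙ^d` (where
`d = Σ d_i`) has dimension `d − s − 2`, then the Fano variety of lines of every smooth
complete intersection of type `(d_1, …, d_s)` in `ℙ^n`, `n ≥ d`, has dimension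
`2n − d − s − 2`. -/
theorem dim_fanoLines_of_dim_fanoLines_ambient_eq_sum
    (s : ℕ) (d : Fin s → ℕ)
    (H : ∀ (g : Fin s → MvPolynomial (Fin (∑ i, d i + 1)) ℂ)
      (Y : Set (Projectivization ℂ (Fin (∑ i, d i + 1) → ℂ))),
      IsSmoothCI (∑ i, d i) s d g Y →
      topologicalKrullDim ↥(fanoLines Y) = ((∑ i, d i - s - 2 : ℕ) : WithBot ℕ∞)) :
    ∀ n : ℕ, ∑ i, d i ≤ n →
      ∀ (f : Fin s → MvPolynomial (Fin (n + 1)) ℂ)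
        (X : Set (Projectivization ℂ (Fin (n + 1) → ℂ))),
        IsSmoothCI n s d f X →
        topologicalKrullDim ↥(fanoLines X) =
          ((2 * n - ∑ i, d i - s - 2 : ℕ) : WithBot ℕ∞) := by
  intro n hn f X hX
  have hd2 := hX.two_le_deg
  have h2s : 2 * s ≤ ∑ i, d i := by
    have h : Finset.univ.card • 2 ≤ ∑ i, d i :=
      Finset.card_nsmul_le_sum Finset.univ d 2 (fun i _ => hd2 i)
    rw [Finset.card_univ, Fintype.card_fin, smul_eq_mul] at h
    omega
  by_cases hds : s + 2 ≤ ∑ i, d i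
  · revert hX
    revert X
    revert f
    induction n, hn using Nat.le_induction with
    | base =>
      intro f X hX
      rw [H f X hX]
      congr 1
      omega
    | succ n hn IH =>
      intro f X hX
      exact fano_step d hd2 hds hn IH f X hX
  · exfalso
    have hs1 : s ≤ 1 := by omega
    interval_cases s
    · have hsum : ∑ i, d i = 0 := by simp
      have hY := fano_smoothCI (n := ∑ i, d i) d (fun i => i.elim0) hd2 (fun i => i.elim0)
        (by omega) (fun v _ _ => linearIndependent_empty_type)
      obtain ⟨W, -⟩ := fano_nonempty_of_dim (H _ _ hY)
      have h1 := Submodule.finrank_le W.1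
      have h2 := W.2
      rw [Module.finrank_fin_fun] at h1
      omega
    · have hsum : ∑ i, d i = 2 := by omega
      have hd0 : ∀ i, d i = 2 := by
        intro i
        rw [Subsingleton.elim i 0]
        simpa using hsum
      have hhom : ∀ i : Fin 1, (∑ t : Fin (∑ i, d i + 1), MvPolynomial.X t ^ 2 :
          MvPolynomial (Fin (∑ i, d i + 1)) ℂ).IsHomogeneous (d i) := by
        intro i
        rw [hd0 i]
        exact MvPolynomial.IsHomogeneous.sum _ _ _ fun t _ => MvPolynomial.isHomogeneous_X_pow t 2
      have hY := fano_smoothCI (n := ∑ i, d i) d (fun _ => ∑ t, MvPolynomial.X t ^ 2) hd2 hhom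
        (by omega) (fun v hv _ => fano_quadric_smooth v hv)
      obtain ⟨W, hW⟩ := fano_nonempty_of_dim (H _ _ hY)
      refine fano_quadric_no_line hsum W.1 W.2 fun u hu => ?_
      have := (fano_mem_fanoLines d _ (fun i => by rw [hd0 i]; decide) hhom W).mp hW u hu 0
      simpa using this

end
end

section
/- Let X ⊂ ℙ^n be a smooth complete intersection of s hypersurfaces of degrees d_1, …, d_s with d := d_1 + ⋯ + d_s. If d ≥ n, then X is not covered by lines: there exists a point p ∈ X such that no projective line through p is contained in X. -/
/-! Formalization of: a smooth complete intersection X ⊆ ℙ^n of s hypersurfaces of degrees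
d_1,…,d_s with d := Σ d_i ≥ n is not covered by lines: there is a point p ∈ X through which
no projective line contained in X passes. -/

noncomputable section

section NoLineHelpers

open scoped TensorProduct
open MvPolynomial


/-- Zariski's lemma -/
lemma fg_point (F R L : Type*) [Field F] [CommRing R] [Algebra F R] [Nontrivial R]
    [Algebra.FiniteType F R] [Field L] [IsAlgClosed L] [Algebra F L] :
    Nonempty (R →ₐ[F] L) := by
  obtain ⟨M, hM⟩ := Ideal.exists_maximal R
  let _ : Field (R ⧸ M) := Ideal.Quotient.field M
  have : Module.Finite F (R ⧸ M) := finite_of_finite_type_of_isJacobsonRing F (R ⧸ M)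
  exact ⟨(IsAlgClosed.lift (M := L) (R := F) (S := R ⧸ M)).comp (Ideal.Quotient.mkₐ F M)⟩

lemma chain_rule {k ι L : Type*} [Fintype ι] [CommRing k] [CommRing L] [Algebra k L]
    (D : Derivation k L L) (x : ι → L) (g : MvPolynomial ι k) :
    D (aeval x g) = ∑ j, aeval x (pderiv j g) * D (x j) := by
  induction g using MvPolynomial.induction_on with
  | C a => simp
  | add p q hp hq => simp [hp, hq, add_mul, Finset.sum_add_distrib]
  | mul_X p i hp =>
    classical
    simp only [map_mul, aeval_X, Derivation.leibniz, smul_eq_mul, hp, map_add, pderiv_X,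
      add_mul, Finset.sum_add_distrib, Finset.mul_sum]
    congr 1
    · rw [Finset.sum_eq_single i]
      · simp
      · intro b _ hb; simp [hb.symm]
      · simp
    · refine Finset.sum_congr rfl fun j _ => by ring

lemma exists_deriv {k A L : Type*} [CommRing k] [CommRing A] [CommRing L] [Algebra k A]
    [Algebra k L] [Algebra A L] [IsScalarTower k A L] [Algebra.FormallyEtale A L]
    (d : Derivation k A L) : ∃ D : Derivation k L L, ∀ a, D (algebraMap A L a) = d a := by
  refine ⟨((d.liftKaehlerDifferential.liftBaseChange L).comp
    (KaehlerDifferential.tensorKaehlerEquivOfFormallyEtale k A L).symm.toLinearMap).compDer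
      (KaehlerDifferential.D k L), fun a => ?_⟩
  simp [KaehlerDifferential.tensorKaehlerEquivOfFormallyEtale_symm_D_algebraMap]

lemma flat_point (A F S L : Type*) [CommRing A] [IsDomain A] [Field F] [Algebra A F]
    [IsFractionRing A F] [CommRing S] [Algebra A S] [Nontrivial S] [Module.Flat A S]
    [Algebra.FiniteType A S] [Field L] [IsAlgClosed L] [Algebra F L] [Algebra A L]
    [IsScalarTower A F L] : Nonempty (S →ₐ[A] L) := by
  have hinj : Function.Injective
      (Algebra.TensorProduct.includeRight : S →ₐ[A] F ⊗[A] S) :=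
    Algebra.TensorProduct.includeRight_injective (IsFractionRing.injective A F)
  have : Nontrivial (F ⊗[A] S) := hinj.nontrivial
  obtain ⟨θ⟩ := fg_point F (F ⊗[A] S) L
  exact ⟨(θ.restrictScalars A).comp Algebra.TensorProduct.includeRight⟩

noncomputable abbrev GF (κ : Type) := AlgebraicClosure (FractionRing (MvPolynomial κ ℂ))

lemma formallyEtale_GF (κ : Type) : Algebra.FormallyEtale (MvPolynomial κ ℂ) (GF κ) := by
  have h1 : Algebra.FormallyEtale (MvPolynomial κ ℂ) (FractionRing (MvPolynomial κ ℂ)) :=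
    Algebra.FormallyEtale.of_isLocalization (nonZeroDivisors _)
  have h2 : Algebra.FormallyEtale (FractionRing (MvPolynomial κ ℂ)) (GF κ) :=
    Algebra.FormallyEtale.of_isSeparable _ _
  exact Algebra.FormallyEtale.comp _ (FractionRing (MvPolynomial κ ℂ)) _

lemma exists_GF_deriv {κ : Type} [DecidableEq κ] (k : κ) : ∃ D : Derivation ℂ (GF κ) (GF κ),
    ∀ l, D (algebraMap (MvPolynomial κ ℂ) (GF κ) (X l)) = if l = k then 1 else 0 := by
  have := formallyEtale_GF κ
  obtain ⟨D, hD⟩ := exists_deriv (k := ℂ) (A := MvPolynomial κ ℂ) (L := GF κ)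
    (mkDerivation ℂ (fun l => if l = k then (1 : GF κ) else 0))
  exact ⟨D, fun l => by rw [hD, mkDerivation_X]⟩

lemma generic_point {σ κ : Type} [Fintype σ] [DecidableEq σ] [Fintype κ]
    (f : σ → MvPolynomial (σ ⊕ κ) ℂ) (p : σ ⊕ κ → ℂ) (hp : ∀ i, eval p (f i) = 0)
    (hdet : (Matrix.of fun i j => eval p (pderiv (Sum.inl i) (f j))).det ≠ 0) :
    ∃ z : σ → GF κ, ∀ i,
      aeval (Sum.elim z (fun k => algebraMap (MvPolynomial κ ℂ) (GF κ) (X k))) (f i) = 0 := by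
  let A := MvPolynomial κ ℂ
  let v : σ → MvPolynomial σ A := fun i => sumAlgEquiv ℂ σ κ (f i)
  let B := MvPolynomial σ A ⧸ (Ideal.span <| Set.range v)
  let P : Algebra.PreSubmersivePresentation A B σ σ :=
    Algebra.PreSubmersivePresentation.naive (v := v) (fun i => i) Function.injective_id
  let g : B := P.jacobian
  let S := Localization.Away g
  let Q : Algebra.SubmersivePresentation A S (Unit ⊕ σ) (Unit ⊕ σ) :=
    { (Algebra.PreSubmersivePresentation.localizationAway S g).comp P with
      jacobian_isUnit := by
        have hu : IsUnit (algebraMap B S g) := IsLocalization.Away.algebraMap_isUnit g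
        change IsUnit ((Algebra.PreSubmersivePresentation.localizationAway S g).comp P).jacobian
        rw [Algebra.PreSubmersivePresentation.comp_jacobian_eq_jacobian_smul_jacobian,
          Algebra.PreSubmersivePresentation.localizationAway_jacobian, Algebra.smul_def]
        exact hu.mul hu }
  have hS : Algebra.IsStandardSmooth A S := Q.isStandardSmooth
  have hflat : Module.Flat A S := inferInstance
  -- evaluation at p
  let φ : MvPolynomial σ A →+* ℂ := eval₂Hom (eval (p ∘ Sum.inr)) (p ∘ Sum.inl)
  have hφ : ∀ q : MvPolynomial (σ ⊕ κ) ℂ, φ (sumAlgEquiv ℂ σ κ q) = eval p q := by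
    intro q
    induction q using MvPolynomial.induction_on with
    | C a => simp [φ]; exact eval_C a
    | add p q hp hq => simp [hp, hq]
    | mul_X p i hp => 
      rw [map_mul, map_mul, hp, map_mul, eval_X]
      congr 1
      rcases i with i | i
      · simp [φ]
      · simp [φ]; exact eval_X i
  let ψ : B →+* ℂ := Ideal.Quotient.lift _ φ (by
    intro a ha
    have : Ideal.span (Set.range v) ≤ RingHom.ker φ := by
      rw [Ideal.span_le]
      rintro _ ⟨i, rfl⟩
      change φ _ = 0
      rw [hφ, hp]
    exact this ha)
  have hg : ψ g ≠ 0 := by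
    have : ψ g = (Matrix.of fun i j => eval p (pderiv (Sum.inl i) (f j))).det := by
      have h1 : g = Ideal.Quotient.mk _ P.jacobiMatrix.det := by
        change P.jacobian = _
        rw [P.jacobian_eq_jacobiMatrix_det]; rfl
      rw [h1]
      change φ _ = _
      rw [RingHom.map_det]
      congr 1
      ext i j
      change φ (P.jacobiMatrix i j) = _
      rw [Algebra.PreSubmersivePresentation.jacobiMatrix_naive]
      change φ (pderiv i (sumAlgEquiv ℂ σ κ (f j))) = _
      rw [pderiv_sumAlgEquiv, hφ]; rfl
    rwa [this]
  have hnt : Nontrivial S := 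
    (IsLocalization.Away.lift (S := S) g (g := ψ) (IsUnit.mk0 _ hg)).domain_nontrivial
  have hft : Algebra.FiniteType A S := inferInstance
  obtain ⟨θ'⟩ := flat_point A (FractionRing A) S (GF κ)
  let w : MvPolynomial σ A →ₐ[A] GF κ := 
    (θ'.comp (IsScalarTower.toAlgHom A B S)).comp (Ideal.Quotient.mkₐ A _)
  refine ⟨fun i => w (X i), fun i => ?_⟩
  have h0 : w (v i) = 0 := by
    have : (Ideal.Quotient.mkₐ A (Ideal.span (Set.range v))) (v i) = 0 := by
      rw [Ideal.Quotient.mkₐ_eq_mk, Ideal.Quotient.eq_zero_iff_mem]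
      exact Ideal.subset_span ⟨i, rfl⟩
    simp [w, this]
  rw [← h0]
  have : (aeval (Sum.elim (fun i => w (X i))
      (fun k => algebraMap (MvPolynomial κ ℂ) (GF κ) (X k))) : MvPolynomial (σ ⊕ κ) ℂ →ₐ[ℂ] GF κ)
      = (w.restrictScalars ℂ).comp (sumAlgEquiv ℂ σ κ).toAlgHom := by
    apply MvPolynomial.algHom_ext
    rintro (i | k)
    · simp
    · simp
      rfl
  rw [this]; rfl

lemma transfer_point {L : Type*} [Field L] [Algebra ℂ L] (T : Set L) (hT : T.Finite) :
    ∃ R : Subalgebra ℂ L, T ⊆ R ∧ Nonempty (R →ₐ[ℂ] ℂ) := by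
  refine ⟨Algebra.adjoin ℂ T, Algebra.subset_adjoin, ?_⟩
  have : Algebra.FiniteType ℂ (Algebra.adjoin ℂ T) :=
    (Subalgebra.fg_iff_finiteType _).1 (Subalgebra.fg_def.2 ⟨T, hT, rfl⟩)
  exact fg_point ℂ _ ℂ

lemma smooth_transfer {ι σ L : Type*} [Fintype ι] [Fintype σ] [Field L] [Algebra ℂ L]
    (f : σ → MvPolynomial ι ℂ)
    (hsm : ∀ v : ι → ℂ, v ≠ 0 → (∀ i, eval v (f i) = 0) → ∀ c : σ → ℂ,
      (∀ j, ∑ i, c i * eval v (pderiv j (f i)) = 0) → c = 0)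
    (v : ι → L) (hv : v ≠ 0) (hfv : ∀ i, aeval v (f i) = 0) (c : σ → L)
    (hc : ∀ j, ∑ i, c i * aeval v (pderiv j (f i)) = 0) : c = 0 := by
  by_contra hc0
  obtain ⟨a, ha⟩ := Function.ne_iff.1 hc0
  obtain ⟨b, hb⟩ := Function.ne_iff.1 hv
  simp only [Pi.zero_apply] at ha hb
  obtain ⟨R, hR, ⟨φ⟩⟩ := transfer_point (Set.range v ∪ Set.range c ∪ {(v b)⁻¹, (c a)⁻¹})
    (by simp [Set.finite_range])
  have hvR : ∀ j, v j ∈ R := fun j => hR (by simp)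
  have hcR : ∀ j, c j ∈ R := fun j => hR (by simp)
  have hbR : (v b)⁻¹ ∈ R := hR (by simp)
  have haR : (c a)⁻¹ ∈ R := hR (by simp)
  let v' : ι → R := fun j => ⟨v j, hvR j⟩
  let c' : σ → R := fun j => ⟨c j, hcR j⟩
  have key : ∀ g, ((aeval (R := ℂ) v' g : R) : L) = aeval v g := fun g => by
    change R.val (aeval v' g) = _
    rw [comp_aeval_apply]; rfl
  have key2 : ∀ g, φ (aeval v' g) = eval (fun j => φ (v' j)) g := fun g => by
    rw [comp_aeval_apply]; simp [coe_aeval_eq_eval]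
  have h1 := hsm (fun j => φ (v' j)) ?_ ?_ (fun i => φ (c' i)) ?_
  · have h2 : φ (c' a * ⟨_, haR⟩) = φ 1 := by
      congr 1; ext; simp [c', ha]
    rw [map_mul, congrFun h1 a] at h2
    simp at h2
  · intro h0
    have h2 : φ (v' b * ⟨_, hbR⟩) = φ 1 := by
      congr 1; ext; simp [v', hb]
    rw [map_mul, congrFun h0 b] at h2
    simp at h2
  · intro i
    rw [← key2]
    have : aeval v' (f i) = 0 := by ext; rw [key, hfv]; rfl
    rw [this, map_zero]
  · intro j
    simp only [← key2, ← map_mul, ← map_sum]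
    have : ∑ i, c' i * aeval v' (pderiv j (f i)) = 0 := by
      ext
      simp only [AddSubmonoidClass.coe_finsetSum, MulMemClass.coe_mul, key]
      exact hc j
    rw [this, map_zero]

/-- The equations (in `u, b`) expressing that the line through `x` with direction `u` lies in
the locus of the `f i`. -/
noncomputable def lineEqs {ι σ : Type*} [Fintype ι] (f : σ → MvPolynomial ι ℂ) (l : ι)
    {T : Type*} [CommRing T] [Algebra ℂ T] (x : ι → T) :
    (σ × ℕ) ⊕ Bool → MvPolynomial (ι ⊕ ι) T
  | .inl (i, t) => aeval (fun j => C (x j) + (t : MvPolynomial (ι ⊕ ι) T) * X (Sum.inl j)) (f i)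
  | .inr true => X (Sum.inl l)
  | .inr false => ∑ j, X (Sum.inl j) * X (Sum.inr j) - 1

lemma line_transfer {ι σ L : Type*} [Fintype ι] [Field L] [IsAlgClosed L] [Algebra ℂ L]
    (f : σ → MvPolynomial ι ℂ)
    (hcov : ∀ v : ι → ℂ, v ≠ 0 → (∀ i, eval v (f i) = 0) → ∃ u : ι → ℂ,
      (∀ c : ℂ, u ≠ c • v) ∧ ∀ (a b : ℂ) (i : σ), eval (a • v + b • u) (f i) = 0)
    (x : ι → L) (hx : x ≠ 0) (hfx : ∀ i, aeval x (f i) = 0) :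
    ∃ y : ι → L, (∀ c : L, y ≠ c • x) ∧ ∀ (t : ℕ) (i : σ), aeval (x + (t : L) • y) (f i) = 0 := by
  obtain ⟨l, hl⟩ := Function.ne_iff.1 hx
  simp only [Pi.zero_apply] at hl
  by_cases htop : Ideal.span (Set.range (lineEqs f l x)) = ⊤
  · exfalso
    have h1 : (1 : MvPolynomial (ι ⊕ ι) L) ∈ Ideal.span (Set.range (lineEqs f l x)) := by
      rw [htop]; trivial
    obtain ⟨c, hc⟩ := (Finsupp.mem_ideal_span_range_iff_exists_finsupp).1 h1
    obtain ⟨R, hR, ⟨φ⟩⟩ := transfer_point (Set.range x ∪ {(x l)⁻¹} ∪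
      ⋃ a ∈ c.support, ((c a).coeffs : Set L)) (by
        refine ((Set.finite_range x).union (Set.finite_singleton _)).union ?_
        exact c.support.finite_toSet.biUnion fun a _ => (c a).coeffs.finite_toSet)
    have hxR : ∀ j, x j ∈ R := fun j => hR (by simp)
    have hlR : (x l)⁻¹ ∈ R := hR (by simp)
    let x' : ι → R := fun j => ⟨x j, hxR j⟩
    have hlift : ∀ a, ∃ c' : MvPolynomial (ι ⊕ ι) R, MvPolynomial.mapAlgHom R.val c' = c a := by
      intro a
      by_cases ha : a ∈ c.support
      · have : c a ∈ Set.range (MvPolynomial.map (σ := ι ⊕ ι) (R.val : R →+* L)) := by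
          rw [MvPolynomial.mem_range_map_iff_coeffs_subset]
          intro z hz
          have : z ∈ R := hR (Or.inr (by simp only [Set.mem_iUnion]; exact ⟨a, ha, hz⟩))
          exact ⟨⟨z, this⟩, rfl⟩
        obtain ⟨c', hc'⟩ := this
        exact ⟨c', hc'⟩
      · exact ⟨0, by simp [Finsupp.notMem_support_iff.1 ha]⟩
    choose c' hc' using hlift
    have hG : ∀ a, MvPolynomial.mapAlgHom R.val (lineEqs f l x' a) = lineEqs f l x a := by
      rintro (⟨i, t⟩ | _ | _)
      · simp only [lineEqs]
        rw [comp_aeval_apply]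
        congr 2
        ext1 j
        simp [x']
      · simp [lineEqs]
      · simp [lineEqs]
    have h2 : ∑ a ∈ c.support, c' a * lineEqs f l x' a = 1 := by
      apply MvPolynomial.map_injective (R.val : R →+* L) Subtype.val_injective
      change MvPolynomial.mapAlgHom R.val _ = MvPolynomial.mapAlgHom R.val _
      rw [map_sum, map_one, ← hc]
      simp only [map_mul, hc', hG]
      rfl
    have key2 : ∀ g, φ (aeval x' g) = eval (fun j => φ (x' j)) g := fun g => by
      rw [comp_aeval_apply]; simp [coe_aeval_eq_eval]
    have hxl : φ (x' l) ≠ 0 := by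
      intro h0
      have h2 : φ (x' l * ⟨_, hlR⟩) = φ 1 := by
        congr 1; ext; simp [x', hl]
      rw [map_mul, h0] at h2
      simp at h2
    obtain ⟨u0, hu0, hline⟩ := hcov (fun j => φ (x' j)) (fun h => hxl (congrFun h l)) (by
      intro i
      rw [← key2]
      have : aeval x' (f i) = 0 := by
        ext
        change R.val (aeval x' (f i)) = _
        rw [comp_aeval_apply]; exact hfx i
      rw [this, map_zero])
    set p : ι → ℂ := fun j => φ (x' j) with hp
    -- normalise the direction
    let c0 : ℂ := u0 l / p l
    let u : ι → ℂ := u0 - c0 • p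
    have hu : u ≠ 0 := fun h => hu0 c0 (sub_eq_zero.1 h)
    obtain ⟨k, hk⟩ := Function.ne_iff.1 hu
    simp only [Pi.zero_apply] at hk
    classical
    have h3 := congrArg (aevalTower φ (Sum.elim u (Pi.single k (u k)⁻¹))) h2
    rw [map_sum, map_one, Finset.sum_eq_zero] at h3
    · exact zero_ne_one h3
    · intro a _
      rw [map_mul]
      convert mul_zero _
      rcases a with (⟨i, t⟩ | _ | _)
      · simp only [lineEqs]
        rw [comp_aeval_apply]
        have hj : (fun j => aevalTower φ (Sum.elim u (Pi.single k (u k)⁻¹))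
            (C (x' j) + (t : MvPolynomial (ι ⊕ ι) R) * X (Sum.inl j)))
            = (1 - t * c0) • p + (t : ℂ) • u0 := by
          ext1 j
          simp [u, hp]
          ring
        have h4 := hline (1 - t * c0) t i
        rw [← coe_aeval_eq_eval, ← hj] at h4
        exact h4
      · simp [lineEqs, Pi.single_apply, hk]
      · have hpl : p l ≠ 0 := hxl
        simp [lineEqs, u, c0, hpl]
  · have hnt : Nontrivial (MvPolynomial (ι ⊕ ι) L ⧸ Ideal.span (Set.range (lineEqs f l x))) :=
      Ideal.Quotient.nontrivial_iff.2 htop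
    obtain ⟨θ⟩ := fg_point L (MvPolynomial (ι ⊕ ι) L ⧸ Ideal.span (Set.range (lineEqs f l x))) L
    let w : MvPolynomial (ι ⊕ ι) L →ₐ[L] L := θ.comp (Ideal.Quotient.mkₐ L _)
    have hw : ∀ a, w (lineEqs f l x a) = 0 := by
      intro a
      have : (Ideal.Quotient.mkₐ L (Ideal.span (Set.range (lineEqs f l x)))) (lineEqs f l x a)
          = 0 := by
        rw [Ideal.Quotient.mkₐ_eq_mk, Ideal.Quotient.eq_zero_iff_mem]
        exact Ideal.subset_span ⟨a, rfl⟩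
      simp [w, this]
    refine ⟨fun j => w (X (Sum.inl j)), ?_, ?_⟩
    · intro c hc
      have h1 := hw (.inr true)
      have h2 := hw (.inr false)
      simp only [lineEqs, map_sub, map_sum, map_mul, map_one] at h1 h2
      have h3 : c = 0 := by
        have := congrFun hc l
        simp only [h1, Pi.smul_apply, smul_eq_mul] at this
        exact (mul_eq_zero.1 this.symm).resolve_right hl
      have h4 : ∀ j, w (X (Sum.inl j)) = 0 := fun j => by
        have := congrFun hc j
        simpa [h3] using this
      simp [h4] at h2
    · intro t i
      have h1 := hw (.inl (i, t))
      simp only [lineEqs] at h1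
      change (w.restrictScalars ℂ) _ = 0 at h1
      rw [comp_aeval_apply] at h1
      rw [← h1]
      congr 2
      ext1 j
      have : w (C (x j)) = x j := w.commutes (x j)
      simp [this]

lemma prod_top_coeff {α L : Type*} [CommRing L] (s : Finset α) (p : α → Polynomial L) (n : α → ℕ)
    (h : ∀ i ∈ s, (p i).natDegree ≤ n i) :
    (∏ i ∈ s, p i).natDegree ≤ ∑ i ∈ s, n i ∧
      (∏ i ∈ s, p i).coeff (∑ i ∈ s, n i) = ∏ i ∈ s, (p i).coeff (n i) := by
  classical
  induction s using Finset.induction_on with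
  | empty => simp
  | insert a s ha ih =>
    obtain ⟨h1, h2⟩ := ih fun i hi => h i (Finset.mem_insert_of_mem hi)
    have h3 := h a (Finset.mem_insert_self _ _)
    rw [Finset.prod_insert ha, Finset.sum_insert ha, Finset.prod_insert ha]
    exact ⟨Polynomial.natDegree_mul_le_of_le h3 h1, by
      rw [Polynomial.coeff_mul_add_eq_of_natDegree_le h3 h1, h2]⟩

lemma det_top_coeff {α L : Type*} [Fintype α] [DecidableEq α] [CommRing L]
    (M : Matrix α α (Polynomial L)) (n : α → ℕ) (h : ∀ i j, (M i j).natDegree ≤ n j) :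
    M.det.natDegree ≤ ∑ j, n j ∧
      M.det.coeff (∑ j, n j) = (Matrix.of fun i j => (M i j).coeff (n j)).det := by
  have key := fun τ : Equiv.Perm α =>
    prod_top_coeff Finset.univ (fun i => M (τ i) i) n (fun i _ => h _ i)
  constructor
  · rw [Matrix.det_apply]
    refine Polynomial.natDegree_sum_le_of_forall_le _ _ fun τ _ => ?_
    refine le_trans ?_ (key τ).1
    rcases Int.units_eq_one_or (Equiv.Perm.sign τ) with h | h <;> simp [h]
  · rw [Matrix.det_apply, Matrix.det_apply, Polynomial.finsetSum_coeff]
    refine Finset.sum_congr rfl fun τ _ => ?_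
    have := (key τ).2
    rcases Int.units_eq_one_or (Equiv.Perm.sign τ) with h | h <;> simp [h, this]

lemma det_top_coeff_row {α L : Type*} [Fintype α] [DecidableEq α] [CommRing L]
    (M : Matrix α α (Polynomial L)) (n : α → ℕ) (h : ∀ i j, (M i j).natDegree ≤ n i) :
    M.det.natDegree ≤ ∑ j, n j ∧
      M.det.coeff (∑ j, n j) = (Matrix.of fun i j => (M i j).coeff (n i)).det := by
  have := det_top_coeff M.transpose n (fun i j => h j i)
  rw [Matrix.det_transpose] at this
  refine ⟨this.1, this.2.trans ?_⟩
  rw [← Matrix.det_transpose]; rfl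

/-- restriction of `g` to the parametrised line `x + t y` -/
noncomputable def lineP {ι L : Type*} [Field L] [Algebra ℂ L] (x y : ι → L)
    (g : MvPolynomial ι ℂ) : Polynomial L :=
  aeval (fun j => Polynomial.C (x j) + Polynomial.C (y j) * Polynomial.X) g

lemma lineP_eval {ι L : Type*} [Field L] [Algebra ℂ L] (x y : ι → L)
    (g : MvPolynomial ι ℂ) (t : L) : (lineP x y g).eval t = aeval (x + t • y) g := by
  have : (lineP x y g).eval t = ((Polynomial.aeval (R := L) t).restrictScalars ℂ) (lineP x y g) := by
    simp [Polynomial.coe_aeval_eq_eval]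
  rw [this, lineP, comp_aeval_apply]
  congr 2
  ext j
  simp
  ring

lemma lineP_top {ι L : Type*} [Fintype ι] [Field L] [Algebra ℂ L] (x y : ι → L)
    (g : MvPolynomial ι ℂ) (e : ℕ) (hg : g.IsHomogeneous e) :
    (lineP x y g).natDegree ≤ e ∧ (lineP x y g).coeff e = aeval y g := by
  have key : ∀ m ∈ g.support,
      (∏ i, (Polynomial.C (x i) + Polynomial.C (y i) * Polynomial.X) ^ m i).natDegree ≤ e ∧
      (∏ i, (Polynomial.C (x i) + Polynomial.C (y i) * Polynomial.X) ^ m i).coeff e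
        = ∏ i, y i ^ m i := by
    intro m hm
    have hme : ∑ i, m i = e := by
      have := hg (mem_support_iff.1 hm)
      rw [← this, Finsupp.weight_apply, Finsupp.sum_fintype] <;> simp
    have hlin : ∀ i, (Polynomial.C (x i) + Polynomial.C (y i) * Polynomial.X).natDegree ≤ 1 := by
      intro i
      compute_degree
    have := prod_top_coeff Finset.univ
      (fun i => (Polynomial.C (x i) + Polynomial.C (y i) * Polynomial.X) ^ m i) (fun i => m i)
      (fun i _ => by simpa using Polynomial.natDegree_pow_le_of_le (m i) (hlin i))
    rw [hme] at this
    refine ⟨this.1, this.2.trans (Finset.prod_congr rfl fun i _ => ?_)⟩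
    have := Polynomial.coeff_pow_of_natDegree_le (m := m i) (hlin i)
    simp at this
    rw [this]
  have h1 : lineP x y g = ∑ m ∈ g.support, Polynomial.C (algebraMap ℂ L (g.coeff m)) *
      ∏ i, (Polynomial.C (x i) + Polynomial.C (y i) * Polynomial.X) ^ m i := by
    rw [lineP, aeval_def, eval₂_eq']; rfl
  constructor
  · rw [h1]
    refine Polynomial.natDegree_sum_le_of_forall_le _ _ fun m hm => ?_
    exact (Polynomial.natDegree_C_mul_le _ _).trans (key m hm).1
  · rw [h1, Polynomial.finsetSum_coeff, aeval_def, eval₂_eq']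
    refine Finset.sum_congr rfl fun m hm => ?_
    rw [Polynomial.coeff_C_mul, (key m hm).2]

lemma exists_completion {σ κ L V : Type*} [Fintype σ] [Fintype κ] [Field L] [AddCommGroup V]
    [Module L V] [FiniteDimensional L V] (v : σ → V) (hv : LinearIndependent L v)
    (hcard : Module.finrank L V = Fintype.card σ + Fintype.card κ) :
    ∃ w : κ → V, LinearIndependent L (Sum.elim v w) := by
  obtain ⟨W, hW⟩ := Submodule.exists_isCompl (Submodule.span L (Set.range v))
  have h1 := Submodule.finrank_add_eq_of_isCompl hW
  rw [finrank_span_eq_card hv] at h1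
  have h2 : Module.finrank L W = Fintype.card κ := by omega
  let b : Module.Basis κ L W := (Module.finBasisOfFinrankEq L W h2).reindex (Fintype.equivFin κ).symm
  refine ⟨fun k => b k, ?_⟩
  refine hv.sum_type (b.linearIndependent.map' W.subtype (by simp)) ?_
  refine hW.disjoint.mono_right ?_
  rw [Submodule.span_le]
  rintro _ ⟨k, rfl⟩
  exact (b k).2

lemma exists_rows {σ κ L : Type*} [Fintype σ] [Fintype κ] [DecidableEq σ] [DecidableEq κ] [Field L]
    (A : Matrix σ (σ ⊕ κ) L) (hA : ∀ c : σ → L, Matrix.vecMul c A = 0 → c = 0) :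
    ∃ B : Matrix κ (σ ⊕ κ) L, IsUnit (Matrix.fromRows A B).det := by
  have h1 : LinearIndependent L A.row := by
    rw [← Matrix.vecMul_injective_iff]
    intro a b hab
    have := hA (a - b) (by rw [Matrix.sub_vecMul]; exact sub_eq_zero.2 hab)
    exact sub_eq_zero.1 this
  obtain ⟨w, hw⟩ := exists_completion (κ := κ) A.row h1 (by simp)
  refine ⟨Matrix.of w, ?_⟩
  rw [← Matrix.isUnit_iff_isUnit_det, ← Matrix.linearIndependent_rows_iff_isUnit]
  have h2 : (Matrix.fromRows A (Matrix.of w)).row = Sum.elim A.row w := by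
    ext (i | i) j <;> rfl
  rw [h2]
  exact hw

lemma exists_right_inv {σ ι L : Type*} [Fintype σ] [Fintype ι] [DecidableEq σ] [DecidableEq ι] [Field L]
    (A : Matrix σ ι L) (hA : ∀ c : σ → L, Matrix.vecMul c A = 0 → c = 0) :
    ∃ C : Matrix ι σ L, A * C = 1 := by
  have h1 : LinearIndependent L A.row := by
    rw [← Matrix.vecMul_injective_iff]
    intro a b hab
    have := hA (a - b) (by rw [Matrix.sub_vecMul]; exact sub_eq_zero.2 hab)
    exact sub_eq_zero.1 this
  rw [← Matrix.mulVec_surjective_iff_exists_right_inverse]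
  have h2 := h1.rank_matrix
  have : LinearMap.range A.mulVecLin = ⊤ := by
    apply Submodule.eq_top_of_finrank_eq
    rw [← Matrix.rank, h2]; simp
  exact LinearMap.range_eq_top.1 this

lemma degree_ineq {σ κ L : Type*} [Fintype σ] [Fintype κ] [DecidableEq σ] [DecidableEq κ] [Field L]
    [IsAlgClosed L] (J : Matrix σ (σ ⊕ κ) (Polynomial L)) (e : σ → ℕ)
    (hJe : ∀ i j, (J i j).natDegree ≤ e i)
    (hJ : ∀ t : L, ∀ c : σ → L, Matrix.vecMul c (J.map (Polynomial.eval t)) = 0 → c = 0)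
    (hJinf : ∀ c : σ → L, Matrix.vecMul c (Matrix.of fun i j => (J i j).coeff (e i)) = 0 → c = 0)
    (V : Matrix (σ ⊕ κ) κ (Polynomial L)) (δ : κ → ℕ)
    (hVδ : ∀ i j, (V i j).natDegree ≤ δ j) (hJV : J * V = 0)
    (hV : ∀ c : κ → L, Matrix.mulVec (V.map (Polynomial.eval 0)) c = 0 → c = 0) :
    ∑ i, e i ≤ ∑ k, δ k := by
  obtain ⟨C, hC⟩ := exists_right_inv _ hJinf
  let C' : Matrix (σ ⊕ κ) σ (Polynomial L) := C.map Polynomial.C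
  let q := (J * C').det
  have hq : q.coeff (∑ i, e i) = 1 := by
    have := (det_top_coeff_row (J * C') e (fun i j => by
      rw [Matrix.mul_apply]
      refine Polynomial.natDegree_sum_le_of_forall_le _ _ fun m hm => ?_
      exact (Polynomial.natDegree_mul_C_le _ _).trans (hJe i m))).2
    change (J * C').det.coeff _ = 1
    rw [this, ← Matrix.det_one (n := σ), ← hC]
    congr 1
    ext i j
    simp [Matrix.mul_apply, C', Polynomial.finsetSum_coeff]
  let D := (Matrix.fromCols C' V).det
  have key : ∀ B : Matrix κ (σ ⊕ κ) (Polynomial L),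
      (Matrix.fromRows J B).det * D = q * (B * V).det := by
    intro B
    rw [← Matrix.det_mul, Matrix.fromRows_mul_fromCols, hJV, Matrix.det_fromBlocks_zero₁₂]
  have hDdeg : D.natDegree ≤ ∑ k, δ k := by
    have := (det_top_coeff (Matrix.fromCols C' V) (Sum.elim (fun _ => 0) δ) (by
      rintro i (j | j)
      · simp [C']
      · simpa using hVδ i j)).1
    simpa using this
  have hq0 : q ≠ 0 := by rintro h; simp [h] at hq
  have hD0 : D ≠ 0 := by
    obtain ⟨B, hB⟩ := exists_right_inv (V.map (Polynomial.eval 0)).transpose (fun c hc => hV c (by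
      rwa [Matrix.vecMul_transpose] at hc))
    intro h
    have h1 := key (B.transpose.map Polynomial.C)
    rw [h, mul_zero, eq_comm, mul_eq_zero] at h1
    have h2 := congrArg (Polynomial.evalRingHom 0) (h1.resolve_left hq0)
    rw [RingHom.map_det, map_zero] at h2
    have h3 : (Polynomial.evalRingHom (0:L)).mapMatrix (B.transpose.map Polynomial.C * V) = 1 := by
      rw [← Matrix.transpose_one, ← hB, Matrix.transpose_mul]
      simp only [RingHom.mapMatrix_apply, Matrix.map_mul]
      congr 1
      ext i j; simp
    rw [h3, Matrix.det_one] at h2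
    exact one_ne_zero h2
  have hdvd : q ∣ D := by
    let I : Ideal (Polynomial L) := 
      { carrier := {h | q ∣ h * D}
        add_mem' := fun {a b} ha hb => by
          simp only [Set.mem_ofPred_eq, add_mul] at *; exact dvd_add ha hb
        zero_mem' := by simp
        smul_mem' := fun c x hx => by
          simp only [Set.mem_ofPred_eq, smul_eq_mul, mul_assoc] at *; exact hx.mul_left c }
    have hI : I = ⊤ := by
      by_contra hI
      obtain ⟨g, hg⟩ : ∃ g, I = Ideal.span {g} := ⟨_, (IsPrincipalIdealRing.principal I).principal.choose_spec⟩
      have hgu : ¬ IsUnit g := fun hu => hI (by rw [hg]; exact Ideal.span_singleton_eq_top.2 hu)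
      have hqI : q ∈ I := dvd_mul_right q D
      have hg0 : g.degree ≠ 0 := fun h => hgu (Polynomial.isUnit_iff_degree_eq_zero.2 h)
      obtain ⟨α, hα⟩ := IsAlgClosed.exists_root g hg0
      obtain ⟨B, hB⟩ := exists_rows _ (hJ α)
      have h1 : (Matrix.fromRows J (B.map Polynomial.C)).det ∈ I := by
        change q ∣ _
        rw [key]; exact dvd_mul_right _ _
      rw [hg, Ideal.mem_span_singleton] at h1
      obtain ⟨r, hr⟩ := h1
      have h2 := congrArg (Polynomial.evalRingHom α) hr
      rw [RingHom.map_det, map_mul] at h2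
      have h3 : (Polynomial.evalRingHom α).mapMatrix (Matrix.fromRows J (B.map Polynomial.C)) =
          Matrix.fromRows (J.map (Polynomial.eval α)) B := by
        ext (i | i) j <;> simp
      rw [h3] at h2
      have h4 : Polynomial.evalRingHom α g = 0 := hα
      rw [h4, zero_mul] at h2
      rw [h2] at hB
      simp at hB
    have : (1 : Polynomial L) ∈ I := by rw [hI]; trivial
    have h2 : q ∣ 1 * D := this
    rwa [one_mul] at h2
  calc ∑ i, e i ≤ q.natDegree := Polynomial.le_natDegree_of_ne_zero (by rw [hq]; exact one_ne_zero)
    _ ≤ D.natDegree := Polynomial.natDegree_le_of_dvd hdvd hD0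
    _ ≤ _ := hDdeg

lemma poly_zero {L : Type*} [Field L] [CharZero L] (p : Polynomial L)
    (h : ∀ t : ℕ, p.eval (t : L) = 0) : p = 0 := by
  apply Polynomial.eq_zero_of_infinite_isRoot
  refine (Set.infinite_range_of_injective (Nat.cast_injective (R := L))).mono ?_
  rintro _ ⟨t, rfl⟩
  exact h t

lemma finrank_ker {σ κ L : Type*} [Fintype σ] [Fintype κ] [DecidableEq σ] [DecidableEq κ] [Field L]
    (A : Matrix σ (σ ⊕ κ) L) (hA : ∀ c : σ → L, Matrix.vecMul c A = 0 → c = 0) :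
    Module.finrank L (LinearMap.ker A.mulVecLin) = Fintype.card κ := by
  have h1 : LinearIndependent L A.row := by
    rw [← Matrix.vecMul_injective_iff]
    intro a b hab
    have := hA (a - b) (by rw [Matrix.sub_vecMul]; exact sub_eq_zero.2 hab)
    exact sub_eq_zero.1 this
  have h2 := h1.rank_matrix
  have h3 := LinearMap.finrank_range_add_finrank_ker A.mulVecLin
  rw [← Matrix.rank, h2] at h3
  simp at h3
  exact h3

lemma core_ineq {σ κ L : Type*} [Fintype σ] [Fintype κ] [DecidableEq σ] [DecidableEq κ] [Field L]
    [IsAlgClosed L] [Algebra ℂ L] (f : σ → MvPolynomial (σ ⊕ κ) ℂ) (d : σ → ℕ)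
    (hf : ∀ i, (f i).IsHomogeneous (d i))
    (hsm : ∀ v : σ ⊕ κ → L, v ≠ 0 → (∀ i, aeval v (f i) = 0) → ∀ c : σ → L,
      (∀ j, ∑ i, c i * aeval v (pderiv j (f i)) = 0) → c = 0)
    (ξ η : σ ⊕ κ → L) (hξ : ξ ≠ 0) (hη : ∀ c : L, η ≠ c • ξ)
    (hline : ∀ (t : ℕ) (i : σ), aeval (ξ + (t : L) • η) (f i) = 0)
    (W W' : κ → σ ⊕ κ → L) (hW : LinearIndependent L W)
    (hJW : ∀ (t : ℕ) (k : κ) (i : σ),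
      ∑ j, aeval (ξ + (t : L) • η) (pderiv j (f i)) * (W k j + t * W' k j) = 0) :
    ∑ i, (d i - 1) + 2 ≤ Fintype.card κ := by
  have : CharZero L := charZero_of_injective_algebraMap (algebraMap ℂ L).injective
  have hf0 : ∀ i, lineP ξ η (f i) = 0 := fun i =>
    poly_zero _ fun t => by rw [lineP_eval]; exact hline t i
  have hft : ∀ (t : L) i, aeval (ξ + t • η) (f i) = 0 := fun t i => by
    rw [← lineP_eval, hf0]; simp
  have hfη : ∀ i, aeval η (f i) = 0 := fun i => by
    rw [← (lineP_top ξ η (f i) _ (hf i)).2, hf0]; simp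
  have hη0 : η ≠ 0 := fun h => hη 0 (by simp [h])
  have hξη : LinearIndependent L ![ξ, η] := by
    rw [LinearIndependent.pair_iff' hξ]
    exact fun c hc => hη c hc.symm
  have hlin0 : ∀ t : L, ξ + t • η ≠ 0 := fun t ht => by
    rw [LinearIndependent.pair_iff] at hξη
    have := (hξη 1 t (by simpa using ht)).1
    exact one_ne_zero this
  let J : Matrix σ (σ ⊕ κ) (Polynomial L) := Matrix.of fun i j => lineP ξ η (pderiv j (f i))
  have hJη : ∀ i, ∑ j, J i j * Polynomial.C (η j) = 0 := by
    intro i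
    have := chain_rule ((Polynomial.derivative' (R := L)).restrictScalars ℂ)
      (fun j => Polynomial.C (ξ j) + Polynomial.C (η j) * Polynomial.X) (f i)
    rw [show aeval (fun j => Polynomial.C (ξ j) + Polynomial.C (η j) * Polynomial.X) (f i) = 0
      from hf0 i, map_zero] at this
    rw [this]
    refine Finset.sum_congr rfl fun j _ => ?_
    congr 1
    simp [Polynomial.derivative']
  have hJξ : ∀ i, ∑ j, J i j * Polynomial.C (ξ j) = 0 := by
    intro i
    have h1 := congrArg (aeval (fun j => Polynomial.C (ξ j) + Polynomial.C (η j) * Polynomial.X))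
      (hf i).sum_X_mul_pderiv
    rw [map_nsmul, show aeval (fun j => Polynomial.C (ξ j) + Polynomial.C (η j) * Polynomial.X)
      (f i) = 0 from hf0 i, smul_zero, map_sum] at h1
    have h2 : ∑ j, J i j * Polynomial.C (ξ j) +
        (∑ j, J i j * Polynomial.C (η j)) * Polynomial.X = 0 := by
      rw [← h1, Finset.sum_mul, ← Finset.sum_add_distrib]
      refine Finset.sum_congr rfl fun j _ => ?_
      rw [map_mul, aeval_X]
      simp only [J, Matrix.of_apply, lineP]
      ring
    rw [hJη, zero_mul, add_zero] at h2
    exact h2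
  have hJWp : ∀ k i, ∑ j, J i j *
      (Polynomial.C (W k j) + Polynomial.C (W' k j) * Polynomial.X) = 0 := by
    intro k i
    refine poly_zero _ fun t => ?_
    rw [← hJW t k i, Polynomial.eval_finsetSum]
    refine Finset.sum_congr rfl fun j _ => ?_
    simp only [J, Matrix.of_apply, Polynomial.eval_mul, lineP_eval, Polynomial.eval_add,
      Polynomial.eval_C, Polynomial.eval_X]
    ring
  have hJt : ∀ t : L, ∀ c : σ → L, Matrix.vecMul c (J.map (Polynomial.eval t)) = 0 → c = 0 := by
    intro t c hc
    refine hsm (ξ + t • η) (hlin0 t) (hft t) c fun j => ?_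
    have := congrFun hc j
    simpa [Matrix.vecMul, dotProduct, J, lineP_eval] using this
  let K := LinearMap.ker (J.map (Polynomial.eval (0 : L))).mulVecLin
  have hK : Module.finrank L K = Fintype.card κ := finrank_ker _ (hJt 0)
  have hKmem : ∀ (x : σ ⊕ κ → L) (y : σ ⊕ κ → L), (∀ i, ∑ j, J i j *
      (Polynomial.C (x j) + Polynomial.C (y j) * Polynomial.X) = 0) → x ∈ K := by
    intro x y h
    rw [LinearMap.mem_ker]
    ext i
    have := congrArg (Polynomial.eval 0) (h i)
    rw [Polynomial.eval_finsetSum] at this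
    simpa [Matrix.mulVec, dotProduct] using this
  have hξK : ξ ∈ K := hKmem ξ 0 fun i => by simpa using hJξ i
  have hηK : η ∈ K := hKmem η 0 fun i => by simpa using hJη i
  have hWK : ∀ k, W k ∈ K := fun k => hKmem _ _ (hJWp k)
  have hspan : Submodule.span L (Set.range W) = K := by
    apply Submodule.eq_of_le_of_finrank_eq
    · rw [Submodule.span_le]
      rintro _ ⟨k, rfl⟩
      exact hWK k
    · rw [finrank_span_eq_card hW, hK]
  let g : Fin 2 → K := ![⟨ξ, hξK⟩, ⟨η, hηK⟩]
  have hgv : ∀ b, (g b : σ ⊕ κ → L) = ![ξ, η] b := by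
    intro b; fin_cases b <;> rfl
  have hg : LinearIndependent L g := by
    apply LinearIndependent.of_comp K.subtype
    have h1 : K.subtype ∘ g = ![ξ, η] := by
      ext1 b; exact hgv b
    rw [h1]
    exact hξη
  have h2κ : 2 ≤ Fintype.card κ := by
    have := hg.fintype_card_le_finrank
    simpa [hK] using this
  obtain ⟨w, hw⟩ := exists_completion (κ := Fin (Fintype.card κ - 2)) g hg (by
    rw [hK]; simp; omega)
  have ha : ∀ t, ∃ a : κ → L, ∑ k, a k • W k = w t := fun t =>
    (Submodule.mem_span_range_iff_exists_fun L).1 (by rw [hspan]; exact (w t).2)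
  choose a ha using ha
  let eqv : κ ≃ Fin 2 ⊕ Fin (Fintype.card κ - 2) := Fintype.equivOfCardEq (by simp; omega)
  let V0 : Fin 2 ⊕ Fin (Fintype.card κ - 2) → σ ⊕ κ → Polynomial L :=
    Sum.elim (fun b j => Polynomial.C (![ξ, η] b j)) (fun t j => ∑ k, Polynomial.C (a t k) *
      (Polynomial.C (W k j) + Polynomial.C (W' k j) * Polynomial.X))
  let δ0 : Fin 2 ⊕ Fin (Fintype.card κ - 2) → ℕ := Sum.elim (fun _ => 0) (fun _ => 1)
  have hV0 : ∀ b i, ∑ j, J i j * V0 b j = 0 := by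
    rintro (b | t) i
    · fin_cases b
      · simpa [V0] using hJξ i
      · simpa [V0] using hJη i
    · simp only [V0, Sum.elim_inr, Finset.mul_sum]
      rw [Finset.sum_comm]
      refine Finset.sum_eq_zero fun k _ => ?_
      rw [← mul_zero (Polynomial.C (a t k)), ← hJWp k i, Finset.mul_sum]
      refine Finset.sum_congr rfl fun j _ => by ring
  have hV0e : ∀ b j, (V0 b j).eval 0 = ((Sum.elim g w b : K) : σ ⊕ κ → L) j := by
    rintro (b | t) j
    · simp [V0, hgv]
    · simp [V0, ← ha, Polynomial.eval_finsetSum]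
  have hVd : ∀ b j, (V0 b j).natDegree ≤ δ0 b := by
    rintro (b | t) j
    · simp [V0, δ0]
    · simp only [V0, δ0, Sum.elim_inr]
      refine Polynomial.natDegree_sum_le_of_forall_le _ _ fun k _ => ?_
      refine (Polynomial.natDegree_C_mul_le _ _).trans ?_
      compute_degree
  have main := degree_ineq J (fun i => d i - 1)
    (fun i j => (lineP_top ξ η _ _ (hf i).pderiv).1) hJt
    (by
      intro c hc
      refine hsm η hη0 hfη c fun j => ?_
      have := congrFun hc j
      simp only [Matrix.vecMul, dotProduct, J, Matrix.of_apply, Pi.zero_apply] at this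
      rw [← this]
      refine Finset.sum_congr rfl fun i _ => ?_
      rw [(lineP_top ξ η _ _ (hf i).pderiv).2])
    (Matrix.of fun j k => V0 (eqv k) j) (fun k => δ0 (eqv k)) (fun j k => hVd _ _)
    (by ext1 i k; exact hV0 _ _)
    (by
      intro c hc
      have hw' : LinearIndependent L ((Sum.elim g w) ∘ eqv) := hw.comp _ eqv.injective
      rw [Fintype.linearIndependent_iff] at hw'
      ext1 k
      refine hw' c ?_ k
      ext j
      have := congrFun hc j
      simp only [Matrix.mulVec, dotProduct, Matrix.map_apply, Matrix.of_apply, hV0e] at this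
      simp only [Submodule.coe_sum, Finset.sum_apply]
      refine Eq.trans ?_ this
      refine Finset.sum_congr rfl fun k _ => ?_
      simp [mul_comm])
  rw [Equiv.sum_comp eqv δ0] at main
  simp [δ0] at main
  omega

lemma core_main {σ κ : Type} [Fintype σ] [Fintype κ] [DecidableEq σ] [DecidableEq κ]
    (f : σ → MvPolynomial (σ ⊕ κ) ℂ) (d : σ → ℕ)
    (hf : ∀ i, (f i).IsHomogeneous (d i))
    (hsm : ∀ v : σ ⊕ κ → ℂ, v ≠ 0 → (∀ i, eval v (f i) = 0) → ∀ c : σ → ℂ,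
      (∀ j, ∑ i, c i * eval v (pderiv j (f i)) = 0) → c = 0)
    (hcov : ∀ v : σ ⊕ κ → ℂ, v ≠ 0 → (∀ i, eval v (f i) = 0) → ∃ u : σ ⊕ κ → ℂ,
      (∀ c : ℂ, u ≠ c • v) ∧ ∀ (a b : ℂ) (i : σ), eval (a • v + b • u) (f i) = 0)
    (p : σ ⊕ κ → ℂ) (hp0 : p ≠ 0) (hp : ∀ i, eval p (f i) = 0)
    (hdet : (Matrix.of fun i j => eval p (pderiv (Sum.inl i) (f j))).det ≠ 0) :
    ∑ i, (d i - 1) + 2 ≤ Fintype.card κ := by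
  have hκ : Nonempty κ := by
    by_contra hκ
    rw [not_nonempty_iff] at hκ
    apply hp0
    have h1 : (fun i => p (Sum.inl i)) = 0 := by
      apply Matrix.eq_zero_of_vecMul_eq_zero hdet
      ext i
      have := congrArg (eval p) (hf i).sum_X_mul_pderiv
      rw [map_nsmul, hp, smul_zero, map_sum, Fintype.sum_sum_type] at this
      simpa [Matrix.vecMul, dotProduct] using this
    ext (i | i)
    · exact congrFun h1 i
    · exact (hκ.false i).elim
  obtain ⟨z, hz⟩ := generic_point f p hp hdet
  set ξ : σ ⊕ κ → GF κ := Sum.elim z (fun k => algebraMap (MvPolynomial κ ℂ) (GF κ) (X k)) with hξd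
  choose D hD using fun k : κ => exists_GF_deriv k
  have hξ : ξ ≠ 0 := by
    obtain ⟨k⟩ := hκ
    intro h
    have h1 := hD k k
    have h2 : algebraMap (MvPolynomial κ ℂ) (GF κ) (X k) = 0 := congrFun h (Sum.inr k)
    rw [h2] at h1
    simp at h1
  obtain ⟨η, hη, hline⟩ := line_transfer f hcov ξ hξ hz
  refine core_ineq f d hf (smooth_transfer f hsm) ξ η hξ hη hline
    (fun k j => D k (ξ j)) (fun k j => D k (η j)) ?_ ?_
  · rw [Fintype.linearIndependent_iff]
    intro c hc l
    have := congrFun hc (Sum.inr l)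
    simpa [hξd, hD] using this
  · intro t k i
    have h1 := chain_rule (D k) (ξ + (t : GF κ) • η) (f i)
    rw [hline, map_zero] at h1
    rw [h1]
    refine Finset.sum_congr rfl fun j _ => ?_
    simp

lemma eval_smul_homog {ι : Type*} [Fintype ι] (g : MvPolynomial ι ℂ) (e : ℕ)
    (hg : g.IsHomogeneous e) (a : ℂ) (v : ι → ℂ) : eval (a • v) g = a ^ e * eval v g := by
  rw [eval_eq', eval_eq', Finset.mul_sum]
  refine Finset.sum_congr rfl fun m hm => ?_
  have hme : ∑ i, m i = e := by
    have := hg (mem_support_iff.1 hm)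
    rw [← this, Finsupp.weight_apply, Finsupp.sum_fintype] <;> simp
  simp only [Pi.smul_apply, smul_eq_mul, mul_pow, Finset.prod_mul_distrib,
    Finset.prod_pow_eq_pow_sum, hme]
  ring

lemma rows_of_rank {s m : ℕ} (A : Matrix (Fin s) (Fin m) ℂ) (hA : A.rank = s) (c : Fin s → ℂ)
    (hc : ∀ j, ∑ i, c i * A i j = 0) : c = 0 := by
  have h1 : LinearIndependent ℂ A.row := by
    rw [linearIndependent_iff_card_eq_finrank_span, Set.finrank, ← Matrix.rank_eq_finrank_span_row,
      hA]
    simp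
  rw [← Matrix.vecMul_injective_iff] at h1
  apply h1
  beta_reduce
  rw [Matrix.zero_vecMul]
  ext j
  exact hc j

lemma exists_minor {s m : ℕ} (A : Matrix (Fin s) (Fin m) ℂ) (hA : A.rank = s) :
    ∃ g : Fin s → Fin m, Function.Injective g ∧ (Matrix.of fun i j => A j (g i)).det ≠ 0 := by
  obtain ⟨κ, a, ha, hsp, hli⟩ := exists_linearIndependent' ℂ A.col
  have : Finite κ := Finite.of_injective a ha
  have : Fintype κ := Fintype.ofFinite κ
  have hc : Fintype.card κ = s := by
    rw [← finrank_span_eq_card hli, hsp, ← Matrix.rank_eq_finrank_span_cols, hA]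
  let e : Fin s ≃ κ := Fintype.equivOfCardEq (by simp [hc])
  refine ⟨a ∘ e, ha.comp e.injective, ?_⟩
  rw [← isUnit_iff_ne_zero, ← Matrix.isUnit_iff_isUnit_det, ← Matrix.linearIndependent_rows_iff_isUnit]
  exact hli.comp e e.injective

end NoLineHelpers

/-- **Lemma.**  If `X ⊆ ℙ^n` is a smooth complete intersection of `s` hypersurfaces of
degrees `d_1, …, d_s` with `Σ d_i ≥ n`, then `X` is not covered by lines: there exists a
point `p ∈ X` such that no projective line through `p` is contained in `X`. -/
theorem exists_point_no_line_of_n_le_sum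
    (n s : ℕ) (d : Fin s → ℕ)
    (f : Fin s → MvPolynomial (Fin (n + 1)) ℂ)
    (X : Set (Projectivization ℂ (Fin (n + 1) → ℂ)))
    (hX : IsSmoothCI n s d f X)
    (hd : n ≤ ∑ i, d i) :
    ∃ p ∈ X, ∀ W : Submodule ℂ (Fin (n + 1) → ℂ), Module.finrank ℂ W = 2 →
      p ∈ lineSet W → ¬ lineSet W ⊆ X := by
  by_contra hcon
  push Not at hcon
  have hsm0 : ∀ v : Fin (n + 1) → ℂ, v ≠ 0 → (∀ i, MvPolynomial.eval v (f i) = 0) →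
      ∀ c : Fin s → ℂ,
      (∀ j, ∑ i, c i * MvPolynomial.eval v (MvPolynomial.pderiv j (f i)) = 0) → c = 0 :=
    fun v hv hfv c hc => rows_of_rank _ (hX.smooth v hv hfv) c hc
  have hmem : ∀ (v : Fin (n + 1) → ℂ) (hv : v ≠ 0),
      Projectivization.mk ℂ v hv ∈ X ↔ ∀ i, MvPolynomial.eval v (f i) = 0 := by
    intro v hv
    obtain ⟨a, ha⟩ := Projectivization.exists_smul_eq_mk_rep ℂ v hv
    have ha' : (a : ℂ) • v = (Projectivization.mk ℂ v hv).rep := ha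
    rw [hX.locus]
    change (∀ i, MvPolynomial.eval (Projectivization.mk ℂ v hv).rep (f i) = 0) ↔ _
    refine forall_congr' fun i => ?_
    rw [← ha', eval_smul_homog _ _ (hX.homog i)]
    simp
  have hcov0 : ∀ v : Fin (n + 1) → ℂ, v ≠ 0 → (∀ i, MvPolynomial.eval v (f i) = 0) →
      ∃ u : Fin (n + 1) → ℂ, (∀ c : ℂ, u ≠ c • v) ∧
        ∀ (a b : ℂ) (i : Fin s), MvPolynomial.eval (a • v + b • u) (f i) = 0 := by
    intro v hv hfv
    obtain ⟨W, hW2, hpW, hWX⟩ := hcon (Projectivization.mk ℂ v hv) ((hmem v hv).2 hfv)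
    have hrep : ∀ (w : Fin (n + 1) → ℂ) (hw : w ≠ 0),
        (Projectivization.mk ℂ w hw).rep ∈ W ↔ w ∈ W := by
      intro w hw
      obtain ⟨a, ha⟩ := Projectivization.exists_smul_eq_mk_rep ℂ w hw
      have ha' : (a : ℂ) • w = (Projectivization.mk ℂ w hw).rep := ha
      rw [← ha']
      exact W.smul_mem_iff a.ne_zero
    have hvW : v ∈ W := (hrep v hv).1 hpW
    have hWf : ∀ w ∈ W, ∀ i, MvPolynomial.eval w (f i) = 0 := by
      intro w hwW i
      by_cases hw : w = 0
      · have h1 := eval_smul_homog (f i) _ (hX.homog i) 0 0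
        have h2 := hX.two_le_deg i
        rw [zero_pow (by omega), zero_mul, zero_smul] at h1
        rw [hw, h1]
      · exact (hmem w hw).1 (hWX ((hrep w hw).2 hwW)) i
    have hlt : Submodule.span ℂ {v} < W := by
      refine lt_of_le_of_ne ?_ ?_
      · rw [Submodule.span_le]; simpa using hvW
      · intro h
        rw [← h, finrank_span_singleton hv] at hW2
        omega
    obtain ⟨u, huW, hu⟩ := SetLike.exists_of_lt hlt
    refine ⟨u, fun c hc => hu ?_, fun a b i => ?_⟩
    · rw [hc]; exact Submodule.smul_mem _ _ (Submodule.mem_span_singleton_self v)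
    · exact hWf _ (W.add_mem (W.smul_mem _ hvW) (W.smul_mem _ huW)) i
  have hne : X.Nonempty := by
    by_contra h
    have hE : IsEmpty ↥X := Set.isEmpty_coe_sort.2 (Set.not_nonempty_iff_eq_empty.1 h)
    have h1 := hX.codim
    have hE2 : IsEmpty (TopologicalSpace.IrreducibleCloseds ↥X) :=
      ⟨fun Z => by
        obtain ⟨x, _⟩ := Z.isIrreducible.nonempty
        exact hE.false x⟩
    rw [topologicalKrullDim, Order.krullDim_eq_bot] at h1
    exact absurd h1.symm (WithBot.coe_ne_bot)
  obtain ⟨P, hP⟩ := hne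
  have hp0 := P.rep_nonzero
  have hp : ∀ i, MvPolynomial.eval P.rep (f i) = 0 := by
    rw [hX.locus] at hP; exact hP
  obtain ⟨g, hg, hdet⟩ := exists_minor _ (hX.smooth P.rep hp0 hp)
  classical
  let e : Fin (n + 1) ≃ Fin s ⊕ ↥((Set.range g)ᶜ) :=
    ((Equiv.sumCongr (Equiv.ofInjective g hg) (Equiv.refl _)).trans
      (Equiv.Set.sumCompl (Set.range g))).symm
  have heg : ∀ i, e (g i) = Sum.inl i := by
    intro i
    rw [Equiv.symm_apply_eq]
    simp
  have hpd : ∀ (v : Fin s ⊕ ↥((Set.range g)ᶜ) → ℂ) j i,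
      MvPolynomial.eval v (MvPolynomial.pderiv (e j) (MvPolynomial.rename e (f i))) =
      MvPolynomial.eval (v ∘ e) (MvPolynomial.pderiv j (f i)) := by
    intro v j i
    rw [MvPolynomial.pderiv_rename e.injective, MvPolynomial.eval_rename]
  have hve : ∀ v : Fin s ⊕ ↥((Set.range g)ᶜ) → ℂ, v ≠ 0 → v ∘ e ≠ 0 := by
    intro v hv h
    apply hv
    ext j
    have := congrFun h (e.symm j)
    simpa using this
  have main := core_main (fun i => MvPolynomial.rename e (f i)) d
    (fun i => (hX.homog i).rename_isHomogeneous)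
    (by
      intro v hv hfv c hc
      simp only [MvPolynomial.eval_rename] at hfv
      refine hsm0 (v ∘ e) (hve v hv) hfv c fun j => ?_
      have := hc (e j)
      simpa only [hpd] using this)
    (by
      intro v hv hfv
      simp only [MvPolynomial.eval_rename] at hfv
      obtain ⟨u, hu, hl⟩ := hcov0 (v ∘ e) (hve v hv) hfv
      refine ⟨u ∘ e.symm, fun c hc => hu c ?_, fun a b i => ?_⟩
      · ext j
        have := congrFun hc (e j)
        simpa using this
      · rw [MvPolynomial.eval_rename, ← hl a b i]
        congr 2
        ext j
        simp)
    (P.rep ∘ e.symm)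
    (by
      intro h
      apply hp0
      ext j
      have := congrFun h (e j)
      simpa using this)
    (by
      intro i
      rw [MvPolynomial.eval_rename, ← hp i]
      congr 2
      ext j
      simp)
    (by
      convert hdet using 2
      ext i j
      simp only [Matrix.of_apply]
      rw [← heg, hpd]
      congr 2
      ext j
      simp)
  have hcard := Fintype.card_congr e
  rw [Fintype.card_sum, Fintype.card_fin, Fintype.card_fin] at hcard
  have hsum : ∑ i, d i = ∑ i, (d i - 1) + s := by
    have h1 : ∀ i, d i = (d i - 1) + 1 := fun i => by
      have := hX.two_le_deg i
      omega
    calc ∑ i, d i = ∑ i, ((d i - 1) + 1) := Finset.sum_congr rfl fun i _ => h1 i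
      _ = _ := by rw [Finset.sum_add_distrib]; simp
  omega


end
end
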